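/- Interior derivative bounds for solutions of the model equation with time-dependent source (Lemma 3.6). Let d ≥ 1, δ ∈ (0,1), let a = a(t) satisfy the assumptions of P₀, and let χ : (−4,0) → ℝ be measurable. Let u : (−4,0)×ℝ^{2d} → ℝ be such that for all integers l, m ≥ 0 the classical derivatives D_x^l D_v^m u and ∂_t D_x^l D_v^m u exist, are continuous and locally square-integrable, and suppose P₀u(z) = χ(t) for all z ∈ (−1,0)×ℝ^d×B_1. Then for every j ∈ {0,1} and integers l, m ≥ 0 with j + l + m ≥ 1 there exist θ = θ(d,j,l,m) > 0 and N = N(d,j,l,m) > 0 such that ‖∂_t^j D_x^l D_v^{m+2} u‖_{L∞(Q_{1/2})} ≤ N δ^{−θ} ( ‖D²_v u − (D²_v u)_{Q_1}‖_{L²(Q_1)} + ‖D_x u‖_{L²(Q_1)} ). -/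

import Mathlib

open MeasureTheory ENNReal Set

noncomputable section

/-- Euclidean space `ℝ^d`. -/
abbrev Ed (d : ℕ) : Type := EuclideanSpace ℝ (Fin d)

/-- Points `z = (t, x, v) ∈ ℝ × ℝ^d × ℝ^d`. -/
abbrev Pt (d : ℕ) : Type := ℝ × Ed d × Ed d

/-- The kinetic quasi-distance `ρ(z, z₀)`. -/
def kRho {d : ℕ} (z z0 : Pt d) : ℝ :=
  max (|z.1 - z0.1| ^ ((1 : ℝ)/2))
    (max (‖z.2.1 - z0.2.1 + (z.1 - z0.1) • z0.2.2‖ ^ ((1 : ℝ)/3)) ‖z.2.2 - z0.2.2‖)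

/-- The kinetic Hölder seminorm `[u]_{kC^α(G)}` (extended-real valued). -/
def kSemi {d : ℕ} {F : Type*} [NormedAddCommGroup F] (α : ℝ) (G : Set (Pt d))
    (u : Pt d → F) : ℝ≥0∞ :=
  ⨆ (z : Pt d) (_ : z ∈ G) (z' : Pt d) (_ : z' ∈ G) (_ : z ≠ z'),
    ENNReal.ofReal (‖u z - u z'‖ / kRho z z' ^ α)

/-- The sup (`L_∞`) norm over `G`, extended-real valued. -/
def supNorm {d : ℕ} {F : Type*} [NormedAddCommGroup F] (G : Set (Pt d))
    (u : Pt d → F) : ℝ≥0∞ :=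
  ⨆ (z : Pt d) (_ : z ∈ G), (‖u z‖₊ : ℝ≥0∞)

/-- Anisotropic Hölder seminorm `[w]_{C^{α/3,α}_{x,v}(D)}`. -/
def anisoSemi {d : ℕ} {F : Type*} [NormedAddCommGroup F] (α : ℝ) (D : Set (Ed d × Ed d))
    (w : Ed d × Ed d → F) : ℝ≥0∞ :=
  ⨆ (p : Ed d × Ed d) (_ : p ∈ D) (q : Ed d × Ed d) (_ : q ∈ D) (_ : p ≠ q),
    ENNReal.ofReal (‖w p - w q‖ / (‖p.1 - q.1‖ ^ ((1 : ℝ)/3) + ‖p.2 - q.2‖) ^ α)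

/-- The `L_∞ C^{α/3,α}_{x,v}` seminorm over `I × D`. -/
def lixvSemi {d : ℕ} {F : Type*} [NormedAddCommGroup F] (α : ℝ) (I : Set ℝ)
    (D : Set (Ed d × Ed d)) (u : Pt d → F) : ℝ≥0∞ :=
  ⨆ (t : ℝ) (_ : t ∈ I), anisoSemi α D (fun p => u (t, p.1, p.2))

/-- The time interval `(−∞, T)` for `T ∈ (−∞, ∞]`. -/
def slabI (T : EReal) : Set ℝ := {t : ℝ | (t : EReal) < T}

/-- The set `ℝ^{1+2d}_T = (−∞,T) × ℝ^{2d}`. -/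
def slabG (d : ℕ) (T : EReal) : Set (Pt d) := slabI T ×ˢ (Set.univ : Set (Ed d × Ed d))

/-- Classical time derivative `∂_t u`. -/
def Dt {d : ℕ} (u : Pt d → ℝ) (z : Pt d) : ℝ := deriv (fun s => u (s, z.2.1, z.2.2)) z.1

/-- Classical spatial gradient `D_x u`. -/
def Dx {d : ℕ} (u : Pt d → ℝ) (z : Pt d) : Ed d →L[ℝ] ℝ :=
  fderiv ℝ (fun y => u (z.1, y, z.2.2)) z.2.1

/-- Classical velocity gradient `D_v u`. -/
def Dv {d : ℕ} (u : Pt d → ℝ) (z : Pt d) : Ed d →L[ℝ] ℝ :=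
  fderiv ℝ (fun w => u (z.1, z.2.1, w)) z.2.2

/-- Classical velocity Hessian `D²_v u`. -/
def Dvv {d : ℕ} (u : Pt d → ℝ) (z : Pt d) : Ed d →L[ℝ] Ed d →L[ℝ] ℝ :=
  fderiv ℝ (fun w => Dv u (z.1, z.2.1, w)) z.2.2

/-- Transport term `Y u = ∂_t u − v · D_x u`. -/
def Yop {d : ℕ} (u : Pt d → ℝ) (z : Pt d) : ℝ := Dt u z - Dx u z z.2.2

/-- Contraction `a^{ij} B_{ij}`. -/
def contr2 {d : ℕ} (A : Matrix (Fin d) (Fin d) ℝ) (B : Ed d →L[ℝ] Ed d →L[ℝ] ℝ) : ℝ :=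
  ∑ i, ∑ j, A i j * B (EuclideanSpace.single i 1) (EuclideanSpace.single j 1)

/-- KFP operator `P u = ∂_t u − v·D_x u − a^{ij}(z) D_{v_iv_j} u`. -/
def Pop {d : ℕ} (a : Pt d → Matrix (Fin d) (Fin d) ℝ) (u : Pt d → ℝ) (z : Pt d) : ℝ :=
  Yop u z - contr2 (a z) (Dvv u z)

/-- Model KFP operator with `a = a(t)`. -/
def P0op {d : ℕ} (a : ℝ → Matrix (Fin d) (Fin d) ℝ) (u : Pt d → ℝ) (z : Pt d) : ℝ :=
  Yop u z - contr2 (a z.1) (Dvv u z)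

/-- Laplacian in the velocity variable `Δ_v u`. -/
def lapV {d : ℕ} (u : Pt d → ℝ) (z : Pt d) : ℝ :=
  ∑ i, Dvv u z (EuclideanSpace.single i 1) (EuclideanSpace.single i 1)

/-- Fractional Laplacian `(−Δ_x)^{1/3} u`, pointwise integral formula with constant `cd`. -/
def fracLap {d : ℕ} (cd : ℝ) (u : Pt d → ℝ) (z : Pt d) : ℝ :=
  cd * ∫ y : Ed d, (u z - u (z.1, z.2.1 + y, z.2.2)) / ‖y‖ ^ ((d : ℝ) + 2/3)

/-- Hölder seminorm in `x` of a function on `ℝ^d`. -/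
def xSemi {d : ℕ} (β : ℝ) (w : Ed d → ℝ) : ℝ≥0∞ :=
  ⨆ (x : Ed d) (x' : Ed d) (_ : x ≠ x'), ENNReal.ofReal (|w x - w x'| / ‖x - x'‖ ^ β)

/-- `sup_{t ∈ I, v} [u(t,·,v)]_{C^β(ℝ^d)}`. -/
def supXSemi {d : ℕ} (β : ℝ) (I : Set ℝ) (u : Pt d → ℝ) : ℝ≥0∞ :=
  ⨆ (t : ℝ) (_ : t ∈ I) (v : Ed d), xSemi β (fun x => u (t, x, v))

/-- Hölder norm in `x` over a set `A ⊂ ℝ^d`. -/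
def xHolderNorm {d : ℕ} (β : ℝ) (A : Set (Ed d)) (w : Ed d → ℝ) : ℝ≥0∞ :=
  (⨆ (x : Ed d) (_ : x ∈ A), ENNReal.ofReal |w x|) +
    ⨆ (x : Ed d) (_ : x ∈ A) (x' : Ed d) (_ : x' ∈ A) (_ : x ≠ x'),
      ENNReal.ofReal (|w x - w x'| / ‖x - x'‖ ^ β)

/-- Kinetic cylinder `Q_{r,s}(z₀)` (`v`-radius `r`, `x`-radius `s³`). -/
def kCyl {d : ℕ} (r s : ℝ) (z0 : Pt d) : Set (Pt d) :=
  {z : Pt d | z0.1 - r ^ 2 < z.1 ∧ z.1 < z0.1 ∧ ‖z.2.2 - z0.2.2‖ < r ∧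
    ‖z.2.1 - z0.2.1 + (z.1 - z0.1) • z0.2.2‖ < s ^ 3}

/-- Kinetic cylinder `Q_r(z₀)`. -/
def kQ {d : ℕ} (r : ℝ) (z0 : Pt d) : Set (Pt d) := kCyl r r z0

/-- The origin of `ℝ^{1+2d}`. -/
def ptO (d : ℕ) : Pt d := (0, 0, 0)

/-- Mean-square average `(|g|²)^{1/2}_A`. -/
def msq {d : ℕ} {F : Type*} [NormedAddCommGroup F] (A : Set (Pt d)) (g : Pt d → F) : ℝ :=
  Real.sqrt (⨍ z in A, ‖g z‖ ^ 2)

/-- Average `(g)_A`. -/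
def avg {d : ℕ} {F : Type*} [NormedAddCommGroup F] [NormedSpace ℝ F] (A : Set (Pt d))
    (g : Pt d → F) : F :=
  ⨍ z in A, g z

/-- Mean-square oscillation `(|g − (g)_A|²)^{1/2}_A`. -/
def oscL2 {d : ℕ} {F : Type*} [NormedAddCommGroup F] [NormedSpace ℝ F] (A : Set (Pt d))
    (g : Pt d → F) : ℝ :=
  msq A (fun z => g z - avg A g)

/-- `L²` norm over `A`. -/
def l2 {d : ℕ} {F : Type*} [NormedAddCommGroup F] (A : Set (Pt d)) (g : Pt d → F) : ℝ :=
  Real.sqrt (∫ z in A, ‖g z‖ ^ 2)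

/-- Membership in the kinetic Hölder space `kC^{2,α}(I × D)`:
`u ∈ kC^α`, the classical derivatives `D_v u`, `D²_v u`, `Y u` exist,
`Y u ∈ L_∞ C^{α/3,α}_{x,v}` and `[D²_v u]_{kC^α} < ∞`. -/
def kC2mem {d : ℕ} (α : ℝ) (I : Set ℝ) (D : Set (Ed d × Ed d)) (u : Pt d → ℝ) : Prop :=
  supNorm (I ×ˢ D) u < ⊤ ∧ kSemi α (I ×ˢ D) u < ⊤ ∧
  (∀ z ∈ I ×ˢ D, DifferentiableAt ℝ (fun s => u (s, z.2.1, z.2.2)) z.1) ∧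
  (∀ z ∈ I ×ˢ D, DifferentiableAt ℝ (fun y => u (z.1, y, z.2.2)) z.2.1) ∧
  (∀ z ∈ I ×ˢ D, DifferentiableAt ℝ (fun w => u (z.1, z.2.1, w)) z.2.2) ∧
  (∀ z ∈ I ×ˢ D, DifferentiableAt ℝ (fun w => Dv u (z.1, z.2.1, w)) z.2.2) ∧
  supNorm (I ×ˢ D) (Yop u) < ⊤ ∧
  lixvSemi α I D (Yop u) < ⊤ ∧
  kSemi α (I ×ˢ D) (Dvv u) < ⊤

/-- Membership in the anisotropic Hölder space `ℂ^{2,α}(I × D)`: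
the classical derivatives `D_v u`, `D²_v u`, `Y u` exist and
`u, D_v u, D²_v u, Y u ∈ L_∞ C^{α/3,α}_{x,v}(I × D)`. -/
def C2mem {d : ℕ} (α : ℝ) (I : Set ℝ) (D : Set (Ed d × Ed d)) (u : Pt d → ℝ) : Prop :=
  (∀ z ∈ I ×ˢ D, DifferentiableAt ℝ (fun s => u (s, z.2.1, z.2.2)) z.1) ∧
  (∀ z ∈ I ×ˢ D, DifferentiableAt ℝ (fun y => u (z.1, y, z.2.2)) z.2.1) ∧
  (∀ z ∈ I ×ˢ D, DifferentiableAt ℝ (fun w => u (z.1, z.2.1, w)) z.2.2) ∧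
  (∀ z ∈ I ×ˢ D, DifferentiableAt ℝ (fun w => Dv u (z.1, z.2.1, w)) z.2.2) ∧
  supNorm (I ×ˢ D) u < ⊤ ∧ lixvSemi α I D u < ⊤ ∧
  supNorm (I ×ˢ D) (Dv u) < ⊤ ∧ lixvSemi α I D (Dv u) < ⊤ ∧
  supNorm (I ×ˢ D) (Dvv u) < ⊤ ∧ lixvSemi α I D (Dvv u) < ⊤ ∧
  supNorm (I ×ˢ D) (Yop u) < ⊤ ∧ lixvSemi α I D (Yop u) < ⊤

/-- Ellipticity and boundedness of a coefficient matrix: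
`a^{ij} ξ_i ξ_j ≥ δ|ξ|²` and `|a| ≤ δ⁻¹`. -/
def elliptic {d : ℕ} (δ : ℝ) (A : Matrix (Fin d) (Fin d) ℝ) : Prop :=
  (∀ ξ : Ed d, δ * ‖ξ‖ ^ 2 ≤ ∑ i, ∑ j, A i j * ξ i * ξ j) ∧ (∀ i j, |A i j| ≤ δ⁻¹)

/-- Iterated classical mixed derivative `D_v^m D_x^l u`. -/
def Dmix {d : ℕ} (l m : ℕ) (u : Pt d → ℝ) (z : Pt d) :
    ContinuousMultilinearMap ℝ (fun _ : Fin m => Ed d)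
      (ContinuousMultilinearMap ℝ (fun _ : Fin l => Ed d) ℝ) :=
  iteratedFDeriv ℝ m (fun w => iteratedFDeriv ℝ l (fun y => u (z.1, y, w)) z.2.1) z.2.2

/-- Time derivative of the mixed derivative: `∂_t D_x^l D_v^m u`. -/
def DtMix {d : ℕ} (l m : ℕ) (u : Pt d → ℝ) (z : Pt d) :
    ContinuousMultilinearMap ℝ (fun _ : Fin m => Ed d)
      (ContinuousMultilinearMap ℝ (fun _ : Fin l => Ed d) ℝ) :=
  deriv (fun s => Dmix l m u (s, z.2.1, z.2.2)) z.1

/-- `∂_t` for functions of `(t,v)`. -/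
def Dt2 {d : ℕ} (w : ℝ × Ed d → ℝ) (t : ℝ) (v : Ed d) : ℝ := deriv (fun s => w (s, v)) t

/-- `D_v` for functions of `(t,v)`. -/
def Dv2 {d : ℕ} (w : ℝ × Ed d → ℝ) (t : ℝ) (v : Ed d) : Ed d →L[ℝ] ℝ :=
  fderiv ℝ (fun y => w (t, y)) v

/-- `D²_v` for functions of `(t,v)`. -/
def Dvv2 {d : ℕ} (w : ℝ × Ed d → ℝ) (t : ℝ) (v : Ed d) : Ed d →L[ℝ] Ed d →L[ℝ] ℝ :=
  fderiv ℝ (fun y => Dv2 w t y) v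

/-- The kinetic scaling `z ↦ z̃ = (r²t + t₀, r³x + x₀ − r²t v₀, rv + v₀)`. -/
def kScale {d : ℕ} (r : ℝ) (z0 z : Pt d) : Pt d :=
  (r ^ 2 * z.1 + z0.1, (r ^ 3) • z.2.1 + z0.2.1 - (r ^ 2 * z.1) • z0.2.2, r • z.2.2 + z0.2.2)

/-- Kinetic Campanato seminorm. -/
def campSemi {d : ℕ} (α : ℝ) (T : EReal) (u : Pt d → ℝ) : ℝ≥0∞ :=
  ⨆ (r : ℝ) (_ : 0 < r) (z0 : Pt d) (_ : (z0.1 : EReal) ≤ T),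
    ENNReal.ofReal (oscL2 (kQ r z0) u / r ^ α)

end

open MeasureTheory ENNReal Set

namespace Kinetic

/-- Phase space `ℝ^d × ℝ^d` with points `p = (x, v)`. -/
abbrev Phase (d : ℕ) : Type := Ed d × Ed d

/-- Coordinate directions in phase space: `inl i` is `x_i`, `inr i` is `v_i`. -/
abbrev Dir (d : ℕ) : Type := Fin d ⊕ Fin d

/-- The coordinate basis vector of phase space in a given direction. -/
noncomputable def basisVec {d : ℕ} : Dir d → Phase d :=
  Sum.elim (fun i => (EuclideanSpace.single i 1, 0)) (fun i => (0, EuclideanSpace.single i 1))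

/-- Partial derivative in a coordinate direction. -/
noncomputable def pd {d : ℕ} (e : Dir d) (f : Phase d → ℝ) (p : Phase d) : ℝ :=
  fderiv ℝ f p (basisVec e)

/-- Iterated partial derivative along a list of directions, the head being outermost. -/
noncomputable def pdList {d : ℕ} : List (Dir d) → (Phase d → ℝ) → Phase d → ℝ
  | [], f => f
  | e :: L, f => pd e (pdList L f)

/-- Smooth functions on phase space. -/
abbrev Smooth {d : ℕ} (f : Phase d → ℝ) : Prop := ContDiff ℝ (⊤ : ℕ∞) f

variable {d : ℕ}

lemma Smooth.differentiable {f : Phase d → ℝ} (hf : Smooth f) : Differentiable ℝ f :=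
  ContDiff.differentiable hf (by simp)

lemma Smooth.pd {f : Phase d → ℝ} (hf : Smooth f) (e : Dir d) : Smooth (pd e f) := by
  have h : ContDiff ℝ (⊤ : ℕ∞) (fderiv ℝ f) := hf.fderiv_right (by simp)
  exact h.clm_apply contDiff_const

lemma Smooth.pdList {f : Phase d → ℝ} (hf : Smooth f) (L : List (Dir d)) :
    Smooth (pdList L f) := by
  induction L with
  | nil => exact hf
  | cons e L ih => exact ih.pd e

lemma pd_add {f g : Phase d → ℝ} (hf : Smooth f) (hg : Smooth g) (e : Dir d) :
    pd e (fun p => f p + g p) = fun p => pd e f p + pd e g p := by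
  funext p
  simp [pd, fderiv_fun_add (hf.differentiable p) (hg.differentiable p)]

lemma pd_mul {f g : Phase d → ℝ} (hf : Smooth f) (hg : Smooth g) (e : Dir d) :
    pd e (fun p => f p * g p) = fun p => pd e f p * g p + f p * pd e g p := by
  funext p
  simp [pd, fderiv_fun_mul (hf.differentiable p) (hg.differentiable p)]
  ring

lemma pd_const_mul (c : ℝ) {f : Phase d → ℝ} (hf : Smooth f) (e : Dir d) :
    pd e (fun p => c * f p) = fun p => c * pd e f p := by
  funext p
  simp [pd, fderiv_const_mul (hf.differentiable p)]

lemma pd_const (c : ℝ) (e : Dir d) : pd e (fun _ : Phase d => c) = fun _ => 0 := by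
  funext p
  simp [pd]

lemma pd_sum {ι : Type*} (s : Finset ι) {f : ι → Phase d → ℝ} (hf : ∀ i, Smooth (f i))
    (e : Dir d) : pd e (fun p => ∑ i ∈ s, f i p) = fun p => ∑ i ∈ s, pd e (f i) p := by
  funext p
  simp only [pd]
  rw [fderiv_fun_sum (fun i _ => (hf i).differentiable p)]
  simp

lemma pd_comm {f : Phase d → ℝ} (hf : Smooth f) (e e' : Dir d) :
    pd e (pd e' f) = pd e' (pd e f) := by
  have hd : Differentiable ℝ (fderiv ℝ f) :=
    (hf.fderiv_right (m := (⊤ : ℕ∞)) (by simp)).differentiable (by simp)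
  have key : ∀ (e e' : Dir d) (p : Phase d),
      pd e (pd e' f) p = fderiv ℝ (fderiv ℝ f) p (basisVec e) (basisVec e') := by
    intro e e' p
    change fderiv ℝ (fun q => fderiv ℝ f q (basisVec e')) p (basisVec e) = _
    rw [fderiv_clm_apply (hd p) (differentiableAt_const _)]
    simp
  funext p
  rw [key, key]
  have := (hf.contDiffAt (x := p)).isSymmSndFDerivAt
    (by
      simp only [minSmoothness_of_isRCLikeNormedField]
      exact WithTop.coe_le_coe.2 (le_top : (2 : ℕ∞) ≤ ⊤))
  exact this.eq _ _

lemma pdList_append (L L' : List (Dir d)) (f : Phase d → ℝ) :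
    pdList (L ++ L') f = pdList L (pdList L' f) := by
  induction L with
  | nil => rfl
  | cons e L ih => simp [pdList, ih]

lemma pdList_perm {L L' : List (Dir d)} (h : L.Perm L') {f : Phase d → ℝ} (hf : Smooth f) :
    pdList L f = pdList L' f := by
  induction h with
  | nil => rfl
  | cons e _ ih => simp [pdList, ih]
  | swap e e' L => exact pd_comm (hf.pdList L) e' e
  | trans _ _ ih ih' => rw [ih, ih']

lemma pdList_const (c : ℝ) {L : List (Dir d)} (hL : L ≠ []) :
    pdList L (fun _ : Phase d => c) = fun _ => 0 := by
  induction L with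
  | nil => exact absurd rfl hL
  | cons e L ih =>
    by_cases h : L = []
    · subst h; exact pd_const c e
    · simp only [pdList, ih h]; exact pd_const 0 e

lemma pdList_add {f g : Phase d → ℝ} (hf : Smooth f) (hg : Smooth g) (L : List (Dir d)) :
    pdList L (fun p => f p + g p) = fun p => pdList L f p + pdList L g p := by
  induction L with
  | nil => rfl
  | cons e L ih => simp only [pdList, ih]; exact pd_add (hf.pdList L) (hg.pdList L) e

lemma pd_congr_of_eventuallyEq {f g : Phase d → ℝ} {p : Phase d} (h : f =ᶠ[nhds p] g)
    (e : Dir d) : pd e f p = pd e g p := by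
  simp only [pd, h.fderiv_eq]

lemma pd_eq_zero_of_support {f : Phase d → ℝ} {K : Set (Phase d)} (hK : IsClosed K)
    (hf : ∀ p ∉ K, f p = 0) (e : Dir d) : ∀ p ∉ K, pd e f p = 0 := by
  intro p hp
  have : f =ᶠ[nhds p] fun _ => 0 := by
    filter_upwards [hK.isOpen_compl.mem_nhds hp] with q hq using hf q hq
  rw [pd_congr_of_eventuallyEq this, pd_const]

lemma pd_velocity (e : Dir d) (i : Fin d) :
    pd e (fun p : Phase d => p.2 i) = fun _ => if e = Sum.inr i then 1 else 0 := by
  funext p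
  have h : HasFDerivAt (fun p : Phase d => p.2 i)
      ((EuclideanSpace.proj i : Ed d →L[ℝ] ℝ).comp (ContinuousLinearMap.snd ℝ (Ed d) (Ed d))) p :=
    ((EuclideanSpace.proj i : Ed d →L[ℝ] ℝ).comp
      (ContinuousLinearMap.snd ℝ (Ed d) (Ed d))).hasFDerivAt
  rw [pd, h.fderiv]
  rcases e with k | k
  · simp [basisVec]
  · by_cases hk : k = i
    · simp [basisVec, hk]
    · simp [basisVec, hk, Ne.symm hk]

lemma smooth_velocity (i : Fin d) : Smooth (fun p : Phase d => p.2 i) :=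
  ((EuclideanSpace.proj i : Ed d →L[ℝ] ℝ).comp
      (ContinuousLinearMap.snd ℝ (Ed d) (Ed d))).contDiff

/-- The transport term `v · D_x f`. -/
noncomputable def transport (f : Phase d → ℝ) (p : Phase d) : ℝ :=
  ∑ i, p.2 i * pd (Sum.inl i) f p

/-- The diffusion term `A^{ij} D_{v_i v_j} f`. -/
noncomputable def diffusion (A : Matrix (Fin d) (Fin d) ℝ) (f : Phase d → ℝ) (p : Phase d) : ℝ :=
  ∑ i, ∑ j, A i j * pd (Sum.inr i) (pd (Sum.inr j) f) p

/-- The velocity form `A^{ij} D_{v_i} f D_{v_j} g`. -/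
noncomputable def velForm (A : Matrix (Fin d) (Fin d) ℝ) (f g : Phase d → ℝ) (p : Phase d) : ℝ :=
  ∑ i, ∑ j, A i j * pd (Sum.inr i) f p * pd (Sum.inr j) g p

lemma Smooth.transport {f : Phase d → ℝ} (hf : Smooth f) : Smooth (transport f) :=
  ContDiff.sum fun i _ => (smooth_velocity i).mul (hf.pd _)

lemma Smooth.diffusion {f : Phase d → ℝ} (hf : Smooth f) (A : Matrix (Fin d) (Fin d) ℝ) :
    Smooth (diffusion A f) :=
  ContDiff.sum fun _ _ => ContDiff.sum fun _ _ => contDiff_const.mul ((hf.pd _).pd _)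

lemma Smooth.velForm {f g : Phase d → ℝ} (hf : Smooth f) (hg : Smooth g)
    (A : Matrix (Fin d) (Fin d) ℝ) : Smooth (velForm A f g) :=
  ContDiff.sum fun _ _ => ContDiff.sum fun _ _ => (contDiff_const.mul (hf.pd _)).mul (hg.pd _)

lemma pd_diffusion {f : Phase d → ℝ} (hf : Smooth f) (A : Matrix (Fin d) (Fin d) ℝ) (e : Dir d) :
    pd e (diffusion A f) = diffusion A (pd e f) := by
  funext p
  unfold diffusion
  rw [pd_sum]
  · refine Finset.sum_congr rfl fun i _ => ?_
    rw [pd_sum]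
    · refine Finset.sum_congr rfl fun j _ => ?_
      rw [pd_const_mul _ ((hf.pd _).pd _), pd_comm (hf.pd _), pd_comm hf]
    · exact fun j => contDiff_const.mul ((hf.pd _).pd _)
  · exact fun i => ContDiff.sum fun j _ => contDiff_const.mul ((hf.pd _).pd _)

lemma pd_transport {f : Phase d → ℝ} (hf : Smooth f) (e : Dir d) (p : Phase d) :
    pd e (transport f) p = transport (pd e f) p +
      ∑ i, (if e = Sum.inr i then pd (Sum.inl i) f p else 0) := by
  unfold transport
  rw [pd_sum]
  · simp only
    rw [← Finset.sum_add_distrib]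
    refine Finset.sum_congr rfl fun i _ => ?_
    rw [pd_mul (smooth_velocity i) (hf.pd _), pd_velocity, pd_comm hf]
    split_ifs <;> simp [add_comm]
  · exact fun i => (smooth_velocity i).mul (hf.pd _)

lemma transport_mul {f g : Phase d → ℝ} (hf : Smooth f) (hg : Smooth g) (p : Phase d) :
    transport (fun p => f p * g p) p = transport f p * g p + f p * transport g p := by
  simp only [transport, pd_mul hf hg, Finset.sum_mul, Finset.mul_sum, ← Finset.sum_add_distrib]
  exact Finset.sum_congr rfl fun i _ => by ring

lemma velForm_mul_left {f g h : Phase d → ℝ} (hf : Smooth f) (hg : Smooth g)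
    (A : Matrix (Fin d) (Fin d) ℝ) (p : Phase d) :
    velForm A (fun p => f p * g p) h p = g p * velForm A f h p + f p * velForm A g h p := by
  simp only [velForm, pd_mul hf hg, Finset.mul_sum, ← Finset.sum_add_distrib]
  exact Finset.sum_congr rfl fun i _ => Finset.sum_congr rfl fun j _ => by ring

/-- The divergence form `D_{v_i} (A^{ij} ψ D_{v_j} g)`. -/
noncomputable def divDiffusion (A : Matrix (Fin d) (Fin d) ℝ) (ψ g : Phase d → ℝ) (p : Phase d) :
    ℝ :=
  ∑ i, ∑ j, A i j * pd (Sum.inr i) (fun q => ψ q * pd (Sum.inr j) g q) p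

lemma divDiffusion_eq {ψ g : Phase d → ℝ} (hψ : Smooth ψ) (hg : Smooth g)
    (A : Matrix (Fin d) (Fin d) ℝ) (p : Phase d) :
    divDiffusion A ψ g p = ψ p * diffusion A g p + velForm A ψ g p := by
  simp only [divDiffusion, diffusion, velForm, Finset.mul_sum, ← Finset.sum_add_distrib]
  refine Finset.sum_congr rfl fun i _ => Finset.sum_congr rfl fun j _ => ?_
  rw [pd_mul hψ (hg.pd _)]
  ring

instance isAddHaarMeasure_volume : (volume : Measure (Phase d)).IsAddHaarMeasure :=
  Measure.prod.instIsAddHaarMeasure (volume : Measure (Ed d)) (volume : Measure (Ed d))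

lemma integrableOn_ball {f : Phase d → ℝ} (hf : Continuous f) (R : ℝ) :
    IntegrableOn f (Metric.closedBall 0 R) :=
  hf.continuousOn.integrableOn_compact (isCompact_closedBall _ _)

lemma setIntegral_pd_eq_zero {F : Phase d → ℝ} (hF : Smooth F) {R : ℝ}
    (h0 : ∀ p ∉ Metric.closedBall (0 : Phase d) R, F p = 0) (e : Dir d) :
    ∫ p in Metric.closedBall (0 : Phase d) R, pd e F p = 0 := by
  rw [setIntegral_eq_integral_of_forall_compl_eq_zero
    (pd_eq_zero_of_support Metric.isClosed_closedBall h0 e)]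
  have hc : HasCompactSupport F := HasCompactSupport.intro (isCompact_closedBall 0 R) h0
  have hc' : HasCompactSupport (pd e F) := HasCompactSupport.intro (isCompact_closedBall 0 R)
    (pd_eq_zero_of_support Metric.isClosed_closedBall h0 e)
  have := integral_mul_fderiv_eq_neg_fderiv_mul_of_integrable (μ := volume)
    (f := fun _ : Phase d => (1 : ℝ)) (g := F) (v := basisVec e) (by simp)
    (by simp only [one_mul]
        exact (hF.pd e).continuous.integrable_of_hasCompactSupport hc')
    (by simpa using hF.continuous.integrable_of_hasCompactSupport hc)
    (fun _ _ => differentiableAt_const _) (fun p _ => hF.differentiable p)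
  simpa [pd] using this

lemma setIntegral_transport_eq_zero {F : Phase d → ℝ} (hF : Smooth F) {R : ℝ}
    (h0 : ∀ p ∉ Metric.closedBall (0 : Phase d) R, F p = 0) :
    ∫ p in Metric.closedBall (0 : Phase d) R, transport F p = 0 := by
  have : transport F = fun p => ∑ i, pd (Sum.inl i) (fun q => q.2 i * F q) p := by
    funext p
    refine Finset.sum_congr rfl fun i _ => ?_
    rw [pd_mul (smooth_velocity i) hF, pd_velocity]
    simp
  rw [this, integral_finsetSum]
  · refine Finset.sum_eq_zero fun i _ => setIntegral_pd_eq_zero ((smooth_velocity i).mul hF) ?_ _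
    intro p hp
    simp [h0 p hp]
  · exact fun i _ => integrableOn_ball (Smooth.pd ((smooth_velocity i).mul hF) _).continuous R

lemma setIntegral_divDiffusion_eq_zero {ψ g : Phase d → ℝ} (hψ : Smooth ψ) (hg : Smooth g) {R : ℝ}
    (h0 : ∀ p ∉ Metric.closedBall (0 : Phase d) R, ψ p = 0) (A : Matrix (Fin d) (Fin d) ℝ) :
    ∫ p in Metric.closedBall (0 : Phase d) R, divDiffusion A ψ g p = 0 := by
  unfold divDiffusion
  have hs : ∀ i j, Smooth (fun p => A i j * pd (Sum.inr i) (fun q => ψ q * pd (Sum.inr j) g q) p) :=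
    fun i j => contDiff_const.mul (Smooth.pd (hψ.mul (hg.pd _)) _)
  rw [integral_finsetSum]
  · refine Finset.sum_eq_zero fun i _ => ?_
    rw [integral_finsetSum _ fun j _ => integrableOn_ball (hs i j).continuous R]
    refine Finset.sum_eq_zero fun j _ => ?_
    rw [integral_const_mul, setIntegral_pd_eq_zero (hψ.mul (hg.pd _)), mul_zero]
    intro p hp
    simp [h0 p hp]
  · exact fun i _ => integrableOn_ball (ContDiff.sum fun j _ => hs i j).continuous R

/-- Bilinear energy identity at a fixed time for `g' = v·D_x g + A D²_v g + f` and
`h' = v·D_x h + A D²_v h + k`, localized by `ψ`. -/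
lemma energy_identity (A : Matrix (Fin d) (Fin d) ℝ) {R : ℝ} {ψ ψ' g g' f h h' k : Phase d → ℝ}
    (hψ : Smooth ψ) (hg : Smooth g) (hh : Smooth h) (hψ' : Continuous ψ')
    (hf : Continuous f) (hk : Continuous k)
    (h0 : ∀ p ∉ Metric.closedBall (0 : Phase d) R, ψ p = 0)
    (eg : ∀ p, ψ p ≠ 0 → g' p = transport g p + diffusion A g p + f p)
    (eh : ∀ p, ψ p ≠ 0 → h' p = transport h p + diffusion A h p + k p) :
    ∫ p in Metric.closedBall (0 : Phase d) R, (ψ' p * g p * h p + ψ p * g' p * h p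
        + ψ p * g p * h' p) =
      ∫ p in Metric.closedBall (0 : Phase d) R, ((ψ' p - transport ψ p) * g p * h p
        + ψ p * (f p * h p + k p * g p) - ψ p * (velForm A h g p + velForm A g h p)
        - h p * velForm A ψ g p - g p * velForm A ψ h p) := by
  have hψg : Smooth fun p => ψ p * g p := hψ.mul hg
  have hψh : Smooth fun p => ψ p * h p := hψ.mul hh
  have hψgh : Smooth fun p => ψ p * g p * h p := hψg.mul hh
  have e : ∀ p, ψ' p * g p * h p + ψ p * g' p * h p + ψ p * g p * h' p =
      ((ψ' p - transport ψ p) * g p * h p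
        + ψ p * (f p * h p + k p * g p) - ψ p * (velForm A h g p + velForm A g h p)
        - h p * velForm A ψ g p - g p * velForm A ψ h p) +
      (transport (fun p => ψ p * g p * h p) p + (divDiffusion A (fun p => ψ p * h p) g p
        + divDiffusion A (fun p => ψ p * g p) h p)) := by
    intro p
    rw [divDiffusion_eq hψh hg, divDiffusion_eq hψg hh, velForm_mul_left hψ hh,
      velForm_mul_left hψ hg, transport_mul hψg hh, transport_mul hψ hg]
    by_cases hp : ψ p = 0
    · simp only [hp]; ring
    · rw [eg p hp, eh p hp]; ring
  have hT : Continuous (transport fun p => ψ p * g p * h p) := (Smooth.transport hψgh).continuous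
  have hD : ∀ {ψ g : Phase d → ℝ}, Smooth ψ → Smooth g → Continuous (divDiffusion A ψ g) := by
    intro ψ g hψ hg
    have : divDiffusion A ψ g = fun p => ψ p * diffusion A g p + velForm A ψ g p :=
      funext fun p => divDiffusion_eq hψ hg A p
    rw [this]
    exact (hψ.continuous.mul (hg.diffusion A).continuous).add (hψ.velForm hg A).continuous
  simp_rw [e]
  rw [integral_add, integral_add, integral_add, setIntegral_transport_eq_zero hψgh,
    setIntegral_divDiffusion_eq_zero hψh hg, setIntegral_divDiffusion_eq_zero hψg hh]
  · simp
  · intro p hp; simp [h0 p hp]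
  · intro p hp; simp [h0 p hp]
  · intro p hp; simp [h0 p hp]
  · exact integrableOn_ball (hD hψh hg) R
  · exact integrableOn_ball (hD hψg hh) R
  · exact integrableOn_ball hT R
  · exact (integrableOn_ball (hD hψh hg) R).add (integrableOn_ball (hD hψg hh) R)
  · refine integrableOn_ball ?_ R
    have := hψ.transport.continuous
    have := (hψ.velForm hg A).continuous
    have := (hψ.velForm hh A).continuous
    have := (hg.velForm hh A).continuous
    have := (hh.velForm hg A).continuous
    have := hψ.continuous
    have := hg.continuous
    have := hh.continuous
    fun_prop
  · exact (integrableOn_ball hT R).add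
      ((integrableOn_ball (hD hψh hg) R).add (integrableOn_ball (hD hψg hh) R))

lemma hasDerivAt_setIntegral {X : Type*} [TopologicalSpace X] [SecondCountableTopology X]
    [MeasurableSpace X] [OpensMeasurableSpace X]
    {μ : Measure X} [IsFiniteMeasureOnCompacts μ] {K S : Set X} (hK : IsCompact K)
    (hS : MeasurableSet S) (hSK : S ⊆ K) {I : Set ℝ} (hI : IsOpen I) {F F' : ℝ → X → ℝ}
    (hF : ∀ t ∈ I, Continuous (F t))
    (hF' : ContinuousOn (fun z : ℝ × X => F' z.1 z.2) (I ×ˢ univ))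
    (hd : ∀ t ∈ I, ∀ x, HasDerivAt (fun s => F s x) (F' t x) t) {t : ℝ} (ht : t ∈ I) :
    HasDerivAt (fun s => ∫ x in S, F s x ∂μ) (∫ x in S, F' t x ∂μ) t := by
  obtain ⟨ε, hε, hball⟩ := Metric.nhds_basis_closedBall.mem_iff.1 (hI.mem_nhds ht)
  have hcomp : IsCompact (Metric.closedBall t ε ×ˢ K) := (isCompact_closedBall t ε).prod hK
  obtain ⟨C, hC⟩ := hcomp.exists_bound_of_continuousOn
    (hF'.mono (prod_mono hball (subset_univ K)))
  have hfin : μ S ≠ ⊤ := ((measure_mono hSK).trans_lt hK.measure_lt_top).ne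
  obtain ⟨C', hC'⟩ := hK.exists_bound_of_continuousOn (hF t ht).continuousOn
  have hF't : Continuous (F' t) := by
    rw [← continuousOn_univ]
    exact hF'.comp (f := fun x => (t, x)) (by fun_prop) fun x _ => ⟨ht, mem_univ _⟩
  refine (hasDerivAt_integral_of_dominated_loc_of_deriv_le (bound := fun _ => C)
    (Metric.closedBall_mem_nhds t hε) ?_ ?_ hF't.aestronglyMeasurable ?_ ?_ ?_).2
  · filter_upwards [hI.mem_nhds ht] with s hs using (hF s hs).aestronglyMeasurable
  · refine IntegrableOn.of_bound hfin.lt_top (hF t ht).aestronglyMeasurable C' ?_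
    exact (ae_restrict_iff' hS).2 (Filter.Eventually.of_forall fun x hx => hC' x (hSK hx))
  · exact (ae_restrict_iff' hS).2 (Filter.Eventually.of_forall fun x hx s hs =>
      hC (s, x) ⟨hs, hSK hx⟩)
  · exact integrableOn_const hfin
  · exact Filter.Eventually.of_forall fun x s hs => hd s (hball hs) x

lemma continuousOn_setIntegral {X : Type*} [TopologicalSpace X] [SecondCountableTopology X]
    [MeasurableSpace X] [OpensMeasurableSpace X]
    {μ : Measure X} [IsLocallyFiniteMeasure μ] {K : Set X} (hK : IsCompact K)
    {I : Set ℝ} (hI : IsOpen I) {F : ℝ → X → ℝ}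
    (hF : ContinuousOn (fun z : ℝ × X => F z.1 z.2) (I ×ˢ univ)) :
    ContinuousOn (fun t => ∫ x in K, F t x ∂μ) I := by
  rw [continuousOn_iff_continuous_domRestrict]
  have := hI.locallyCompactSpace
  refine continuous_parametric_integral_of_continuous (f := fun (t : I) x => F t x) ?_ hK
  rw [← continuousOn_univ]
  exact hF.comp (f := fun z : I × X => ((z.1 : ℝ), z.2)) (by fun_prop)
    fun z _ => ⟨z.1.2, mem_univ _⟩

/-- The time interval of the unit cylinder. -/
abbrev timeI : Set ℝ := Ioo (-1 : ℝ) 0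

/-- Time derivative of a function of `(t, p)`. -/
noncomputable def dt (G : ℝ → Phase d → ℝ) (t : ℝ) (p : Phase d) : ℝ := deriv (fun s => G s p) t

/-- Joint continuity on the time interval. -/
abbrev JointCont (G : ℝ → Phase d → ℝ) : Prop :=
  ContinuousOn (fun z : ℝ × Phase d => G z.1 z.2) (timeI ×ˢ univ)

/-- Functions all of whose `(x, v)`-derivatives are jointly continuous and have jointly continuous
time derivatives. -/
structure Regular (G : ℝ → Phase d → ℝ) : Prop where
  smooth : ∀ t ∈ timeI, Smooth (G t)
  cont : ∀ L, JointCont fun t => pdList L (G t)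
  diff : ∀ L, ∀ t ∈ timeI, ∀ p, DifferentiableAt ℝ (fun s => pdList L (G s) p) t
  cont_dt : ∀ L, JointCont (dt fun t => pdList L (G t))

lemma Regular.pdList {G : ℝ → Phase d → ℝ} (hG : Regular G) (L : List (Dir d)) :
    Regular fun t => pdList L (G t) where
  smooth t ht := (hG.smooth t ht).pdList L
  cont L' := by simpa only [pdList_append] using hG.cont (L' ++ L)
  diff L' := by simpa only [pdList_append] using hG.diff (L' ++ L)
  cont_dt L' := by simpa only [pdList_append] using hG.cont_dt (L' ++ L)

lemma Regular.pd {G : ℝ → Phase d → ℝ} (hG : Regular G) (e : Dir d) :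
    Regular fun t => pd e (G t) := hG.pdList [e]

lemma Regular.jointCont {G : ℝ → Phase d → ℝ} (hG : Regular G) : JointCont G := hG.cont []

lemma Regular.jointCont_dt {G : ℝ → Phase d → ℝ} (hG : Regular G) : JointCont (dt G) :=
  hG.cont_dt []

lemma Regular.hasDerivAt {G : ℝ → Phase d → ℝ} (hG : Regular G) {t : ℝ} (ht : t ∈ timeI)
    (p : Phase d) : HasDerivAt (fun s => G s p) (dt G t p) t :=
  (hG.diff [] t ht p).hasDerivAt

lemma JointCont.continuous {G : ℝ → Phase d → ℝ} (hG : JointCont G) {t : ℝ} (ht : t ∈ timeI) :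
    Continuous (G t) := by
  rw [← continuousOn_univ]
  exact hG.comp (f := fun x => (t, x)) (by fun_prop) fun x _ => ⟨ht, mem_univ _⟩

lemma Regular.sub_const {G : ℝ → Phase d → ℝ} (hG : Regular G) (c : ℝ) :
    Regular fun t p => G t p - c := by
  have key : ∀ L : List (Dir d), ∃ c', ∀ t ∈ timeI,
      Kinetic.pdList L (fun p => G t p - c) = fun p => Kinetic.pdList L (G t) p - c' := by
    intro L
    by_cases hL : L = []
    · subst hL; exact ⟨c, fun t _ => rfl⟩
    · refine ⟨0, fun t ht => ?_⟩
      have := pdList_add (hG.smooth t ht) (contDiff_const : Smooth fun _ => -c) L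
      simp only [pdList_const _ hL, ← sub_eq_add_neg] at this
      simpa using this
  have hev : ∀ (L : List (Dir d)) (c' : ℝ), (∀ t ∈ timeI,
      Kinetic.pdList L (fun p => G t p - c) = fun p => Kinetic.pdList L (G t) p - c') →
      ∀ t ∈ timeI, ∀ p, (fun s => Kinetic.pdList L (fun p => G s p - c) p) =ᶠ[nhds t]
        fun s => Kinetic.pdList L (G s) p - c' := by
    intro L c' h t ht p
    filter_upwards [isOpen_Ioo.mem_nhds ht] with s hs
    rw [h s hs]
  refine ⟨fun t ht => (hG.smooth t ht).sub contDiff_const, fun L => ?_, fun L t ht p => ?_,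
    fun L => ?_⟩ <;> obtain ⟨c', h⟩ := key L
  · refine ((hG.cont L).sub (continuousOn_const (c := c'))).congr ?_
    rintro ⟨t, p⟩ ⟨ht, -⟩
    simp only [h t ht]
    rfl
  · exact ((hG.diff L t ht p).sub_const c').congr_of_eventuallyEq (hev L c' h t ht p)
  · refine (hG.cont_dt L).congr ?_
    rintro ⟨t, p⟩ ⟨ht, -⟩
    simp only [dt]
    rw [(hev L c' h t ht p).deriv_eq, deriv_sub_const]

lemma hasDerivAt_line {f : Phase d → ℝ} (hf : Smooth f) (e : Dir d) (p : Phase d) (s : ℝ) :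
    HasDerivAt (fun r : ℝ => f (p + r • basisVec e)) (pd e f (p + s • basisVec e)) s := by
  have h1 : HasDerivAt (fun r : ℝ => p + r • basisVec e) (basisVec e) s := by
    simpa using ((hasDerivAt_id s).smul_const (basisVec e)).const_add p
  exact (hf.differentiable (p + s • basisVec e)).hasFDerivAt.comp_hasDerivAt s h1

lemma Regular.hasDerivAt_dt_line {G : ℝ → Phase d → ℝ} (hG : Regular G) (e : Dir d) {t : ℝ}
    (ht : t ∈ timeI) (p : Phase d) :
    HasDerivAt (fun s : ℝ => dt G t (p + s • basisVec e))
      (dt (fun t => Kinetic.pd e (G t)) t p) 0 := by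
  have hP := hG.pd e
  have hline : Continuous fun r : ℝ => p + r • basisVec e := by fun_prop
  have h2 : ∀ {H : ℝ → Phase d → ℝ}, JointCont H →
      ContinuousOn (fun z : ℝ × ℝ => H z.1 (p + z.2 • basisVec e)) (timeI ×ˢ univ) := by
    intro H hH
    exact hH.comp (f := fun z : ℝ × ℝ => (z.1, p + z.2 • basisVec e)) (by fun_prop)
      fun z hz => ⟨hz.1, mem_univ _⟩
  have hInt : ∀ s : ℝ, dt G t (p + s • basisVec e) = dt G t p +
      ∫ r in (0 : ℝ)..s, dt (fun t => Kinetic.pd e (G t)) t (p + r • basisVec e) := by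
    intro s
    have hD : HasDerivAt (fun τ => ∫ r in (0 : ℝ)..s, Kinetic.pd e (G τ) (p + r • basisVec e))
        (∫ r in (0 : ℝ)..s, dt (fun t => Kinetic.pd e (G t)) t (p + r • basisVec e)) t := by
      simp only [intervalIntegral.intervalIntegral_eq_integral_uIoc]
      have hset := hasDerivAt_setIntegral (μ := volume) (I := timeI) (K := uIcc 0 s)
        (S := uIoc 0 s) (t := t)
        (F := fun τ r => Kinetic.pd e (G τ) (p + r • basisVec e))
        (F' := fun τ r => dt (fun t => Kinetic.pd e (G t)) τ (p + r • basisVec e))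
        isCompact_uIcc measurableSet_uIoc uIoc_subset_uIcc isOpen_Ioo
        (fun τ hτ => (hP.jointCont.continuous hτ).comp hline) (h2 hP.jointCont_dt)
        (fun τ hτ r => hP.hasDerivAt hτ _) ht
      exact hset.const_smul (if (0 : ℝ) ≤ s then (1 : ℝ) else -1)
    have hE : (fun τ => G τ (p + s • basisVec e)) =ᶠ[nhds t] fun τ => G τ p +
        ∫ r in (0 : ℝ)..s, Kinetic.pd e (G τ) (p + r • basisVec e) := by
      filter_upwards [isOpen_Ioo.mem_nhds ht] with τ hτ
      rw [intervalIntegral.integral_eq_sub_of_hasDerivAt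
        (f := fun r => G τ (p + r • basisVec e))
        (fun r _ => hasDerivAt_line (hG.smooth τ hτ) e p r)
        (((hP.jointCont.continuous hτ).comp hline).intervalIntegrable _ _)]
      simp
    exact (((hG.hasDerivAt ht p).add hD).congr_of_eventuallyEq hE).deriv
  have hc : Continuous fun r : ℝ => dt (fun t => Kinetic.pd e (G t)) t (p + r • basisVec e) :=
    (hP.jointCont_dt.continuous ht).comp hline
  have := ((hc.integral_hasStrictDerivAt 0 0).hasDerivAt.const_add (dt G t p))
  simp only [zero_smul, add_zero] at this
  exact this.congr_of_eventuallyEq (Filter.Eventually.of_forall hInt)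

/-- `G` solves `∂_t G = v·D_x G + a D²_v G + f` for `|v| < 1`. -/
def Solves (a : ℝ → Matrix (Fin d) (Fin d) ℝ) (G f : ℝ → Phase d → ℝ) : Prop :=
  ∀ t ∈ timeI, ∀ p : Phase d, ‖p.2‖ < 1 →
    dt G t p = transport (G t) p + diffusion (a t) (G t) p + f t p

lemma Solves.pd {a : ℝ → Matrix (Fin d) (Fin d) ℝ} {G f : ℝ → Phase d → ℝ} (hs : Solves a G f)
    (hG : Regular G) (hf : ∀ t ∈ timeI, Smooth (f t)) (e : Dir d) :
    Solves a (fun t => pd e (G t)) fun t p => pd e (f t) p +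
      ∑ i, (if e = Sum.inr i then Kinetic.pd (Sum.inl i) (G t) p else 0) := by
  intro t ht p hp
  have hT := (hG.smooth t ht).transport
  have hA := (hG.smooth t ht).diffusion (a t)
  have hTA : Smooth fun p => transport (G t) p + diffusion (a t) (G t) p := hT.add hA
  have h1 := hG.hasDerivAt_dt_line e ht p
  have hopen : IsOpen {q : Phase d | ‖q.2‖ < 1} := isOpen_lt (by fun_prop) continuous_const
  have hc : Continuous fun s : ℝ => p + s • basisVec e := by fun_prop
  have h2 := hasDerivAt_line (hTA.add (hf t ht)) e p 0
  simp only [zero_smul, add_zero] at h2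
  have hev : (fun s : ℝ => dt G t (p + s • basisVec e)) =ᶠ[nhds 0] fun s : ℝ =>
      (fun q => transport (G t) q + diffusion (a t) (G t) q + f t q) (p + s • basisVec e) := by
    have : ∀ᶠ s : ℝ in nhds 0, p + s • basisVec e ∈ {q : Phase d | ‖q.2‖ < 1} :=
      (hc.tendsto 0).eventually (hopen.mem_nhds (by simpa using hp))
    filter_upwards [this] with s hs' using hs t ht _ hs'
  have h3 := (h2.congr_of_eventuallyEq hev).unique h1
  rw [← h3, pd_add hTA (hf t ht), pd_add hT hA]
  simp only [pd_transport (hG.smooth t ht), pd_diffusion (hG.smooth t ht)]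
  ring

/-- The lists produced by commuting the derivatives in a list past the transport operator: each
velocity direction is replaced, in turn, by the corresponding space direction. -/
def commLists : List (Dir d) → List (List (Dir d))
  | [] => []
  | Sum.inl i :: L => (commLists L).map (Sum.inl i :: ·)
  | Sum.inr i :: L => (Sum.inl i :: L) :: (commLists L).map (Sum.inr i :: ·)

/-- The commutator source term attached to a list of directions. -/
noncomputable def commSource (L : List (Dir d)) (f : Phase d → ℝ) (p : Phase d) : ℝ :=
  ((commLists L).map fun L' => pdList L' f p).sum

lemma smooth_listSum {f : Phase d → ℝ} (hf : Smooth f) (S : List (List (Dir d))) :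
    Smooth fun p => (S.map fun L' => pdList L' f p).sum := by
  induction S with
  | nil => exact contDiff_const
  | cons L S ih => simp only [List.map_cons, List.sum_cons]; exact (hf.pdList L).add ih

lemma pd_listSum {f : Phase d → ℝ} (hf : Smooth f) (S : List (List (Dir d))) (e : Dir d)
    (p : Phase d) : pd e (fun p => (S.map fun L' => pdList L' f p).sum) p =
      ((S.map (e :: ·)).map fun L' => pdList L' f p).sum := by
  induction S with
  | nil => simp [pd_const]
  | cons L S ih =>
    simp only [List.map_cons, List.sum_cons] at ih ⊢
    rw [pd_add (hf.pdList L) (smooth_listSum hf S)]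
    simp only [ih]
    rfl

lemma Solves.pdList {a : ℝ → Matrix (Fin d) (Fin d) ℝ} {G : ℝ → Phase d → ℝ} {χ : ℝ → ℝ}
    (hs : Solves a G fun t _ => χ t) (hG : Regular G) (L : List (Dir d)) :
    Solves a (fun t => pdList L (G t)) fun t p => pdList L (fun _ => χ t) p +
      commSource L (G t) p := by
  induction L with
  | nil => intro t ht p hp; simpa [commSource, commLists, Kinetic.pdList] using hs t ht p hp
  | cons e L ih =>
    intro t ht p hp
    have hχ : Smooth (Kinetic.pdList L (fun _ : Phase d => χ t)) := Smooth.pdList contDiff_const L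
    have := (Solves.pd ih (hG.pdList L) (fun t ht => (Smooth.pdList contDiff_const L).add
      (smooth_listSum (hG.smooth t ht) _)) e) t ht p hp
    simp only [Kinetic.pdList] at this ⊢
    rw [this]
    have hS := smooth_listSum (hG.smooth t ht) (commLists L)
    change _ + _ + (Kinetic.pd e (fun p => Kinetic.pdList L (fun _ => χ t) p +
      ((commLists L).map fun L' => Kinetic.pdList L' (G t) p).sum) p + _) = _
    rw [pd_add hχ hS]
    simp only [pd_listSum (hG.smooth t ht), commSource]
    rcases e with i | i
    · simp [commLists]
    · simp only [commLists, List.map_cons, List.sum_cons]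
      simp only [Sum.inr.injEq, Finset.sum_ite_eq, Finset.mem_univ, if_true, Kinetic.pdList]
      ring

/-- Euclidean norm of the velocity gradient. -/
noncomputable def velNorm (f : Phase d → ℝ) (p : Phase d) : ℝ :=
  √(∑ i, pd (Sum.inr i) f p ^ 2)

lemma velNorm_nonneg (f : Phase d → ℝ) (p : Phase d) : 0 ≤ velNorm f p := Real.sqrt_nonneg _

lemma velNorm_sq (f : Phase d → ℝ) (p : Phase d) :
    velNorm f p ^ 2 = ∑ i, pd (Sum.inr i) f p ^ 2 :=
  Real.sq_sqrt (Finset.sum_nonneg fun _ _ => sq_nonneg _)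

lemma le_velForm {δ : ℝ} {A : Matrix (Fin d) (Fin d) ℝ} (hA : elliptic δ A) (f : Phase d → ℝ)
    (p : Phase d) : δ * velNorm f p ^ 2 ≤ velForm A f f p := by
  have := hA.1 (WithLp.toLp 2 fun i => pd (Sum.inr i) f p)
  rw [EuclideanSpace.norm_sq_eq] at this
  simpa [velNorm_sq, velForm] using this

lemma abs_velForm_le {δ : ℝ} {A : Matrix (Fin d) (Fin d) ℝ} (hA : elliptic δ A) (hδ : 0 < δ)
    (f g : Phase d → ℝ) (p : Phase d) :
    |velForm A f g p| ≤ (d + 1) * δ⁻¹ * velNorm f p * velNorm g p := by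
  have hl1 : ∀ f : Phase d → ℝ, (∑ i, |pd (Sum.inr i) f p|) ^ 2 ≤ d * velNorm f p ^ 2 := by
    intro f
    have := sq_sum_le_card_mul_sum_sq (s := Finset.univ) (f := fun i => |pd (Sum.inr i) f p|)
    simpa [velNorm_sq] using this
  have hl0 : ∀ f : Phase d → ℝ, 0 ≤ ∑ i, |pd (Sum.inr i) f p| :=
    fun f => Finset.sum_nonneg fun _ _ => abs_nonneg _
  have h1 : |velForm A f g p| ≤
      δ⁻¹ * ((∑ i, |pd (Sum.inr i) f p|) * ∑ j, |pd (Sum.inr j) g p|) := by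
    rw [Finset.sum_mul_sum, Finset.mul_sum]
    refine (Finset.abs_sum_le_sum_abs _ _).trans (Finset.sum_le_sum fun i _ => ?_)
    rw [Finset.mul_sum]
    refine (Finset.abs_sum_le_sum_abs _ _).trans (Finset.sum_le_sum fun j _ => ?_)
    rw [abs_mul, abs_mul, mul_assoc]
    exact mul_le_mul_of_nonneg_right (hA.2 i j) (by positivity)
  have h2 : (∑ i, |pd (Sum.inr i) f p|) * ∑ j, |pd (Sum.inr j) g p| ≤
      (d + 1) * (velNorm f p * velNorm g p) := by
    refine (abs_le_of_sq_le_sq' ?_ (by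
      have := velNorm_nonneg f p
      have := velNorm_nonneg g p
      positivity)).2
    have := mul_le_mul (hl1 f) (hl1 g) (sq_nonneg _) (by positivity)
    have h0 : (0 : ℝ) ≤ velNorm f p ^ 2 * velNorm g p ^ 2 := by positivity
    have hd : (0 : ℝ) ≤ d := Nat.cast_nonneg d
    nlinarith [mul_nonneg hd h0]
  calc _ ≤ _ := h1
    _ ≤ δ⁻¹ * ((d + 1) * (velNorm f p * velNorm g p)) := by gcongr
    _ = _ := by ring

/-- Space-time cutoff functions between the half-open cylinders of sizes `ρ < R`. -/
structure Cutoff (ρ R M : ℝ) (φ φ' : ℝ → Phase d → ℝ) : Prop where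
  smooth : ∀ t, Smooth (φ t)
  deriv : ∀ t p, HasDerivAt (fun s => φ s p) (φ' t p) t
  cont : Continuous fun z : ℝ × Phase d => φ z.1 z.2
  cont' : Continuous fun z : ℝ × Phase d => φ' z.1 z.2
  nonneg : ∀ t p, 0 ≤ φ t p
  le_one : ∀ t p, φ t p ≤ 1
  eq_one : ∀ t p, -ρ ≤ t → p ∈ Metric.closedBall (0 : Phase d) ρ → φ t p = 1
  zero_time : ∀ p, φ (-R) p = 0
  zero_space : ∀ t, ∀ p ∉ Metric.closedBall (0 : Phase d) R, φ t p = 0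
  transport_le : ∀ t ∈ timeI, ∀ p, |φ' t p - transport (φ t) p| ≤ M
  velNorm_le : ∀ t p, velNorm (φ t) p ≤ M

lemma exists_cutoff (d : ℕ) {ρ R : ℝ} (hρ : 0 < ρ) (hρR : ρ < R) :
    ∃ M, 1 ≤ M ∧ ∃ φ φ' : ℝ → Phase d → ℝ, Cutoff ρ R M φ φ' := by
  let b : ContDiffBump (0 : Ed d) := ⟨ρ, R, hρ, hρR⟩
  set β : Phase d → ℝ := fun p => b p.1 * b p.2 with hβ
  have hβs : Smooth β := (b.contDiff.comp contDiff_fst).mul (b.contDiff.comp contDiff_snd)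
  set ζ : ℝ → ℝ := fun t => Real.smoothTransition ((t + R) / (R - ρ)) with hζ
  have hζs : ContDiff ℝ (⊤ : ℕ∞) ζ :=
    Real.smoothTransition.contDiff.comp (by fun_prop)
  have hζd : Continuous (_root_.deriv ζ) := hζs.continuous_deriv (by simp)
  have hβ0 : ∀ p ∉ Metric.closedBall (0 : Phase d) R, β p = 0 := by
    intro p hp
    have hp' : R < max ‖p.1‖ ‖p.2‖ := by
      rw [mem_closedBall_zero_iff, not_le, Prod.norm_def] at hp
      exact hp
    rcases lt_max_iff.1 hp' with h | h
    · simp [hβ, b.zero_of_le_dist (x := p.1) (by simpa using h.le)]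
    · simp [hβ, b.zero_of_le_dist (x := p.2) (by simpa using h.le)]
  have hbd : ∀ F : Phase d → ℝ, Continuous F →
      (∀ p ∉ Metric.closedBall (0 : Phase d) R, F p = 0) → ∃ C, 0 ≤ C ∧ ∀ p, |F p| ≤ C := by
    intro F hF h0
    obtain ⟨C, hC⟩ := (isCompact_closedBall (0 : Phase d) R).exists_bound_of_continuousOn
      hF.continuousOn
    refine ⟨max C 0, le_max_right _ _, fun p => ?_⟩
    by_cases hp : p ∈ Metric.closedBall (0 : Phase d) R
    · exact (hC p hp).trans (le_max_left _ _)
    · simp [h0 p hp]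
  have hpd0 := fun e => pd_eq_zero_of_support (e := e) Metric.isClosed_closedBall hβ0
  obtain ⟨C1, hC1, hT⟩ := hbd (transport β) hβs.transport.continuous fun p hp => by
    simp [transport, hpd0 _ p hp]
  have hvc : Continuous (velNorm β) := by
    have := fun e => (hβs.pd e).continuous
    unfold velNorm
    fun_prop
  obtain ⟨C2, hC2, hV⟩ := hbd (velNorm β) hvc fun p hp => by
    simp [velNorm, hpd0 _ p hp]
  obtain ⟨C3, hC3⟩ := (isCompact_Icc (a := (-1 : ℝ)) (b := 0)).exists_bound_of_continuousOn
    hζd.continuousOn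
  have hζ0 : ∀ t, 0 ≤ ζ t := fun t => Real.smoothTransition.nonneg _
  have hζ1 : ∀ t, ζ t ≤ 1 := fun t => Real.smoothTransition.le_one _
  have hβnn : ∀ p, 0 ≤ β p := fun p => mul_nonneg b.nonneg b.nonneg
  have hβ1 : ∀ p, β p ≤ 1 := fun p => mul_le_one₀ b.le_one b.nonneg b.le_one
  have hpd : ∀ t e p, pd e (fun p => ζ t * β p) p = ζ t * pd e β p := fun t e p => by
    rw [pd_const_mul _ hβs]
  refine ⟨1 + C1 + C2 + |C3|, by have := abs_nonneg C3; linarith, fun t p => ζ t * β p,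
    fun t p => _root_.deriv ζ t * β p, ?_, ?_, ?_, ?_, ?_, ?_, ?_, ?_, ?_, ?_, ?_⟩
  · exact fun t => contDiff_const.mul hβs
  · exact fun t p => ((hζs.differentiable (by simp)) t).hasDerivAt.mul_const _
  · exact (hζs.continuous.comp continuous_fst).mul (hβs.continuous.comp continuous_snd)
  · exact (hζd.comp continuous_fst).mul (hβs.continuous.comp continuous_snd)
  · exact fun t p => mul_nonneg (hζ0 t) (hβnn p)
  · exact fun t p => mul_le_one₀ (hζ1 t) (hβnn p) (hβ1 p)
  · intro t p ht hp
    have hp' : max ‖p.1‖ ‖p.2‖ ≤ ρ := by simpa [Prod.norm_def] using hp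
    have h1 : b p.1 = 1 := b.one_of_mem_closedBall (by simpa using (max_le_iff.1 hp').1)
    have h2 : b p.2 = 1 := b.one_of_mem_closedBall (by simpa using (max_le_iff.1 hp').2)
    have h3 : ζ t = 1 := Real.smoothTransition.one_of_one_le
      ((one_le_div (by linarith)).2 (by linarith))
    simp [hβ, h1, h2, h3]
  · intro p
    simp [hζ]
  · exact fun t p hp => by simp [hβ0 p hp]
  · intro t ht p
    have h1 : transport (fun p => ζ t * β p) p = ζ t * transport β p := by
      simp only [transport, hpd, Finset.mul_sum]
      exact Finset.sum_congr rfl fun i _ => by ring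
    rw [h1]
    have h2 : |_root_.deriv ζ t * β p| ≤ |C3| := by
      rw [abs_mul, abs_of_nonneg (hβnn p)]
      refine (mul_le_of_le_one_right (abs_nonneg _) (hβ1 p)).trans ?_
      exact (hC3 t ⟨ht.1.le, ht.2.le⟩).trans (le_abs_self _)
    have h3 : |ζ t * transport β p| ≤ C1 := by
      rw [abs_mul, abs_of_nonneg (hζ0 t)]
      exact (mul_le_of_le_one_left (abs_nonneg _) (hζ1 t)).trans (hT p)
    have := abs_sub (_root_.deriv ζ t * β p) (ζ t * transport β p)
    linarith
  · intro t p
    have h1 : velNorm (fun p => ζ t * β p) p = ζ t * velNorm β p := by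
      simp only [velNorm, hpd, mul_pow, ← Finset.mul_sum]
      rw [Real.sqrt_mul (sq_nonneg _), Real.sqrt_sq (hζ0 t)]
    rw [h1]
    have h2 := (le_abs_self _).trans (hV p)
    have := mul_le_of_le_one_left (velNorm_nonneg β p) (hζ1 t)
    have := abs_nonneg C3
    linarith

/-- Integral over the sup-norm ball of radius `R` in phase space. -/
noncomputable def ballInt (R : ℝ) (f : Phase d → ℝ) : ℝ :=
  ∫ p in Metric.closedBall (0 : Phase d) R, f p

/-- Integral over a cylinder ending at time `T`. -/
noncomputable def cylInt (R T : ℝ) (F : ℝ → Phase d → ℝ) : ℝ :=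
  ∫ t in (-R)..T, ballInt R (F t)

lemma ballInt_mono {R : ℝ} {f g : Phase d → ℝ} (hf : Continuous f) (hg : Continuous g)
    (h : ∀ p ∈ Metric.closedBall (0 : Phase d) R, f p ≤ g p) : ballInt R f ≤ ballInt R g :=
  setIntegral_mono_on (integrableOn_ball hf R) (integrableOn_ball hg R)
    Metric.isClosed_closedBall.measurableSet h

lemma ballInt_mono_set {ρ R : ℝ} (hρR : ρ ≤ R) {f : Phase d → ℝ} (hf : Continuous f)
    (h : ∀ p, 0 ≤ f p) : ballInt ρ f ≤ ballInt R f :=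
  setIntegral_mono_set (integrableOn_ball hf R) (Filter.Eventually.of_forall h)
    (Metric.closedBall_subset_closedBall hρR).eventuallyLE

lemma ballInt_nonneg {R : ℝ} {f : Phase d → ℝ} (h : ∀ p, 0 ≤ f p) : 0 ≤ ballInt R f :=
  integral_nonneg h

lemma continuousOn_ballInt (R : ℝ) {F : ℝ → Phase d → ℝ} (hF : JointCont F) :
    ContinuousOn (fun t => ballInt R (F t)) timeI :=
  continuousOn_setIntegral (isCompact_closedBall _ _) isOpen_Ioo hF

lemma uIcc_subset_timeI {R T : ℝ} (hR : R < 1) (hT : T ∈ Ico (-R) 0) : uIcc (-R) T ⊆ timeI := by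
  rw [uIcc_of_le hT.1]
  exact fun t ht => ⟨by linarith [ht.1], ht.2.trans_lt hT.2⟩

lemma intervalIntegrable_ballInt {r R T : ℝ} (hR : R < 1) (hT : T ∈ Ico (-R) 0)
    {F : ℝ → Phase d → ℝ} (hF : JointCont F) :
    IntervalIntegrable (fun t => ballInt r (F t)) volume (-R) T :=
  ((continuousOn_ballInt r hF).mono (uIcc_subset_timeI hR hT)).intervalIntegrable

lemma cylInt_mono {R T : ℝ} (hR : R < 1) (hT : T ∈ Ico (-R) 0)
    {F G : ℝ → Phase d → ℝ} (hF : JointCont F) (hG : JointCont G)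
    (h : ∀ t ∈ timeI, ballInt R (F t) ≤ ballInt R (G t)) : cylInt R T F ≤ cylInt R T G := by
  refine intervalIntegral.integral_mono_on hT.1 (intervalIntegrable_ballInt hR hT hF)
    (intervalIntegrable_ballInt hR hT hG) fun t ht => h t ?_
  exact uIcc_subset_timeI hR hT (Icc_subset_uIcc ht)

lemma cylInt_mono_set {ρ R T : ℝ} (hρR : ρ ≤ R) (hR : R < 1) (hT : T ∈ Ico (-ρ) 0)
    {F G : ℝ → Phase d → ℝ} (hF : JointCont F) (hG : JointCont G) (h0 : ∀ t p, 0 ≤ G t p)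
    (h : ∀ t, -ρ ≤ t → ∀ p ∈ Metric.closedBall (0 : Phase d) ρ, F t p ≤ G t p) :
    cylInt ρ T F ≤ cylInt R T G := by
  have hT' : T ∈ Ico (-R) 0 := ⟨by linarith [hT.1], hT.2⟩
  have hρ : ρ < 1 := hρR.trans_lt hR
  have h1 : cylInt ρ T F ≤ ∫ t in (-ρ)..T, ballInt R (G t) := by
    refine intervalIntegral.integral_mono_on hT.1 (intervalIntegrable_ballInt hρ hT hF)
      (intervalIntegrable_ballInt hρ hT hG) fun t ht => ?_
    have ht' := uIcc_subset_timeI hρ hT (Icc_subset_uIcc ht)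
    exact (ballInt_mono (hF.continuous ht') (hG.continuous ht') (h t ht.1)).trans
      (ballInt_mono_set hρR (hG.continuous ht') (h0 t))
  refine h1.trans (intervalIntegral.integral_mono_interval (by linarith) hT.1 le_rfl ?_
    (intervalIntegrable_ballInt hR hT' hG))
  exact Filter.Eventually.of_forall fun t => ballInt_nonneg (h0 t)

lemma cylInt_nonneg {R T : ℝ} (hT : -R ≤ T) {F : ℝ → Phase d → ℝ} (h0 : ∀ t p, 0 ≤ F t p) :
    0 ≤ cylInt R T F :=
  intervalIntegral.integral_nonneg hT fun t _ => ballInt_nonneg (h0 t)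

lemma cylInt_const_mul (c R T : ℝ) (F : ℝ → Phase d → ℝ) :
    cylInt R T (fun t p => c * F t p) = c * cylInt R T F := by
  simp [cylInt, ballInt, integral_const_mul]

lemma ballInt_add {R : ℝ} {f g : Phase d → ℝ} (hf : Continuous f) (hg : Continuous g) :
    ballInt R (fun p => f p + g p) = ballInt R f + ballInt R g :=
  integral_add (integrableOn_ball hf R) (integrableOn_ball hg R)

lemma cylInt_add {R T : ℝ} (hR : R < 1) (hT : T ∈ Ico (-R) 0)
    {F G : ℝ → Phase d → ℝ} (hF : JointCont F) (hG : JointCont G) :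
    cylInt R T (fun t p => F t p + G t p) = cylInt R T F + cylInt R T G := by
  rw [cylInt, cylInt, cylInt, ← intervalIntegral.integral_add (intervalIntegrable_ballInt hR hT hF)
    (intervalIntegrable_ballInt hR hT hG)]
  refine intervalIntegral.integral_congr fun t ht => ?_
  have ht' := uIcc_subset_timeI hR hT ht
  exact ballInt_add (hF.continuous ht') (hG.continuous ht')

/-- Integration in time of a differential inequality for a localized energy. -/
lemma energy_estimate {R T : ℝ} (hR : R < 1) (hT : T ∈ Ico (-R) 0)
    {e e' lo up : ℝ → Phase d → ℝ} (he : ∀ t ∈ timeI, Continuous (e t)) (he' : JointCont e')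
    (hd : ∀ t ∈ timeI, ∀ p, HasDerivAt (fun s => e s p) (e' t p) t) (h0 : ∀ p, e (-R) p = 0)
    (hlo : JointCont lo) (hup : JointCont up)
    (hle : ∀ t ∈ timeI, ballInt R (e' t) + ballInt R (lo t) ≤ ballInt R (up t)) :
    ballInt R (e T) + cylInt R T lo ≤ cylInt R T up := by
  have hE : ∀ t ∈ timeI, HasDerivAt (fun s => ballInt R (e s)) (ballInt R (e' t)) t :=
    fun t ht => hasDerivAt_setIntegral (isCompact_closedBall _ _)
      Metric.isClosed_closedBall.measurableSet subset_rfl isOpen_Ioo he he' hd ht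
  have hft := intervalIntegral.integral_eq_sub_of_hasDerivAt
    (fun t ht => hE t (uIcc_subset_timeI hR hT ht)) (intervalIntegrable_ballInt hR hT he')
  have hz : ballInt R (e (-R)) = 0 := by simp [ballInt, h0]
  rw [hz, sub_zero] at hft
  rw [← hft, ← cylInt, ← cylInt_add hR hT he' hlo]
  refine cylInt_mono hR hT (he'.add hlo) hup fun t ht => ?_
  rw [ballInt_add (he'.continuous ht) (hlo.continuous ht)]
  exact hle t ht

lemma pd_pow {φ : Phase d → ℝ} (hφ : Smooth φ) (n : ℕ) (e : Dir d) (p : Phase d) :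
    pd e (fun p => φ p ^ n) p = n * φ p ^ (n - 1) * pd e φ p := by
  simp [pd, fderiv_fun_pow n (hφ.differentiable p), mul_assoc]

lemma transport_pow {φ : Phase d → ℝ} (hφ : Smooth φ) (n : ℕ) (p : Phase d) :
    transport (fun p => φ p ^ n) p = n * φ p ^ (n - 1) * transport φ p := by
  simp only [transport, pd_pow hφ, Finset.mul_sum]
  exact Finset.sum_congr rfl fun i _ => by ring

lemma velForm_pow {φ : Phase d → ℝ} (hφ : Smooth φ) (n : ℕ) (A : Matrix (Fin d) (Fin d) ℝ)
    (g : Phase d → ℝ) (p : Phase d) :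
    velForm A (fun p => φ p ^ n) g p = n * φ p ^ (n - 1) * velForm A φ g p := by
  simp only [velForm, pd_pow hφ, Finset.mul_sum]
  exact Finset.sum_congr rfl fun i _ => Finset.sum_congr rfl fun j _ => by ring

/-- Time derivative of the energy density `φ ^ n * g * h`. -/
noncomputable def energyDt (n : ℕ) (φ φ' g h : ℝ → Phase d → ℝ) (t : ℝ) (p : Phase d) : ℝ :=
  n * φ t p ^ (n - 1) * φ' t p * g t p * h t p + φ t p ^ n * dt g t p * h t p +
    φ t p ^ n * g t p * dt h t p

/-- The density obtained from `energyDt` by using the equations and integrating by parts. -/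
noncomputable def energyRhs (n : ℕ) (A : Matrix (Fin d) (Fin d) ℝ) (φ φ' g h f k : Phase d → ℝ)
    (p : Phase d) : ℝ :=
  n * φ p ^ (n - 1) * (φ' p - transport φ p) * g p * h p + φ p ^ n * (f p * h p + k p * g p)
    - φ p ^ n * (velForm A h g p + velForm A g h p)
    - h p * (n * φ p ^ (n - 1) * velForm A φ g p) - g p * (n * φ p ^ (n - 1) * velForm A φ h p)

lemma continuous_energyRhs (n : ℕ) (A : Matrix (Fin d) (Fin d) ℝ) {φ φ' g h f k : Phase d → ℝ}
    (hφ : Smooth φ) (hφ' : Continuous φ') (hg : Smooth g) (hh : Smooth h) (hf : Continuous f)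
    (hk : Continuous k) : Continuous (energyRhs n A φ φ' g h f k) := by
  have := hφ.transport.continuous
  have := (hφ.velForm hg A).continuous
  have := (hφ.velForm hh A).continuous
  have := (hg.velForm hh A).continuous
  have := (hh.velForm hg A).continuous
  have := hφ.continuous
  have := hg.continuous
  have := hh.continuous
  unfold energyRhs
  fun_prop

section Cutoff

variable {ρ R M : ℝ} {φ φ' : ℝ → Phase d → ℝ}

lemma Cutoff.continuous' (hc : Cutoff ρ R M φ φ') (t : ℝ) : Continuous (φ' t) :=
  hc.cont'.comp (Continuous.prodMk_right t)

lemma Cutoff.hasDerivAt_energy (hc : Cutoff ρ R M φ φ') (n : ℕ) {g h : ℝ → Phase d → ℝ}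
    (hg : Regular g) (hh : Regular h) {t : ℝ} (ht : t ∈ timeI) (p : Phase d) :
    HasDerivAt (fun s => φ s p ^ n * g s p * h s p) (energyDt n φ φ' g h t p) t := by
  refine ((((hc.deriv t p).pow n).mul (hg.hasDerivAt ht p)).mul
    (hh.hasDerivAt ht p)).congr_deriv ?_
  simp only [energyDt, Pi.pow_apply, Pi.mul_apply]
  ring

lemma Cutoff.jointCont_energyDt (hc : Cutoff ρ R M φ φ') (n : ℕ) {g h : ℝ → Phase d → ℝ}
    (hg : Regular g) (hh : Regular h) : JointCont (energyDt n φ φ' g h) := by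
  have h1 := hc.cont.continuousOn (s := timeI ×ˢ univ)
  have h2 := hc.cont'.continuousOn (s := timeI ×ˢ univ)
  have h3 := hg.jointCont
  have h4 := hh.jointCont
  have h5 := hg.jointCont_dt
  have h6 := hh.jointCont_dt
  unfold JointCont at *
  simp only [energyDt]
  fun_prop

lemma Cutoff.ballInt_energyDt (hc : Cutoff ρ R M φ φ') (hR : R < 1) {n : ℕ} (hn : n ≠ 0)
    {a : ℝ → Matrix (Fin d) (Fin d) ℝ} {g h f k : ℝ → Phase d → ℝ}
    (hg : Regular g) (hh : Regular h) (hf : JointCont f) (hk : JointCont k)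
    (sg : Solves a g f) (sh : Solves a h k) {t : ℝ} (ht : t ∈ timeI) :
    ballInt R (energyDt n φ φ' g h t) =
      ballInt R (energyRhs n (a t) (φ t) (φ' t) (g t) (h t) (f t) (k t)) := by
  have hψ : Smooth fun p => φ t p ^ n := (hc.smooth t).pow n
  have hin : ∀ p : Phase d, φ t p ^ n ≠ 0 → ‖p.2‖ < 1 := by
    intro p hp
    have : p ∈ Metric.closedBall (0 : Phase d) R := by
      by_contra hp'
      exact hp (by rw [hc.zero_space t p hp', zero_pow hn])
    exact ((norm_snd_le p).trans (mem_closedBall_zero_iff.1 this)).trans_lt hR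
  have hψ' : Continuous fun p => n * φ t p ^ (n - 1) * φ' t p :=
    (continuous_const.mul ((hc.smooth t).continuous.pow _)).mul (hc.continuous' t)
  have := energy_identity (a t) (R := R) hψ (hg.smooth t ht) (hh.smooth t ht) hψ'
    (hf.continuous ht) (hk.continuous ht)
    (fun p hp => by rw [hc.zero_space t p hp, zero_pow hn])
    (fun p hp => sg t ht p (hin p hp)) (fun p hp => sh t ht p (hin p hp))
  refine this.trans (congrArg _ (funext fun p => ?_))
  rw [transport_pow (hc.smooth t), velForm_pow (hc.smooth t), velForm_pow (hc.smooth t), energyRhs]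
  ring

end Cutoff

lemma caccioppoli_density {φ X g f V W P δ K M : ℝ} (hφ0 : 0 ≤ φ) (hφ1 : φ ≤ 1) (hX : |X| ≤ M)
    (hδ : 0 < δ) (hV : δ * P ^ 2 ≤ V) (hW : |W| ≤ K * M * P) :
    2 * φ * X * g * g + φ ^ 2 * (f * g + f * g) - φ ^ 2 * (V + V) - g * (2 * φ * W)
      - g * (2 * φ * W) + δ * φ ^ 2 * P ^ 2 ≤
      (2 * M + 1 + 4 * K ^ 2 * M ^ 2 / δ) * (g ^ 2 + f ^ 2) := by
  have hM : 0 ≤ M := (abs_nonneg X).trans hX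
  have h1 : 2 * φ * X * g * g ≤ 2 * M * g ^ 2 := by
    have : φ * X ≤ M := by
      nlinarith [le_abs_self X, neg_abs_le X]
    nlinarith [sq_nonneg g]
  have hφ2 : φ ^ 2 ≤ 1 := pow_le_one₀ hφ0 hφ1
  have h2 : φ ^ 2 * (f * g + f * g) ≤ g ^ 2 + f ^ 2 := by
    nlinarith [sq_nonneg (f - g), sq_nonneg (f + g), sq_nonneg φ]
  have h3 : φ ^ 2 * (δ * P ^ 2) ≤ φ ^ 2 * V := mul_le_mul_of_nonneg_left hV (sq_nonneg _)
  have h4 : -(g * W) ≤ |g| * (K * M * P) := by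
    calc -(g * W) ≤ |g * W| := neg_le_abs _
      _ = |g| * |W| := abs_mul _ _
      _ ≤ _ := by gcongr
  have h5 : -(4 * φ * (g * W)) ≤ δ * φ ^ 2 * P ^ 2 + 4 * K ^ 2 * M ^ 2 / δ * g ^ 2 := by
    have e : δ * φ ^ 2 * P ^ 2 + 4 * K ^ 2 * M ^ 2 / δ * g ^ 2 - 4 * φ * (|g| * (K * M * P)) =
        (δ * (φ * P) - 2 * K * M * |g|) ^ 2 / δ := by
      rw [← sq_abs g]; field_simp; ring
    have : 0 ≤ (δ * (φ * P) - 2 * K * M * |g|) ^ 2 / δ := by positivity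
    nlinarith [mul_le_mul_of_nonneg_left h4 hφ0]
  have h6 : 0 ≤ (2 * M + 4 * K ^ 2 * M ^ 2 / δ) * f ^ 2 := by positivity
  nlinarith

/-- Caccioppoli-type estimate for the energy at the final time and for the velocity gradient. -/
lemma caccioppoli (d : ℕ) {ρ R : ℝ} (hρ : 0 < ρ) (hρR : ρ < R) (hR : R < 1) :
    ∃ C : ℝ, 0 ≤ C ∧ ∃ k : ℕ, ∀ δ ∈ Ioo (0 : ℝ) 1, ∀ a : ℝ → Matrix (Fin d) (Fin d) ℝ,
      (∀ t, elliptic δ (a t)) → ∀ g f : ℝ → Phase d → ℝ, Regular g → JointCont f →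
      Solves a g f → ∀ T ∈ Ico (-ρ) 0,
      ballInt ρ (fun p => g T p ^ 2) ≤ C * δ⁻¹ ^ k *
        (cylInt R T (fun t p => g t p ^ 2) + cylInt R T (fun t p => f t p ^ 2)) ∧
      ∀ i, cylInt ρ T (fun t p => pd (Sum.inr i) (g t) p ^ 2) ≤ C * δ⁻¹ ^ k *
        (cylInt R T (fun t p => g t p ^ 2) + cylInt R T (fun t p => f t p ^ 2)) := by
  obtain ⟨M, hM, φ, φ', hc⟩ := exists_cutoff d hρ hρR
  refine ⟨2 * M + 1 + 4 * (d + 1) ^ 2 * M ^ 2, by positivity, 4, ?_⟩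
  intro δ hδ a ha g f hg hf hs T hT
  have hδ0 : 0 < δ := hδ.1
  have hδi : 1 ≤ δ⁻¹ := (one_le_inv₀ hδ0).2 hδ.2.le
  have hT' : T ∈ Ico (-R) 0 := ⟨by linarith [hT.1], hT.2⟩
  have hTI : T ∈ timeI := ⟨by linarith [hT.1], hT.2⟩
  set N : ℝ := 2 * M + 1 + 4 * ((d + 1) * δ⁻¹) ^ 2 * M ^ 2 / δ with hN
  have hN0 : 0 ≤ N := by positivity
  have hgJ := hg.jointCont
  have hsq : ∀ {F : ℝ → Phase d → ℝ}, JointCont F → JointCont fun t p => F t p ^ 2 :=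
    fun h => ContinuousOn.pow h 2
  have hφJ : JointCont φ := hc.cont.continuousOn
  set lo : ℝ → Phase d → ℝ := fun t p => δ * φ t p ^ 2 * velNorm (g t) p ^ 2 with hlo
  have hloJ : JointCont lo := by
    have := fun i => (hg.pd (Sum.inr i)).jointCont
    simp only [hlo, velNorm_sq]
    unfold JointCont at *
    fun_prop
  set up : ℝ → Phase d → ℝ := fun t p => N * (g t p ^ 2 + f t p ^ 2) with hup
  have hupJ : JointCont up := continuousOn_const.mul ((hsq hgJ).add (hsq hf))
  have hest := energy_estimate (e := fun t p => φ t p ^ 2 * g t p * g t p)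
    (e' := energyDt 2 φ φ' g g) hR hT'
    (fun t ht => (((hc.smooth t).continuous.pow 2).mul (hgJ.continuous ht)).mul
      (hgJ.continuous ht)) (hc.jointCont_energyDt 2 hg hg)
    (fun t ht p => hc.hasDerivAt_energy 2 hg hg ht p) (fun p => by simp [hc.zero_time])
    hloJ hupJ (fun t ht => ?_)
  · have hS : cylInt R T up = N * (cylInt R T (fun t p => g t p ^ 2) +
        cylInt R T (fun t p => f t p ^ 2)) := by
      rw [hup, cylInt_const_mul, cylInt_add hR hT' (hsq hgJ) (hsq hf)]
    have hJ0 : 0 ≤ cylInt R T (fun t p => g t p ^ 2) + cylInt R T (fun t p => f t p ^ 2) :=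
      add_nonneg (cylInt_nonneg hT'.1 fun _ _ => sq_nonneg _)
        (cylInt_nonneg hT'.1 fun _ _ => sq_nonneg _)
    have hlo0 : ∀ t p, 0 ≤ lo t p := fun t p => by positivity
    have he0 : ∀ p, 0 ≤ φ T p ^ 2 * g T p * g T p := fun p => by
      rw [mul_assoc]; exact mul_nonneg (sq_nonneg _) (mul_self_nonneg _)
    have h1 := cylInt_nonneg hT'.1 hlo0
    have h2 := ballInt_nonneg (R := R) he0
    have hNδ : N ≤ (2 * M + 1 + 4 * (d + 1) ^ 2 * M ^ 2) * δ⁻¹ ^ 3 := by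
      have : 1 ≤ δ⁻¹ ^ 3 := one_le_pow₀ hδi
      have e : N = (2 * M + 1) + 4 * (d + 1) ^ 2 * M ^ 2 * δ⁻¹ ^ 3 := by
        rw [hN, div_eq_mul_inv]; ring
      rw [e, add_mul]
      gcongr
      exact le_mul_of_one_le_right (by linarith) this
    have hb : ∀ x : ℝ, δ * x ≤ N * (cylInt R T (fun t p => g t p ^ 2) +
        cylInt R T (fun t p => f t p ^ 2)) → x ≤ (2 * M + 1 + 4 * (d + 1) ^ 2 * M ^ 2) *
        δ⁻¹ ^ 4 * (cylInt R T (fun t p => g t p ^ 2) + cylInt R T (fun t p => f t p ^ 2)) := by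
      intro x hx
      have := mul_le_mul_of_nonneg_left (hx.trans (mul_le_mul_of_nonneg_right hNδ hJ0))
        (inv_nonneg.2 hδ0.le)
      rw [inv_mul_cancel_left₀ hδ0.ne'] at this
      exact this.trans_eq (by ring)
    constructor
    · refine hb _ ?_
      have h3 : ballInt ρ (fun p => g T p ^ 2) ≤ ballInt R fun p => φ T p ^ 2 * g T p * g T p := by
        have hgc := hgJ.continuous hTI
        have hφc := (hc.smooth T).continuous
        refine le_trans (ballInt_mono (g := fun p => φ T p ^ 2 * g T p * g T p)
          (by fun_prop) (by fun_prop) fun p hp => ?_)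
          (ballInt_mono_set hρR.le (by fun_prop) he0)
        rw [hc.eq_one T p hT.1 hp]
        exact le_of_eq (by ring)
      have h4 := ballInt_nonneg (R := ρ) fun p => sq_nonneg (g T p)
      nlinarith [hδ.2]
    · intro i
      refine hb _ ?_
      have h3 : cylInt ρ T (fun t p => δ * pd (Sum.inr i) (g t) p ^ 2) ≤ cylInt R T lo := by
        refine cylInt_mono_set hρR.le hR hT
          (continuousOn_const.mul (hsq (hg.pd _).jointCont)) hloJ hlo0 fun t ht p hp => ?_
        simp only [hlo, hc.eq_one t p ht hp, velNorm_sq, one_pow, mul_one]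
        gcongr
        exact Finset.single_le_sum (f := fun i => pd (Sum.inr i) (g t) p ^ 2)
          (fun _ _ => sq_nonneg _) (Finset.mem_univ i)
      rw [cylInt_const_mul] at h3
      linarith
  · rw [hc.ballInt_energyDt hR two_ne_zero hg hg hf hf hs hs ht]
    have hR1 := continuous_energyRhs 2 (a t) (hc.smooth t) (hc.continuous' t) (hg.smooth t ht)
      (hg.smooth t ht) (hf.continuous ht) (hf.continuous ht)
    rw [← ballInt_add hR1 (hloJ.continuous ht)]
    refine ballInt_mono (hR1.add (hloJ.continuous ht)) (hupJ.continuous ht) fun p _ => ?_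
    have hW : |velForm (a t) (φ t) (g t) p| ≤ (d + 1) * δ⁻¹ * M * velNorm (g t) p := by
      refine (abs_velForm_le (ha t) hδ0 _ _ p).trans ?_
      have := hc.velNorm_le t p
      have := velNorm_nonneg (g t) p
      gcongr
    have := caccioppoli_density (g := g t p) (f := f t p) (hc.nonneg t p) (hc.le_one t p)
      (hc.transport_le t ht p) hδ0 (le_velForm (ha t) (g t) p) hW
    simpa [energyRhs, hlo, hup, hN] using this

lemma mul_le_of_abs_le {x y b : ℝ} (h : |y| ≤ b) : x * y ≤ |x| * b :=
  (le_abs_self _).trans ((abs_mul x y).le.trans (mul_le_mul_of_nonneg_left h (abs_nonneg x)))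

lemma neg_mul_le_of_abs_le {x y b : ℝ} (h : |y| ≤ b) : -(x * y) ≤ |x| * b :=
  (neg_le_abs _).trans ((abs_mul x y).le.trans (mul_le_mul_of_nonneg_left h (abs_nonneg x)))

lemma two_mul_le_weighted {x y w : ℝ} (hw : 0 < w) : 2 * (x * y) ≤ w * x ^ 2 + w⁻¹ * y ^ 2 := by
  have : w * x ^ 2 + w⁻¹ * y ^ 2 - 2 * (x * y) = (w * x - y) ^ 2 * w⁻¹ := by field_simp; ring
  have : 0 ≤ (w * x - y) ^ 2 * w⁻¹ := by positivity
  linarith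

set_option maxHeartbeats 400000 in
lemma hypoelliptic_quadratic {G H P Q δ K M ε : ℝ} (hδ : 0 < δ) (hδ1 : δ < 1)
    (hK : 1 ≤ K) (hM : 1 ≤ M) (hε : ε * (576 * K ^ 2 * M ^ 2) = δ ^ 2) :
    2 * M * G ^ 2 + 2 * (G * H) - 2 * (δ * P ^ 2) + 4 * (K * M * (G * P))
      + ε ^ 2 * (4 * (M * (G * H)) - H ^ 2 + 2 * (K * (P * Q)) + 4 * (K * M * (H * P))
        + 4 * (K * M * (G * Q)))
      + ε ^ 3 * (6 * (M * H ^ 2) - 2 * (δ * Q ^ 2) + 12 * (K * M * (H * Q)))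
      + ε ^ 2 / 4 * H ^ 2 ≤
      (2 * M + 8 / ε ^ 2 + 1 + 8 * K ^ 2 * M ^ 2 / δ + 1) * G ^ 2 := by
  have hK2 : 1 ≤ K ^ 2 := one_le_pow₀ hK
  have hM2 : M ≤ M ^ 2 := le_self_pow₀ hM two_ne_zero
  have hKM : 1 ≤ K ^ 2 * M ^ 2 := by nlinarith
  have hε0 : 0 < ε := by
    by_contra h
    nlinarith [sq_pos_of_pos hδ]
  have hKMε : ε * (K ^ 2 * M ^ 2) = δ ^ 2 / 576 := by linarith
  have hδ2 : δ ^ 2 ≤ δ := by nlinarith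
  have hMε : ε * M ≤ 1 / 576 := by
    have : M ≤ K ^ 2 * M ^ 2 := by nlinarith
    nlinarith
  have hKε : ε * K ^ 2 ≤ δ ^ 2 / 576 := by
    have : K ^ 2 ≤ K ^ 2 * M ^ 2 := le_mul_of_one_le_right (by positivity) (hM.trans hM2)
    nlinarith
  have hε1 : ε ≤ 1 := by nlinarith
  have hH := sq_nonneg H
  have hP := sq_nonneg P
  have hQ := sq_nonneg Q
  have hG := sq_nonneg G
  have y1 : 2 * (G * H) ≤ 8 / ε ^ 2 * G ^ 2 + ε ^ 2 / 8 * H ^ 2 := by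
    have := two_mul_le_weighted (x := G) (y := H) (w := 8 / ε ^ 2) (by positivity)
    rwa [inv_div] at this
  have y2 : ε ^ 2 * (4 * (M * (G * H))) ≤ ε ^ 2 / 8 * H ^ 2 + G ^ 2 := by
    have h := two_mul_le_weighted (x := H) (y := 2 * M * G) (w := 1 / 8) (by norm_num)
    have h2 : ε ^ 2 * (32 * M ^ 2 * G ^ 2) ≤ G ^ 2 := by
      have : 32 * (ε * M) ^ 2 ≤ 1 := by
        have : 0 ≤ ε * M := by positivity
        nlinarith
      linarith [mul_le_mul_of_nonneg_right this hG]
    have := mul_le_mul_of_nonneg_left h (sq_nonneg ε)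
    rw [show (1 / 8 : ℝ)⁻¹ = 8 by norm_num] at this
    linarith
  have y3 : ε ^ 2 * (4 * (K * M * (H * P))) ≤ ε ^ 2 / 8 * H ^ 2 + δ / 4 * P ^ 2 := by
    have h := two_mul_le_weighted (x := H) (y := 2 * K * M * P) (w := 1 / 8) (by norm_num)
    have h2 : ε ^ 2 * (32 * (K ^ 2 * M ^ 2) * P ^ 2) ≤ δ / 4 * P ^ 2 := by
      have : ε ^ 2 * (32 * (K ^ 2 * M ^ 2)) ≤ δ / 4 := by
        have : ε ^ 2 * (32 * (K ^ 2 * M ^ 2)) = 32 * ε * (δ ^ 2 / 576) := by rw [← hKMε]; ring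
        nlinarith
      linarith [mul_le_mul_of_nonneg_right this hP]
    have := mul_le_mul_of_nonneg_left h (sq_nonneg ε)
    rw [show (1 / 8 : ℝ)⁻¹ = 8 by norm_num] at this
    linarith
  have y4 : ε ^ 3 * (6 * (M * H ^ 2)) ≤ ε ^ 2 / 8 * H ^ 2 := by
    have : ε ^ 3 * (6 * (M * H ^ 2)) = ε ^ 2 * H ^ 2 * (6 * (ε * M)) := by ring
    have h0 := mul_nonneg (sq_nonneg ε) hH
    linarith [mul_le_mul_of_nonneg_left hMε h0]
  have y5 : ε ^ 3 * (12 * (K * M * (H * Q))) ≤ ε ^ 2 / 8 * H ^ 2 + ε ^ 3 * (δ / 2 * Q ^ 2) := by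
    have h := two_mul_le_weighted (x := H) (y := 6 * ε * K * M * Q) (w := 1 / 8) (by norm_num)
    have h2 : ε ^ 2 * (8 * (6 * ε * K * M * Q) ^ 2) ≤ ε ^ 3 * (δ / 2 * Q ^ 2) := by
      have : ε ^ 2 * (8 * (6 * ε * K * M * Q) ^ 2) =
          288 * (ε ^ 3 * Q ^ 2) * (ε * (K ^ 2 * M ^ 2)) := by ring
      rw [this, hKMε]
      have : 0 ≤ ε ^ 3 * Q ^ 2 := by positivity
      linarith [mul_le_mul_of_nonneg_left hδ2 this]
    have := mul_le_mul_of_nonneg_left h (sq_nonneg ε)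
    rw [show (1 / 8 : ℝ)⁻¹ = 8 by norm_num] at this
    linarith
  have y6 : 4 * (K * M * (G * P)) ≤ δ / 2 * P ^ 2 + 8 * K ^ 2 * M ^ 2 / δ * G ^ 2 := by
    have h := two_mul_le_weighted (x := P) (y := 2 * K * M * G) (w := δ / 2) (by positivity)
    have e : (δ / 2)⁻¹ * (2 * K * M * G) ^ 2 = 8 * K ^ 2 * M ^ 2 / δ * G ^ 2 := by
      field_simp; ring
    rw [e] at h
    linarith
  have y7 : ε ^ 2 * (2 * (K * (P * Q))) ≤ δ / 2 * P ^ 2 + ε ^ 3 * (δ / 2 * Q ^ 2) := by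
    have h := two_mul_le_weighted (x := P) (y := ε ^ 2 * K * Q) (w := δ / 2) (by positivity)
    have h2 : (δ / 2)⁻¹ * (ε ^ 2 * K * Q) ^ 2 ≤ ε ^ 3 * (δ / 2 * Q ^ 2) := by
      have e : (δ / 2)⁻¹ * (ε ^ 2 * K * Q) ^ 2 = ε ^ 3 * Q ^ 2 * (2 * (ε * K ^ 2) / δ) := by
        rw [inv_div]; ring
      have : 2 * (ε * K ^ 2) / δ ≤ δ / 2 := by
        rw [div_le_iff₀ hδ]; nlinarith
      have h0 : 0 ≤ ε ^ 3 * Q ^ 2 := by positivity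
      rw [e]
      exact (mul_le_mul_of_nonneg_left this h0).trans_eq (by ring)
    linarith
  have y8 : ε ^ 2 * (4 * (K * M * (G * Q))) ≤ ε ^ 3 * (δ / 2 * Q ^ 2) + G ^ 2 := by
    have h := two_mul_le_weighted (x := Q) (y := 2 * K * M * G) (w := ε * δ / 2) (by positivity)
    have h2 : ε ^ 2 * ((ε * δ / 2)⁻¹ * (2 * K * M * G) ^ 2) ≤ G ^ 2 := by
      have e : ε ^ 2 * ((ε * δ / 2)⁻¹ * (2 * K * M * G) ^ 2) =
          G ^ 2 * (8 * (ε * (K ^ 2 * M ^ 2)) / δ) := by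
        field_simp; ring
      have : 8 * (ε * (K ^ 2 * M ^ 2)) / δ ≤ 1 := by
        rw [div_le_iff₀ hδ, hKMε]; nlinarith
      rw [e]
      exact mul_le_of_le_one_right hG this
    have := mul_le_mul_of_nonneg_left h (sq_nonneg ε)
    linarith
  have hr1 : 0 ≤ ε ^ 2 * H ^ 2 := by positivity
  have hr2 : 0 ≤ ε ^ 3 * (δ * Q ^ 2) := by positivity
  have hr3 : 0 ≤ δ * P ^ 2 := by positivity
  linarith

lemma hypoelliptic_density {φ X g h Pg Ph Vgg Vhh Vgh Vhg Wg Wh δ K M ε : ℝ} (hφ0 : 0 ≤ φ)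
    (hφ1 : φ ≤ 1) (hX : |X| ≤ M) (hδ : 0 < δ) (hδ1 : δ < 1) (hK : 1 ≤ K) (hM : 1 ≤ M)
    (hε : ε * (576 * K ^ 2 * M ^ 2) = δ ^ 2) (hVg : δ * Pg ^ 2 ≤ Vgg) (hVh : δ * Ph ^ 2 ≤ Vhh)
    (hVgh : |Vgh| ≤ K * Pg * Ph) (hVhg : |Vhg| ≤ K * Ph * Pg)
    (hWg : |Wg| ≤ K * M * Pg) (hWh : |Wh| ≤ K * M * Ph) :
    (2 * φ * X * g * g + φ ^ 2 * (h * g + h * g) - φ ^ 2 * (Vgg + Vgg) - g * (2 * φ * Wg)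
      - g * (2 * φ * Wg))
    - ε ^ 2 * (4 * φ ^ 3 * X * g * h + φ ^ 4 * (h * h + 0 * g) - φ ^ 4 * (Vhg + Vgh)
      - h * (4 * φ ^ 3 * Wg) - g * (4 * φ ^ 3 * Wh))
    + ε ^ 3 * (6 * φ ^ 5 * X * h * h + φ ^ 6 * (0 * h + 0 * h) - φ ^ 6 * (Vhh + Vhh)
      - h * (6 * φ ^ 5 * Wh) - h * (6 * φ ^ 5 * Wh)) + ε ^ 2 / 4 * (φ ^ 4 * h ^ 2) ≤
      (2 * M + 8 / ε ^ 2 + 1 + 8 * K ^ 2 * M ^ 2 / δ + 1) * g ^ 2 := by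
  have hε0 : 0 < ε := by
    by_contra hh
    have : 0 ≤ 576 * K ^ 2 * M ^ 2 := by positivity
    nlinarith [sq_pos_of_pos hδ]
  have hφX : |φ * X| ≤ M := by
    rw [abs_mul, abs_of_nonneg hφ0]
    exact (mul_le_of_le_one_left (abs_nonneg X) hφ1).trans hX
  have key := hypoelliptic_quadratic (G := |g|) (H := φ ^ 2 * |h|) (P := φ * Pg) (Q := φ ^ 3 * Ph)
    hδ hδ1 hK hM hε
  have hgg : |g| ^ 2 = g ^ 2 := sq_abs g
  have hhh : |h| ^ 2 = h ^ 2 := sq_abs h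
  have hgh : h * g ≤ |g| * |h| := by rw [← abs_mul, mul_comm]; exact le_abs_self _
  have t1 : 2 * φ * X * g * g ≤ 2 * M * |g| ^ 2 := by
    have := (le_abs_self _).trans hφX
    rw [hgg]
    nlinarith [sq_nonneg g]
  have t2 : φ ^ 2 * (h * g) ≤ |g| * (φ ^ 2 * |h|) := by
    have := mul_le_mul_of_nonneg_left hgh (sq_nonneg φ)
    linarith
  have t3 : φ ^ 2 * (δ * Pg ^ 2) ≤ φ ^ 2 * Vgg := mul_le_mul_of_nonneg_left hVg (sq_nonneg _)
  have t4 : φ * -(g * Wg) ≤ K * M * (|g| * (φ * Pg)) := by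
    have := mul_le_mul_of_nonneg_left (neg_mul_le_of_abs_le (x := g) hWg) hφ0
    linarith
  have t5 : -(φ ^ 3 * X * g * h) ≤ M * (|g| * (φ ^ 2 * |h|)) := by
    have := mul_le_mul_of_nonneg_left (neg_mul_le_of_abs_le (x := g * h) hφX) (sq_nonneg φ)
    rw [abs_mul] at this
    linarith
  have t6 : φ ^ 4 * Vhg ≤ K * (φ * Pg * (φ ^ 3 * Ph)) := by
    have := mul_le_mul_of_nonneg_left ((le_abs_self _).trans hVhg) (pow_nonneg hφ0 4)
    linarith
  have t7 : φ ^ 4 * Vgh ≤ K * (φ * Pg * (φ ^ 3 * Ph)) := by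
    have := mul_le_mul_of_nonneg_left ((le_abs_self _).trans hVgh) (pow_nonneg hφ0 4)
    linarith
  have t8 : φ ^ 3 * (h * Wg) ≤ K * M * (φ ^ 2 * |h| * (φ * Pg)) := by
    have := mul_le_mul_of_nonneg_left (mul_le_of_abs_le (x := h) hWg) (pow_nonneg hφ0 3)
    linarith
  have t9 : φ ^ 3 * (g * Wh) ≤ K * M * (|g| * (φ ^ 3 * Ph)) := by
    have := mul_le_mul_of_nonneg_left (mul_le_of_abs_le (x := g) hWh) (pow_nonneg hφ0 3)
    linarith
  have t10 : φ ^ 5 * X * h * h ≤ M * (φ ^ 2 * |h|) ^ 2 := by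
    have := mul_le_mul_of_nonneg_left (mul_le_of_abs_le (x := h * h) hφX) (pow_nonneg hφ0 4)
    rw [abs_mul] at this
    linarith
  have t11 : φ ^ 6 * (δ * Ph ^ 2) ≤ φ ^ 6 * Vhh := mul_le_mul_of_nonneg_left hVh (by positivity)
  have t12 : φ ^ 5 * -(h * Wh) ≤ K * M * (φ ^ 2 * |h| * (φ ^ 3 * Ph)) := by
    have := mul_le_mul_of_nonneg_left (neg_mul_le_of_abs_le (x := h) hWh) (pow_nonneg hφ0 5)
    linarith
  have hH2 : (φ ^ 2 * |h|) ^ 2 = φ ^ 4 * h ^ 2 := by rw [mul_pow, hhh]; ring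
  rw [hgg] at key t1
  rw [hH2] at key t10
  have u2 := mul_le_mul_of_nonneg_left (show -(4 * φ ^ 3 * X * g * h + φ ^ 4 * (h * h + 0 * g)
      - φ ^ 4 * (Vhg + Vgh) - h * (4 * φ ^ 3 * Wg) - g * (4 * φ ^ 3 * Wh)) ≤
      4 * (M * (|g| * (φ ^ 2 * |h|))) - φ ^ 4 * h ^ 2 + 2 * (K * (φ * Pg * (φ ^ 3 * Ph)))
      + 4 * (K * M * (φ ^ 2 * |h| * (φ * Pg))) + 4 * (K * M * (|g| * (φ ^ 3 * Ph))) by linarith)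
    (sq_nonneg ε)
  have u3 := mul_le_mul_of_nonneg_left (show 6 * φ ^ 5 * X * h * h + φ ^ 6 * (0 * h + 0 * h)
      - φ ^ 6 * (Vhh + Vhh) - h * (6 * φ ^ 5 * Wh) - h * (6 * φ ^ 5 * Wh) ≤
      6 * (M * (φ ^ 4 * h ^ 2)) - 2 * (δ * (φ ^ 3 * Ph) ^ 2)
      + 12 * (K * M * (φ ^ 2 * |h| * (φ ^ 3 * Ph))) by linarith) (pow_nonneg hε0.le 3)
  linarith

lemma ballInt_combination {R b c : ℝ} {f g h : Phase d → ℝ} (hf : Continuous f)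
    (hg : Continuous g) (hh : Continuous h) :
    ballInt R (fun p => f p - b * g p + c * h p) =
      ballInt R f - b * ballInt R g + c * ballInt R h := by
  unfold ballInt
  rw [integral_add, integral_sub, integral_const_mul, integral_const_mul]
  all_goals exact integrableOn_ball (by fun_prop) R

/-- Interior estimate for the commutator `h` of the transport with a velocity derivative `g`. -/
lemma hypoelliptic (d : ℕ) {ρ R : ℝ} (hρ : 0 < ρ) (hρR : ρ < R) (hR : R < 1) :
    ∃ C : ℝ, 0 ≤ C ∧ ∃ k : ℕ, ∀ δ ∈ Ioo (0 : ℝ) 1, ∀ a : ℝ → Matrix (Fin d) (Fin d) ℝ,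
      (∀ t, elliptic δ (a t)) → ∀ g h : ℝ → Phase d → ℝ, Regular g → Regular h →
      Solves a g h → Solves a h (fun _ _ => 0) → ∀ T ∈ Ico (-ρ) 0,
      cylInt ρ T (fun t p => h t p ^ 2) ≤ C * δ⁻¹ ^ k * cylInt R T (fun t p => g t p ^ 2) := by
  obtain ⟨M, hM, φ, φ', hc⟩ := exists_cutoff d hρ hρR
  set c : ℝ := 1 / (576 * (d + 1) ^ 2 * M ^ 2) with hcdef
  have hM0 : 0 < M := by linarith
  have hc0 : 0 < c := by positivity
  refine ⟨(2 * M + 2 + 8 * (d + 1) ^ 2 * M ^ 2 + 8 / c ^ 2) * (4 / c ^ 2), by positivity, 16, ?_⟩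
  intro δ hδ a ha g h hg hh sg sh T hT
  have hδ0 : 0 < δ := hδ.1
  have hδi : 1 ≤ δ⁻¹ := (one_le_inv₀ hδ0).2 hδ.2.le
  have hT' : T ∈ Ico (-R) 0 := ⟨by linarith [hT.1], hT.2⟩
  set K : ℝ := (d + 1) * δ⁻¹ with hK
  have hK1 : 1 ≤ K := by
    have : (0 : ℝ) ≤ d := Nat.cast_nonneg d
    exact one_le_mul_of_one_le_of_one_le (by linarith) hδi
  set ε : ℝ := c * δ ^ 4 with hε
  have hε0 : 0 < ε := by positivity
  have hεK : ε * (576 * K ^ 2 * M ^ 2) = δ ^ 2 := by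
    rw [hε, hK, hcdef]; field_simp
  have hε1 : ε ≤ 1 := by
    have hd : (0 : ℝ) ≤ d := Nat.cast_nonneg d
    have h1 : c ≤ 1 := by
      rw [hcdef, div_le_one (by positivity)]
      have h2 : (1 : ℝ) ≤ (d + 1) ^ 2 := one_le_pow₀ (by linarith)
      have h3 : 1 ≤ M ^ 2 := one_le_pow₀ hM
      nlinarith
    exact mul_le_one₀ h1 (by positivity) (pow_le_one₀ hδ0.le hδ.2.le)
  set N : ℝ := 2 * M + 8 / ε ^ 2 + 1 + 8 * K ^ 2 * M ^ 2 / δ + 1 with hN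
  have hgJ := hg.jointCont
  have hhJ := hh.jointCont
  have hzJ : JointCont (fun (_ : ℝ) (_ : Phase d) => (0 : ℝ)) := continuousOn_const
  have hφJ : JointCont φ := hc.cont.continuousOn
  have hsq : ∀ {F : ℝ → Phase d → ℝ}, JointCont F → JointCont fun t p => F t p ^ 2 :=
    fun h => ContinuousOn.pow h 2
  set lo : ℝ → Phase d → ℝ := fun t p => ε ^ 2 / 4 * (φ t p ^ 4 * h t p ^ 2) with hlo
  have hloJ : JointCont lo := by
    simp only [hlo]
    unfold JointCont at *
    fun_prop
  have hlo0 : ∀ t p, 0 ≤ lo t p := fun t p => by positivity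
  set up : ℝ → Phase d → ℝ := fun t p => N * g t p ^ 2 with hup
  have hupJ : JointCont up := continuousOn_const.mul (hsq hgJ)
  have hE2 := hc.jointCont_energyDt 2 hg hg
  have hE4 := hc.jointCont_energyDt 4 hg hh
  have hE6 := hc.jointCont_energyDt 6 hh hh
  have hest := energy_estimate
    (e := fun t p => φ t p ^ 2 * g t p * g t p - ε ^ 2 * (φ t p ^ 4 * g t p * h t p) +
      ε ^ 3 * (φ t p ^ 6 * h t p * h t p))
    (e' := fun t p => energyDt 2 φ φ' g g t p - ε ^ 2 * energyDt 4 φ φ' g h t p +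
      ε ^ 3 * energyDt 6 φ φ' h h t p) hR hT'
    (fun t ht => by
      have := hgJ.continuous ht
      have := hhJ.continuous ht
      have := (hc.smooth t).continuous
      fun_prop)
    ((hE2.sub (continuousOn_const.mul hE4)).add (continuousOn_const.mul hE6))
    (fun t ht p => ((hc.hasDerivAt_energy 2 hg hg ht p).sub
      ((hc.hasDerivAt_energy 4 hg hh ht p).const_mul _)).add
      ((hc.hasDerivAt_energy 6 hh hh ht p).const_mul _)) (fun p => by simp [hc.zero_time])
    hloJ hupJ (fun t ht => ?_)
  · have he0 : ∀ p, 0 ≤ φ T p ^ 2 * g T p * g T p - ε ^ 2 * (φ T p ^ 4 * g T p * h T p) +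
        ε ^ 3 * (φ T p ^ 6 * h T p * h T p) := by
      intro p
      have e : φ T p ^ 2 * g T p * g T p - ε ^ 2 * (φ T p ^ 4 * g T p * h T p) +
          ε ^ 3 * (φ T p ^ 6 * h T p * h T p) =
          (φ T p * g T p - ε ^ 2 / 2 * (φ T p ^ 3 * h T p)) ^ 2 +
          ε ^ 3 * (1 - ε / 4) * (φ T p ^ 3 * h T p) ^ 2 := by ring
      have h4 : 0 ≤ 1 - ε / 4 := by linarith
      rw [e]
      positivity
    have h2 := ballInt_nonneg (R := R) he0
    have h3 : cylInt ρ T (fun t p => ε ^ 2 / 4 * h t p ^ 2) ≤ cylInt R T lo := by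
      refine cylInt_mono_set hρR.le hR hT (continuousOn_const.mul (hsq hhJ)) hloJ hlo0
        fun t ht p hp => ?_
      simp only [hlo, hc.eq_one t p ht hp, one_pow, one_mul, le_refl]
    have hupN : cylInt R T up = N * cylInt R T (fun t p => g t p ^ 2) := cylInt_const_mul _ _ _ _
    rw [hupN] at hest
    rw [cylInt_const_mul] at h3
    have hJ0 : 0 ≤ cylInt R T (fun t p => g t p ^ 2) := cylInt_nonneg hT'.1 fun _ _ => sq_nonneg _
    have h5 : cylInt ρ T (fun t p => h t p ^ 2) ≤
        N * (4 / ε ^ 2) * cylInt R T (fun t p => g t p ^ 2) := by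
      have h6 : ε ^ 2 / 4 * cylInt ρ T (fun t p => h t p ^ 2) ≤
        N * cylInt R T (fun t p => g t p ^ 2) := by linarith
      have := mul_le_mul_of_nonneg_left h6 (show 0 ≤ 4 / ε ^ 2 by positivity)
      have e : 4 / ε ^ 2 * (ε ^ 2 / 4 * cylInt ρ T (fun t p => h t p ^ 2)) =
        cylInt ρ T (fun t p => h t p ^ 2) := by field_simp
      rw [e] at this
      linarith
    refine h5.trans (mul_le_mul_of_nonneg_right ?_ hJ0)
    have e1 : 4 / ε ^ 2 = 4 / c ^ 2 * δ⁻¹ ^ 8 := by rw [hε]; field_simp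
    have e2 : N = (2 * M + 2) + 8 * (d + 1) ^ 2 * M ^ 2 * δ⁻¹ ^ 3 + 8 / c ^ 2 * δ⁻¹ ^ 8 := by
      rw [hN, hK, hε]; field_simp; ring
    have e3 : N ≤ (2 * M + 2 + 8 * (d + 1) ^ 2 * M ^ 2 + 8 / c ^ 2) * δ⁻¹ ^ 8 := by
      rw [e2, add_mul, add_mul]
      have h8 : 1 ≤ δ⁻¹ ^ 8 := one_le_pow₀ hδi
      have h38 : δ⁻¹ ^ 3 ≤ δ⁻¹ ^ 8 := pow_le_pow_right₀ hδi (by norm_num)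
      gcongr
      exact le_mul_of_one_le_right (by linarith) h8
    rw [e1]
    calc N * (4 / c ^ 2 * δ⁻¹ ^ 8) ≤ _ := mul_le_mul_of_nonneg_right e3 (by positivity)
      _ = _ := by ring
  · have hR2 := continuous_energyRhs 2 (a t) (hc.smooth t) (hc.continuous' t) (hg.smooth t ht)
      (hg.smooth t ht) (hhJ.continuous ht) (hhJ.continuous ht)
    have hR4 := continuous_energyRhs 4 (a t) (hc.smooth t) (hc.continuous' t) (hg.smooth t ht)
      (hh.smooth t ht) (hhJ.continuous ht) (hzJ.continuous ht)
    have hR6 := continuous_energyRhs 6 (a t) (hc.smooth t) (hc.continuous' t) (hh.smooth t ht)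
      (hh.smooth t ht) (hzJ.continuous ht) (hzJ.continuous ht)
    rw [ballInt_combination (hE2.continuous ht) (hE4.continuous ht) (hE6.continuous ht),
      hc.ballInt_energyDt hR (by norm_num) hg hg hhJ hhJ sg sg ht,
      hc.ballInt_energyDt hR (by norm_num) hg hh hhJ hzJ sg sh ht,
      hc.ballInt_energyDt hR (by norm_num) hh hh hzJ hzJ sh sh ht,
      ← ballInt_combination hR2 hR4 hR6]
    have hRc : Continuous fun p =>
        energyRhs 2 (a t) (φ t) (φ' t) (g t) (g t) (h t) (h t) p -
          ε ^ 2 * energyRhs 4 (a t) (φ t) (φ' t) (g t) (h t) (h t) (fun _ => 0) p +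
          ε ^ 3 * energyRhs 6 (a t) (φ t) (φ' t) (h t) (h t) (fun _ => 0) (fun _ => 0) p :=
      (hR2.sub (continuous_const.mul hR4)).add (continuous_const.mul hR6)
    rw [← ballInt_add hRc (hloJ.continuous ht)]
    refine ballInt_mono (hRc.add (hloJ.continuous ht)) (hupJ.continuous ht) fun p _ => ?_
    have hW : ∀ g : ℝ → Phase d → ℝ, |velForm (a t) (φ t) (g t) p| ≤ K * M * velNorm (g t) p := by
      intro g
      refine (abs_velForm_le (ha t) hδ0 _ _ p).trans ?_
      have := hc.velNorm_le t p
      have := velNorm_nonneg (g t) p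
      gcongr
    have := hypoelliptic_density (g := g t p) (h := h t p) (hc.nonneg t p) (hc.le_one t p)
      (hc.transport_le t ht p) hδ0 hδ.2 hK1 hM hεK
      (le_velForm (ha t) (g t) p) (le_velForm (ha t) (h t) p)
      (abs_velForm_le (ha t) hδ0 (g t) (h t) p) (abs_velForm_le (ha t) hδ0 (h t) (g t) p)
      (hW g) (hW h)
    simpa [energyRhs, hlo, hup, hN] using this

/-- A solution of the model equation whose space gradient and shifted velocity Hessian have
square integrals bounded by `S` on interior cylinders. -/
structure Setup (δ : ℝ) (a : ℝ → Matrix (Fin d) (Fin d) ℝ) (U : ℝ → Phase d → ℝ) (χ : ℝ → ℝ)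
    (c : Fin d → Fin d → ℝ) (S : ℝ) : Prop where
  mem : δ ∈ Ioo (0 : ℝ) 1
  ell : ∀ t, elliptic δ (a t)
  reg : Regular U
  sol : Solves a U fun t _ => χ t
  nonneg : 0 ≤ S
  space : ∀ ρ ∈ Ico (1 / 2 : ℝ) 1, ∀ T ∈ Ico (-1 / 4 : ℝ) 0, ∀ i,
    cylInt ρ T (fun t p => pd (Sum.inl i) (U t) p ^ 2) ≤ S
  velocity : ∀ ρ ∈ Ico (1 / 2 : ℝ) 1, ∀ T ∈ Ico (-1 / 4 : ℝ) 0, ∀ i j,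
    cylInt ρ T (fun t p => (pd (Sum.inr i) (pd (Sum.inr j) (U t)) p - c i j) ^ 2) ≤ S

/-- A quantity attached to solutions that is bounded by `C δ⁻ᵏ S` uniformly over all setups. -/
def Controlled (Q : (ℝ → Phase d → ℝ) → (Fin d → Fin d → ℝ) → ℝ → ℝ) : Prop :=
  ∃ C : ℝ, 0 ≤ C ∧ ∃ k : ℕ, ∀ δ a U χ c S, Setup δ a U χ c S → ∀ T ∈ Ico (-1 / 4 : ℝ) 0,
    Q U c T ≤ C * δ⁻¹ ^ k * S

lemma Setup.one_le_inv {δ : ℝ} {a : ℝ → Matrix (Fin d) (Fin d) ℝ} {U : ℝ → Phase d → ℝ}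
    {χ : ℝ → ℝ} {c : Fin d → Fin d → ℝ} {S : ℝ} (h : Setup δ a U χ c S) : 1 ≤ δ⁻¹ :=
  (one_le_inv₀ h.mem.1).2 h.mem.2.le

lemma Controlled.of_le {Q Q' : (ℝ → Phase d → ℝ) → (Fin d → Fin d → ℝ) → ℝ → ℝ}
    (hQ' : Controlled Q') {C : ℝ} (hC : 0 ≤ C) {k : ℕ}
    (h : ∀ δ a U χ c S, Setup δ a U χ c S → ∀ T ∈ Ico (-1 / 4 : ℝ) 0,
      Q U c T ≤ C * δ⁻¹ ^ k * Q' U c T) : Controlled Q := by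
  obtain ⟨C', hC', k', h'⟩ := hQ'
  refine ⟨C * C', mul_nonneg hC hC', k + k', fun δ a U χ c S hS T hT => ?_⟩
  have hδ := inv_nonneg.2 hS.mem.1.le
  calc Q U c T ≤ C * δ⁻¹ ^ k * Q' U c T := h δ a U χ c S hS T hT
    _ ≤ C * δ⁻¹ ^ k * (C' * δ⁻¹ ^ k' * S) :=
      mul_le_mul_of_nonneg_left (h' δ a U χ c S hS T hT) (by positivity)
    _ = _ := by ring

lemma Controlled.mono {Q Q' : (ℝ → Phase d → ℝ) → (Fin d → Fin d → ℝ) → ℝ → ℝ}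
    (hQ' : Controlled Q')
    (h : ∀ δ a U χ c S, Setup δ a U χ c S → ∀ T ∈ Ico (-1 / 4 : ℝ) 0, Q U c T ≤ Q' U c T) :
    Controlled Q :=
  hQ'.of_le zero_le_one (k := 0) (by simpa using h)

lemma Controlled.add {Q Q' : (ℝ → Phase d → ℝ) → (Fin d → Fin d → ℝ) → ℝ → ℝ}
    (hQ : Controlled Q) (hQ' : Controlled Q') : Controlled fun U c T => Q U c T + Q' U c T := by
  obtain ⟨C, hC, k, h⟩ := hQ
  obtain ⟨C', hC', k', h'⟩ := hQ'
  refine ⟨C + C', add_nonneg hC hC', k + k', fun δ a U χ c S hS T hT => ?_⟩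
  have hδ := hS.one_le_inv
  have hS0 := hS.nonneg
  rw [add_mul, add_mul]
  refine add_le_add ((h δ a U χ c S hS T hT).trans ?_) ((h' δ a U χ c S hS T hT).trans ?_)
  · gcongr
    exact Nat.le_add_right _ _
  · gcongr
    exact Nat.le_add_left _ _

lemma Controlled.zero : Controlled fun (_ : ℝ → Phase d → ℝ) (_ : Fin d → Fin d → ℝ) _ => 0 :=
  ⟨0, le_rfl, 0, fun δ a U χ c S _ T _ => by simp⟩

/-- Interior control of the square integrals of the derivative along a list. -/
def GoodList (L : List (Dir d)) : Prop :=
  ∀ ρ ∈ Ico (1 / 2 : ℝ) 1,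
    Controlled fun U (_ : Fin d → Fin d → ℝ) T => cylInt ρ T fun t p => pdList L (U t) p ^ 2

lemma JointCont.sq {F : ℝ → Phase d → ℝ} (h : JointCont F) : JointCont fun t p => F t p ^ 2 :=
  ContinuousOn.pow h 2

lemma Regular.jointCont_listSum {U : ℝ → Phase d → ℝ} (hU : Regular U)
    (S : List (List (Dir d))) :
    JointCont fun t p => (S.map fun L => Kinetic.pdList L (U t) p).sum := by
  induction S with
  | nil => exact continuousOn_const
  | cons L S ih => simp only [List.map_cons, List.sum_cons]; exact (hU.cont L).add ih

lemma Ico_subset_Ico_time {ρ T : ℝ} (hρ : 1 / 2 ≤ ρ) (hT : T ∈ Ico (-1 / 4 : ℝ) 0) :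
    T ∈ Ico (-ρ) 0 := ⟨by linarith [hT.1], hT.2⟩

lemma controlled_listSum {ρ : ℝ} (hρ : ρ ∈ Ico (1 / 2 : ℝ) 1) {S : List (List (Dir d))}
    (hS : ∀ L ∈ S, GoodList L) :
    Controlled fun U (_ : Fin d → Fin d → ℝ) T =>
      cylInt ρ T fun t p => (S.map fun L => pdList L (U t) p).sum ^ 2 := by
  induction S with
  | nil => simpa [cylInt, ballInt] using Controlled.zero (d := d)
  | cons L S ih =>
    have h := ((hS L (by simp)) ρ hρ).add (ih fun L' hL' => hS L' (by simp [hL']))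
    refine h.of_le zero_le_two (k := 0) fun δ a U χ c s hs T hT => ?_
    have hT' := Ico_subset_Ico_time hρ.1 hT
    have h1 := hs.reg.cont L
    have h2 := hs.reg.jointCont_listSum S
    have h3 : JointCont fun t p => ((L :: S).map fun L => pdList L (U t) p).sum :=
      hs.reg.jointCont_listSum (L :: S)
    rw [pow_zero, mul_one, ← cylInt_add hρ.2 hT' h1.sq h2.sq, ← cylInt_const_mul]
    have h4 : JointCont fun t p => 2 * (pdList L (U t) p ^ 2 +
        (S.map fun L => pdList L (U t) p).sum ^ 2) :=
      continuousOn_const.mul (h1.sq.add h2.sq)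
    refine cylInt_mono hρ.2 hT' h3.sq h4 fun t ht => ballInt_mono (h3.sq.continuous ht)
      (h4.continuous ht) fun p _ => ?_
    simp only [List.map_cons, List.sum_cons]
    nlinarith [sq_nonneg (pdList L (U t) p - (S.map fun L => pdList L (U t) p).sum)]

lemma Setup.solves_pdList {δ : ℝ} {a : ℝ → Matrix (Fin d) (Fin d) ℝ} {U : ℝ → Phase d → ℝ}
    {χ : ℝ → ℝ} {c : Fin d → Fin d → ℝ} {S : ℝ} (h : Setup δ a U χ c S) {L : List (Dir d)}
    (hL : L ≠ []) : Solves a (fun t => pdList L (U t)) fun t => commSource L (U t) := by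
  intro t ht p hp
  have := h.sol.pdList h.reg L t ht p hp
  simp only [pdList_const _ hL, zero_add] at this
  exact this

lemma Solves.sub_const {a : ℝ → Matrix (Fin d) (Fin d) ℝ} {G f : ℝ → Phase d → ℝ}
    (hs : Solves a G f) (c : ℝ) : Solves a (fun t p => G t p - c) f := by
  intro t ht p hp
  have hpd : ∀ e, Kinetic.pd e (fun p => G t p - c) = Kinetic.pd e (G t) := fun e => by
    funext q
    simp only [Kinetic.pd, fderiv_sub_const]
  have : dt (fun t p => G t p - c) t p = dt G t p := by simp only [dt, deriv_sub_const]
  rw [this, hs t ht p hp]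
  simp only [transport, diffusion, hpd]

/-- The constant subtracted from second velocity derivatives. -/
def offset (c : Fin d → Fin d → ℝ) : List (Dir d) → ℝ
  | [Sum.inr i, Sum.inr j] => c i j
  | _ => 0

lemma pd_sub_const (e : Dir d) (f : Phase d → ℝ) (c : ℝ) : pd e (fun p => f p - c) = pd e f := by
  funext q
  simp only [pd, fderiv_sub_const]

/-- Adding a velocity derivative to a controlled list. -/
lemma goodList_inr_cons {L : List (Dir d)} (hL : L ≠ [])
    (h : ∀ ρ ∈ Ico (1 / 2 : ℝ) 1, Controlled fun U c T =>
      cylInt ρ T fun t p => (pdList L (U t) p - offset c L) ^ 2)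
    (hcomm : ∀ L' ∈ commLists L, GoodList L') (i : Fin d) : GoodList (Sum.inr i :: L) := by
  intro ρ hρ
  obtain ⟨C, hC, k, hest⟩ := caccioppoli d (ρ := ρ) (R := (ρ + 1) / 2) (by linarith [hρ.1])
    (by linarith [hρ.2]) (by linarith [hρ.2])
  have hR : (ρ + 1) / 2 ∈ Ico (1 / 2 : ℝ) 1 := ⟨by linarith [hρ.1], by linarith [hρ.2]⟩
  refine ((h _ hR).add (controlled_listSum hR hcomm)).of_le hC (k := k)
    fun δ a U χ c s hs T hT => ?_
  have hg := (hs.reg.pdList L).sub_const (offset c L)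
  have := (hest δ hs.mem a hs.ell _ _ hg (hs.reg.jointCont_listSum (commLists L))
    ((hs.solves_pdList hL).sub_const _) T (Ico_subset_Ico_time hρ.1 hT)).2 i
  simpa only [pd_sub_const, pdList] using this

lemma commLists_inl {L : List (Dir d)} (hL : ∀ e ∈ L, ∃ i, e = Sum.inl i) : commLists L = [] := by
  induction L with
  | nil => rfl
  | cons e L ih =>
    obtain ⟨i, rfl⟩ := hL e (by simp)
    simp [commLists, ih fun e he => hL e (by simp [he])]

lemma offset_eq_zero_of_inl {L : List (Dir d)} {i : Fin d} (h : Sum.inl i ∈ L)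
    (c : Fin d → Fin d → ℝ) : offset c L = 0 := by
  unfold offset
  split
  · simp at h
  · rfl

lemma offset_eq_zero_of_length {L : List (Dir d)} (h : L.length ≠ 2)
    (c : Fin d → Fin d → ℝ) : offset c L = 0 := by
  unfold offset
  split
  · simp at h
  · rfl

lemma goodList_inl {L : List (Dir d)} (hL0 : L ≠ []) (hL : ∀ e ∈ L, ∃ i, e = Sum.inl i) :
    GoodList L := by
  induction L with
  | nil => exact absurd rfl hL0
  | cons e L ih =>
    obtain ⟨i, rfl⟩ := hL e (by simp)
    have hL' : ∀ e ∈ L, ∃ i, e = Sum.inl i := fun e he => hL e (by simp [he])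
    by_cases hne : L = []
    · subst hne
      exact fun ρ hρ => ⟨1, zero_le_one, 0, fun δ a U χ c s hs T hT => by
        simpa [pdList] using hs.space ρ hρ T hT i⟩
    · have hgood := ih hne hL'
      obtain ⟨e', he'⟩ := List.exists_mem_of_ne_nil L hne
      obtain ⟨i', rfl⟩ := hL' e' he'
      have hg := goodList_inr_cons hne
        (fun ρ hρ => by simpa [offset_eq_zero_of_inl he'] using hgood ρ hρ)
        (by simp [commLists_inl hL']) i
      intro ρ hρ
      obtain ⟨C, hC, k, hest⟩ := hypoelliptic d (ρ := ρ) (R := (ρ + 1) / 2) (by linarith [hρ.1])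
        (by linarith [hρ.2]) (by linarith [hρ.2])
      have hR : (ρ + 1) / 2 ∈ Ico (1 / 2 : ℝ) 1 := ⟨by linarith [hρ.1], by linarith [hρ.2]⟩
      refine (hg _ hR).of_le hC (k := k) fun δ a U χ c s hs T hT => ?_
      refine hest δ hs.mem a hs.ell _ _ (hs.reg.pdList (Sum.inr i :: L))
        (hs.reg.pdList (Sum.inl i :: L)) ?_ ?_ T (Ico_subset_Ico_time hρ.1 hT)
      · have := hs.solves_pdList (L := Sum.inr i :: L) (by simp)
        simpa +unfoldPartialApp [commSource, commLists, commLists_inl hL'] using this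
      · have := hs.solves_pdList (L := Sum.inl i :: L) (by simp)
        simpa +unfoldPartialApp [commSource, commLists, commLists_inl hL'] using this

lemma GoodList.perm {L L' : List (Dir d)} (h : GoodList L) (hp : L'.Perm L) : GoodList L' := by
  intro ρ hρ
  refine (h ρ hρ).mono fun δ a U χ c s hs T hT => le_of_eq ?_
  have hT' := Ico_subset_Ico_time hρ.1 hT
  refine intervalIntegral.integral_congr fun t ht => ?_
  simp only [pdList_perm hp (hs.reg.smooth t (uIcc_subset_timeI hρ.2 hT' ht))]

lemma commLists_spec {L L' : List (Dir d)} (h : L' ∈ commLists L) :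
    (∃ i, Sum.inl i ∈ L') ∧ L'.countP Sum.isRight + 1 = L.countP Sum.isRight := by
  induction L generalizing L' with
  | nil => simp [commLists] at h
  | cons e L ih =>
    rcases e with i | i
    · simp only [commLists, List.mem_map] at h
      obtain ⟨L'', hL'', rfl⟩ := h
      exact ⟨⟨i, by simp⟩, by simpa using (ih hL'').2⟩
    · simp only [commLists, List.mem_cons, List.mem_map] at h
      rcases h with rfl | ⟨L'', hL'', rfl⟩
      · exact ⟨⟨i, by simp⟩, by simp [List.countP_cons]⟩
      · obtain ⟨⟨i', hi'⟩, hc⟩ := ih hL''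
        exact ⟨⟨i', by simp [hi']⟩, by simp [List.countP_cons, ← hc]⟩

lemma goodList_of_inl_mem {L : List (Dir d)} (hL : ∃ i, Sum.inl i ∈ L) : GoodList L := by
  obtain ⟨n, hn⟩ : ∃ n, n = L.countP Sum.isRight := ⟨_, rfl⟩
  induction n using Nat.strong_induction_on generalizing L with
  | _ n ih =>
    obtain ⟨i, hi⟩ := hL
    by_cases h : ∀ e ∈ L, ∃ i, e = Sum.inl i
    · exact goodList_inl (List.ne_nil_of_mem hi) h
    · push Not at h
      obtain ⟨e, he, hne⟩ := h
      rcases e with j | j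
      · exact absurd rfl (hne j)
      · obtain ⟨L0, hp⟩ : ∃ L0, L.Perm (Sum.inr j :: L0) := by
          obtain ⟨L1, L2, rfl⟩ := List.append_of_mem he
          exact ⟨_, List.perm_middle⟩
        have hi0 : Sum.inl i ∈ L0 := by simpa using hp.mem_iff.1 hi
        have hc : L.countP Sum.isRight = L0.countP Sum.isRight + 1 := by
          rw [hp.countP_eq]; simp [List.countP_cons]
        refine GoodList.perm (goodList_inr_cons (List.ne_nil_of_mem hi0) (fun ρ hρ => ?_)
          (fun L' hL' => ?_) j) hp
        · simpa [offset_eq_zero_of_inl hi0] using ih _ (by omega) ⟨i, hi0⟩ rfl ρ hρ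
        · exact ih _ (by have := (commLists_spec hL').2; omega) (commLists_spec hL').1 rfl

lemma goodList_of_length {L : List (Dir d)} (hL : 3 ≤ L.length) : GoodList L := by
  induction L with
  | nil => simp at hL
  | cons e L ih =>
    by_cases h : ∃ i, Sum.inl i ∈ e :: L
    · exact goodList_of_inl_mem h
    push Not at h
    obtain ⟨i, rfl⟩ : ∃ i, e = Sum.inr i := by
      rcases e with i | i
      · exact absurd (by simp) (h i)
      · exact ⟨i, rfl⟩
    have hlen : 2 ≤ L.length := by simpa using hL
    refine goodList_inr_cons (by rintro rfl; simp at hlen) (fun ρ hρ => ?_)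
      (fun L' hL' => goodList_of_inl_mem (commLists_spec hL').1) i
    rcases hlen.eq_or_lt with h2 | h3
    · obtain ⟨e1, e2, rfl⟩ := List.length_eq_two.1 h2.symm
      rcases e1 with i1 | i1
      · exact absurd (by simp) (h i1)
      rcases e2 with i2 | i2
      · exact absurd (by simp) (h i2)
      exact ⟨1, zero_le_one, 0, fun δ a U χ c s hs T hT => by
        simpa [pdList, offset] using hs.velocity ρ hρ T hT i1 i2⟩
    · simpa [offset_eq_zero_of_length (show L.length ≠ 2 by omega)] using ih h3 ρ hρ

/-- Lists of directions whose derivatives are controlled: they contain a space direction or have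
length at least three. -/
def Relevant (L : List (Dir d)) : Prop := (∃ i, Sum.inl i ∈ L) ∨ 3 ≤ L.length

lemma Relevant.append {L : List (Dir d)} (h : Relevant L) (L' : List (Dir d)) :
    Relevant (L' ++ L) := by
  rcases h with ⟨i, hi⟩ | h
  · exact Or.inl ⟨i, by simp [hi]⟩
  · exact Or.inr (by simp; omega)

lemma Relevant.ne_nil {L : List (Dir d)} (h : Relevant L) : L ≠ [] := by
  rintro rfl
  rcases h with ⟨i, hi⟩ | h
  · simp at hi
  · simp at h

lemma Relevant.goodList {L : List (Dir d)} (h : Relevant L) : GoodList L :=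
  h.elim goodList_of_inl_mem goodList_of_length

lemma Relevant.controlled_ballInt {L : List (Dir d)} (h : Relevant L) :
    Controlled fun U (_ : Fin d → Fin d → ℝ) T =>
      ballInt (3 / 4) fun p => pdList L (U T) p ^ 2 := by
  obtain ⟨C, hC, k, hest⟩ := caccioppoli d (ρ := 3 / 4) (R := 7 / 8) (by norm_num)
    (by norm_num) (by norm_num)
  have hR : (7 / 8 : ℝ) ∈ Ico (1 / 2 : ℝ) 1 := by norm_num
  refine ((h.goodList _ hR).add (controlled_listSum hR fun L' hL' =>
    goodList_of_inl_mem (commLists_spec (L := L) hL').1)).of_le hC (k := k)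
    fun δ a U χ c s hs T hT => ?_
  exact (hest δ hs.mem a hs.ell _ _ (hs.reg.pdList L) (hs.reg.jointCont_listSum (commLists L))
    (hs.solves_pdList h.ne_nil) T (Ico_subset_Ico_time (by norm_num) hT)).1

/-- Phase space points from their coordinates. -/
def ofCoord (y : Dir d → ℝ) : Phase d :=
  (WithLp.toLp 2 fun i => y (Sum.inl i), WithLp.toLp 2 fun i => y (Sum.inr i))

lemma ofCoord_update (y : Dir d → ℝ) (e : Dir d) (s : ℝ) :
    ofCoord (Function.update y e s) = ofCoord (Function.update y e 0) + s • basisVec e := by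
  rcases e with i | i
  · refine Prod.ext (PiLp.ext fun k => ?_) (PiLp.ext fun k => ?_)
    · by_cases hk : k = i
      · subst hk; simp [ofCoord, basisVec]
      · simp [ofCoord, basisVec, hk]
    · simp [ofCoord, basisVec]
  · refine Prod.ext (PiLp.ext fun k => ?_) (PiLp.ext fun k => ?_)
    · simp [ofCoord, basisVec]
    · by_cases hk : k = i
      · subst hk; simp [ofCoord, basisVec]
      · simp [ofCoord, basisVec, hk]

lemma continuous_ofCoord : Continuous (ofCoord (d := d)) := by
  unfold ofCoord
  fun_prop

lemma abs_le_norm_ofCoord (y : Dir d → ℝ) (e : Dir d) : |y e| ≤ ‖ofCoord y‖ := by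
  rcases e with i | i
  · exact (PiLp.norm_apply_le (ofCoord y).1 i).trans (norm_fst_le _)
  · exact (PiLp.norm_apply_le (ofCoord y).2 i).trans (norm_snd_le _)

lemma measurePreserving_ofCoord : MeasurePreserving (ofCoord (d := d)) := by
  have h1 := volume_measurePreserving_sumPiEquivProdPi (fun _ : Dir d => ℝ)
  exact ((PiLp.volume_preserving_toLp (Fin d)).prod (PiLp.volume_preserving_toLp (Fin d))).comp h1

lemma enorm_le_lintegral_pd {f : Phase d → ℝ} (hf : Smooth f) {R : ℝ}
    (h0 : ∀ p ∉ Metric.closedBall (0 : Phase d) R, f p = 0) (e : Dir d) (y : Dir d → ℝ) :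
    ‖f (ofCoord y)‖ₑ ≤ ∫⁻ s, ‖pd e f (ofCoord (Function.update y e s))‖ₑ := by
  set F : ℝ → ℝ := fun s => f (ofCoord (Function.update y e s)) with hF
  have hd : ∀ s, HasDerivAt F (pd e f (ofCoord (Function.update y e s))) s := fun s => by
    rw [show F = fun s => f (ofCoord (Function.update y e 0) + s • basisVec e) from
      funext fun s => congrArg f (ofCoord_update y e s), ofCoord_update y e s]
    exact hasDerivAt_line hf e _ s
  have hcont : Continuous fun s => pd e f (ofCoord (Function.update y e s)) :=
    (hf.pd e).continuous.comp (continuous_ofCoord.comp (continuous_const.update e continuous_id))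
  have hC1 : ContDiff ℝ 1 F := contDiff_one_iff_deriv.2
    ⟨fun s => (hd s).differentiableAt, by
      rw [show deriv F = _ from funext fun s => (hd s).deriv]; exact hcont⟩
  have hsupp : HasCompactSupport F := by
    refine HasCompactSupport.intro (isCompact_Icc (a := -R) (b := R)) fun s hs =>
      h0 _ fun h => hs ?_
    have := abs_le_norm_ofCoord (Function.update y e s) e
    rw [Function.update_self] at this
    exact abs_le.1 (this.trans (mem_closedBall_zero_iff.1 h))
  have := hsupp.enorm_le_lintegral_Ici_deriv hC1 (y e)
  simp only [hF, Function.update_eq_self] at this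
  refine this.trans ((setLIntegral_le_lintegral _ _).trans_eq ?_)
  exact lintegral_congr fun s => by rw [← (hd s).deriv]

lemma pdList_eq_zero_of_support {f : Phase d → ℝ} {K : Set (Phase d)} (hK : IsClosed K)
    (hf : ∀ p ∉ K, f p = 0) (L : List (Dir d)) : ∀ p ∉ K, pdList L f p = 0 := by
  induction L with
  | nil => exact hf
  | cons e L ih => exact pd_eq_zero_of_support hK ih e

lemma enorm_le_lmarginal_pdList {f : Phase d → ℝ} (hf : Smooth f) {R : ℝ}
    (h0 : ∀ p ∉ Metric.closedBall (0 : Phase d) R, f p = 0) {L : List (Dir d)} (hL : L.Nodup) :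
    (fun y => ‖f (ofCoord y)‖ₑ) ≤
      lmarginal (fun _ => volume) L.toFinset fun y => ‖pdList L f (ofCoord y)‖ₑ := by
  induction L with
  | nil => simp [pdList]
  | cons e L ih =>
    have hnot : e ∉ L.toFinset := by simpa using (List.nodup_cons.1 hL).1
    have hm : Measurable fun y => ‖pdList (e :: L) f (ofCoord y)‖ₑ :=
      ((hf.pdList _).continuous.comp continuous_ofCoord).measurable.enorm
    rw [List.toFinset_cons, lmarginal_insert' _ hm hnot]
    exact (ih (List.nodup_cons.1 hL).2).trans (lmarginal_mono fun y =>
      enorm_le_lintegral_pd (hf.pdList L)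
        (pdList_eq_zero_of_support Metric.isClosed_closedBall h0 L) e y)

/-- A compactly supported function is bounded by the integral of its full mixed derivative. -/
lemma abs_le_ballInt_pdList {f : Phase d → ℝ} (hf : Smooth f) {R : ℝ}
    (h0 : ∀ p ∉ Metric.closedBall (0 : Phase d) R, f p = 0) (p : Phase d) :
    |f p| ≤ ballInt R fun q => |pdList Finset.univ.toList f q| := by
  set L : List (Dir d) := Finset.univ.toList with hLdef
  have hz := pdList_eq_zero_of_support Metric.isClosed_closedBall h0 L
  have hc := (hf.pdList L).continuous
  have h1 := enorm_le_lmarginal_pdList hf h0 (L := L) (Finset.nodup_toList _)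
    (Sum.elim (fun i => p.1 i) fun i => p.2 i)
  have hLu : L.toFinset = Finset.univ := Finset.toList_toFinset _
  simp only [hLu, lmarginal_univ] at h1
  have h2 : ∫⁻ y, ‖pdList L f (ofCoord y)‖ₑ = ∫⁻ q, ‖pdList L f q‖ₑ :=
    measurePreserving_ofCoord.lintegral_comp hc.measurable.enorm
  rw [← volume_pi, h2] at h1
  have h3 : ∫⁻ q, ‖pdList L f q‖ₑ = ∫⁻ q in Metric.closedBall (0 : Phase d) R, ‖pdList L f q‖ₑ := by
    rw [← lintegral_indicator Metric.isClosed_closedBall.measurableSet]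
    refine lintegral_congr fun q => ?_
    by_cases hq : q ∈ Metric.closedBall (0 : Phase d) R
    · rw [indicator_of_mem hq]
    · rw [indicator_of_notMem hq, hz q hq, enorm_zero]
  rw [h3, ← ofReal_integral_norm_eq_lintegral_enorm (integrableOn_ball hc R)] at h1
  have h4 : ofCoord (Sum.elim (fun i => p.1 i) fun i => p.2 i) = p := rfl
  rw [h4, ← ofReal_norm, ENNReal.ofReal_le_ofReal_iff (by positivity)] at h1
  exact h1

lemma pdList_cons_eq (e : Dir d) (L : List (Dir d)) {f : Phase d → ℝ} (hf : Smooth f) :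
    pdList (e :: L) f = pdList L (pd e f) := by
  rw [pdList_perm (List.perm_append_singleton e L).symm hf, pdList_append]
  rfl

lemma abs_pdList_mul_le (L : List (Dir d)) {β : Phase d → ℝ} (hβ : Smooth β) (R : ℝ) :
    ∃ M : ℝ, 0 ≤ M ∧ ∀ g : Phase d → ℝ, Smooth g → ∀ q ∈ Metric.closedBall (0 : Phase d) R,
      |pdList L (fun p => β p * g p) q| ≤ M * (L.sublists'.map fun L' => |pdList L' g q|).sum := by
  induction L generalizing β with
  | nil =>
    obtain ⟨M, hM⟩ := (isCompact_closedBall (0 : Phase d) R).exists_bound_of_continuousOn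
      hβ.continuous.continuousOn
    refine ⟨max M 0, le_max_right _ _, fun g _ q hq => ?_⟩
    simp only [pdList, List.sublists'_nil, List.map_cons, List.map_nil, List.sum_cons,
      List.sum_nil, add_zero, abs_mul]
    exact mul_le_mul_of_nonneg_right ((hM q hq).trans (le_max_left _ _)) (abs_nonneg _)
  | cons e L ih =>
    obtain ⟨M, hM0, hM⟩ := ih hβ
    obtain ⟨M', hM'0, hM'⟩ := ih (hβ.pd e)
    refine ⟨max M M', hM0.trans (le_max_left _ _), fun g hg q hq => ?_⟩
    rw [pdList_cons_eq e L (hβ.mul hg), pd_mul hβ hg,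
      pdList_add ((hβ.pd e).mul hg) (hβ.mul (hg.pd e)), List.sublists'_cons, List.map_append,
      List.map_map, List.sum_append, mul_add]
    refine (abs_add_le _ _).trans (add_le_add ?_ ?_)
    · refine (hM' g hg q hq).trans (mul_le_mul_of_nonneg_right (le_max_right _ _) ?_)
      exact List.sum_nonneg (by simp)
    · refine (hM _ (hg.pd e) q hq).trans ?_
      simp only [Function.comp_def, pdList_cons_eq e _ hg]
      exact mul_le_mul_of_nonneg_right (le_max_left _ _) (List.sum_nonneg (by simp))

lemma sq_ballInt_le {y : Phase d → ℝ} (hy : Continuous y) (R : ℝ) :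
    ballInt R y ^ 2 ≤ volume.real (Metric.closedBall (0 : Phase d) R) *
      ballInt R fun p => y p ^ 2 := by
  set V := volume.real (Metric.closedBall (0 : Phase d) R) with hV
  set I := ballInt R y with hI
  have h0 : 0 ≤ ballInt R fun p => (V * y p - I) ^ 2 := ballInt_nonneg fun p => sq_nonneg _
  have h1 : ballInt R (fun p => (V * y p - I) ^ 2) =
      V ^ 2 * ballInt R (fun p => y p ^ 2) - V * I ^ 2 := by
    have : (fun p => (V * y p - I) ^ 2) =
        fun p => V ^ 2 * y p ^ 2 + (-2 * V * I * y p + I ^ 2) := by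
      funext p; ring
    rw [this, ballInt_add (by fun_prop) (by fun_prop), ballInt_add (by fun_prop) (by fun_prop)]
    simp only [ballInt, integral_const_mul, setIntegral_const, smul_eq_mul]
    change _ + (-2 * V * I * I + _) = _
    ring
  have hV0 : 0 ≤ V := measureReal_nonneg
  rcases hV0.eq_or_lt with h | h
  · have : I = 0 := by
      have hz : volume (Metric.closedBall (0 : Phase d) R) = 0 :=
        ((measureReal_eq_zero_iff (isCompact_closedBall _ _).measure_lt_top.ne).1 h.symm)
      simp [hI, ballInt, Measure.restrict_eq_zero.2 hz]
    simp [this, ← h]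
  · have : 0 ≤ V * (V * ballInt R (fun p => y p ^ 2) - I ^ 2) := by nlinarith
    have := nonneg_of_mul_nonneg_right this h
    linarith

lemma controlled_listSum_abs {R : ℝ} {S : List (List (Dir d))}
    (hS : ∀ L ∈ S, Controlled fun U (_ : Fin d → Fin d → ℝ) T =>
      ballInt R fun p => pdList L (U T) p ^ 2) :
    Controlled fun U (_ : Fin d → Fin d → ℝ) T =>
      ballInt R fun p => (S.map fun L => |pdList L (U T) p|).sum ^ 2 := by
  induction S with
  | nil => simpa [ballInt] using Controlled.zero (d := d)
  | cons L S ih =>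
    have h := (hS L (by simp)).add (ih fun L' hL' => hS L' (by simp [hL']))
    refine h.of_le zero_le_two (k := 0) fun δ a U χ c s hs T hT => ?_
    have hsm := hs.reg.smooth T ⟨by linarith [hT.1], hT.2⟩
    have h1 := (hsm.pdList L).continuous
    have h2 : Continuous fun p => (S.map fun L => |pdList L (U T) p|).sum :=
      continuous_list_sum S fun L _ => (hsm.pdList L).continuous.abs
    have h3 : Continuous fun p => pdList L (U T) p ^ 2 := h1.pow 2
    have h4 : Continuous fun p => (S.map fun L => |pdList L (U T) p|).sum ^ 2 := h2.pow 2
    rw [pow_zero, mul_one, ← ballInt_add h3 h4, ballInt, ballInt, ← integral_const_mul]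
    simp only [List.map_cons, List.sum_cons]
    refine ballInt_mono (by fun_prop) (by fun_prop) fun p _ => ?_
    nlinarith [sq_nonneg (|pdList L (U T) p| - (S.map fun L => |pdList L (U T) p|).sum),
      sq_abs (pdList L (U T) p)]

/-- Pointwise interior control of the derivative along a relevant list. -/
lemma Relevant.pointwise {L : List (Dir d)} (h : Relevant L) :
    ∃ C : ℝ, 0 ≤ C ∧ ∃ k : ℕ, ∀ δ a U χ c S, Setup δ a U χ c S → ∀ T ∈ Ico (-1 / 4 : ℝ) 0,
      ∀ p ∈ Metric.closedBall (0 : Phase d) (1 / 2), pdList L (U T) p ^ 2 ≤ C * δ⁻¹ ^ k * S := by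
  set E : List (Dir d) := Finset.univ.toList with hE
  let b : ContDiffBump (0 : Phase d) := ⟨1 / 2, 3 / 4, by norm_num, by norm_num⟩
  have hb : Smooth b := b.contDiff
  obtain ⟨M, hM0, hM⟩ := abs_pdList_mul_le E hb (3 / 4)
  set V := volume.real (Metric.closedBall (0 : Phase d) (3 / 4)) with hV
  obtain ⟨C, hC, k, hest⟩ := controlled_listSum_abs (R := 3 / 4)
    (S := E.sublists'.map (· ++ L)) fun L' hL' => by
      obtain ⟨L'', -, rfl⟩ := List.mem_map.1 hL'
      exact (h.append L'').controlled_ballInt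
  refine ⟨M ^ 2 * V * C, by positivity, k, fun δ a U χ c S hS T hT p hp => ?_⟩
  have hU := hS.reg.smooth T ⟨by linarith [hT.1], hT.2⟩
  have hg := hU.pdList L
  set y : Phase d → ℝ := fun q => (E.sublists'.map fun L' => |pdList L' (pdList L (U T)) q|).sum
    with hy
  have hyc : Continuous y := continuous_list_sum _ fun L' _ => (hg.pdList L').continuous.abs
  have h1 : |pdList L (U T) p| ≤ M * ballInt (3 / 4) y := by
    have hbp : b p = 1 := b.one_of_mem_closedBall hp
    have := abs_le_ballInt_pdList (hb.mul hg) (R := 3 / 4) (fun q hq => by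
      rw [b.zero_of_le_dist (not_le.1 hq).le, zero_mul]) p
    rw [hbp, one_mul] at this
    refine this.trans ?_
    rw [ballInt, ballInt, ← integral_const_mul]
    exact ballInt_mono (Smooth.pdList (hb.mul hg) _).continuous.abs (continuous_const.mul hyc)
      fun q hq => hM _ hg q hq
  have h2 : ballInt (3 / 4) (fun q => y q ^ 2) ≤ C * δ⁻¹ ^ k * S := by
    have := hest δ a U χ c S hS T hT
    simpa only [List.map_map, Function.comp_def, pdList_append] using this
  calc pdList L (U T) p ^ 2 = |pdList L (U T) p| ^ 2 := (sq_abs _).symm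
    _ ≤ (M * ballInt (3 / 4) y) ^ 2 := by gcongr
    _ = M ^ 2 * ballInt (3 / 4) y ^ 2 := by ring
    _ ≤ M ^ 2 * (V * (C * δ⁻¹ ^ k * S)) := by
      refine mul_le_mul_of_nonneg_left ((sq_ballInt_le hyc _).trans ?_) (sq_nonneg _)
      exact mul_le_mul_of_nonneg_left h2 measureReal_nonneg
    _ = _ := by ring

/-- A pointwise quantity attached to solutions that is bounded by `C δ⁻ᵏ √S` on the inner cylinder,
uniformly over all setups. -/
def Bounded (Q : (ℝ → Matrix (Fin d) (Fin d) ℝ) → (ℝ → Phase d → ℝ) → ℝ → Phase d → ℝ) : Prop :=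
  ∃ C : ℝ, 0 ≤ C ∧ ∃ k : ℕ, ∀ δ a U χ c S, Setup δ a U χ c S → ∀ T ∈ Ico (-1 / 4 : ℝ) 0,
    ∀ p ∈ Metric.closedBall (0 : Phase d) (1 / 2), |Q a U T p| ≤ C * δ⁻¹ ^ k * √S

lemma Bounded.congr
    {Q Q' : (ℝ → Matrix (Fin d) (Fin d) ℝ) → (ℝ → Phase d → ℝ) → ℝ → Phase d → ℝ}
    (hQ : Bounded Q) (h : ∀ δ a U χ c S, Setup δ a U χ c S → ∀ T ∈ Ico (-1 / 4 : ℝ) 0,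
      ∀ p ∈ Metric.closedBall (0 : Phase d) (1 / 2), Q' a U T p = Q a U T p) : Bounded Q' := by
  obtain ⟨C, hC, k, hQ⟩ := hQ
  exact ⟨C, hC, k, fun δ a U χ c S hS T hT p hp => by
    rw [h δ a U χ c S hS T hT p hp]; exact hQ δ a U χ c S hS T hT p hp⟩

lemma Bounded.zero : Bounded (d := d) fun _ _ _ _ => 0 :=
  ⟨0, le_rfl, 0, fun δ a U χ c S _ T _ p _ => by simp⟩

lemma Bounded.add
    {Q Q' : (ℝ → Matrix (Fin d) (Fin d) ℝ) → (ℝ → Phase d → ℝ) → ℝ → Phase d → ℝ}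
    (hQ : Bounded Q) (hQ' : Bounded Q') : Bounded fun a U T p => Q a U T p + Q' a U T p := by
  obtain ⟨C, hC, k, h⟩ := hQ
  obtain ⟨C', hC', k', h'⟩ := hQ'
  refine ⟨C + C', add_nonneg hC hC', k + k', fun δ a U χ c S hS T hT p hp => ?_⟩
  have hδ := hS.one_le_inv
  rw [add_mul, add_mul]
  refine (abs_add_le _ _).trans (add_le_add ((h δ a U χ c S hS T hT p hp).trans ?_)
    ((h' δ a U χ c S hS T hT p hp).trans ?_))
  · gcongr
    exact Nat.le_add_right _ _
  · gcongr
    exact Nat.le_add_left _ _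

lemma Bounded.sum {ι : Type*} (s : Finset ι)
    {Q : ι → (ℝ → Matrix (Fin d) (Fin d) ℝ) → (ℝ → Phase d → ℝ) → ℝ → Phase d → ℝ}
    (hQ : ∀ i ∈ s, Bounded (Q i)) : Bounded fun a U T p => ∑ i ∈ s, Q i a U T p := by
  classical
  induction s using Finset.induction_on with
  | empty => simpa using Bounded.zero
  | insert i s hi ih =>
    simp only [Finset.sum_insert hi]
    exact (hQ i (by simp)).add (ih fun j hj => hQ j (by simp [hj]))

lemma Bounded.listSum (S : List (List (Dir d)))
    (hS : ∀ L ∈ S, Bounded fun _ U T p => pdList L (U T) p) :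
    Bounded fun _ U T p => (S.map fun L => pdList L (U T) p).sum := by
  induction S with
  | nil => simpa using Bounded.zero
  | cons L S ih =>
    simp only [List.map_cons, List.sum_cons]
    exact (hS L (by simp)).add (ih fun L' hL' => hS L' (by simp [hL']))

lemma Bounded.velocity_mul
    {Q : (ℝ → Matrix (Fin d) (Fin d) ℝ) → (ℝ → Phase d → ℝ) → ℝ → Phase d → ℝ}
    (hQ : Bounded Q) (i : Fin d) : Bounded fun a U T p => p.2 i * Q a U T p := by
  obtain ⟨C, hC, k, h⟩ := hQ
  refine ⟨C, hC, k, fun δ a U χ c S hS T hT p hp => ?_⟩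
  have h1 : |p.2 i| ≤ 1 := by
    have h2 : ‖p.2‖ ≤ 1 / 2 := (norm_snd_le p).trans (mem_closedBall_zero_iff.1 hp)
    have h3 : |p.2 i| ≤ ‖p.2‖ := PiLp.norm_apply_le p.2 i
    linarith
  rw [abs_mul]
  exact (mul_le_of_le_one_left (abs_nonneg _) h1).trans (h δ a U χ c S hS T hT p hp)

lemma Bounded.coeff_mul
    {Q : (ℝ → Matrix (Fin d) (Fin d) ℝ) → (ℝ → Phase d → ℝ) → ℝ → Phase d → ℝ}
    (hQ : Bounded Q) (i j : Fin d) : Bounded fun a U T p => a T i j * Q a U T p := by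
  obtain ⟨C, hC, k, h⟩ := hQ
  refine ⟨C, hC, k + 1, fun δ a U χ c S hS T hT p hp => ?_⟩
  have hδ := hS.one_le_inv
  rw [abs_mul]
  calc |a T i j| * |Q a U T p| ≤ δ⁻¹ * (C * δ⁻¹ ^ k * √S) :=
        mul_le_mul ((hS.ell T).2 i j) (h δ a U χ c S hS T hT p hp) (abs_nonneg _) (by linarith)
    _ = _ := by ring

lemma Relevant.bounded {L : List (Dir d)} (h : Relevant L) :
    Bounded fun _ U T p => pdList L (U T) p := by
  obtain ⟨C, hC, k, hest⟩ := h.pointwise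
  refine ⟨√C, Real.sqrt_nonneg _, k, fun δ a U χ c S hS T hT p hp => ?_⟩
  have hδ := hS.one_le_inv
  refine abs_le_of_sq_le_sq ((hest δ a U χ c S hS T hT p hp).trans ?_) (by positivity)
  rw [mul_pow, mul_pow, Real.sq_sqrt hC, Real.sq_sqrt hS.nonneg, ← pow_mul]
  have hS0 := hS.nonneg
  gcongr
  omega

lemma bounded_dt_pdList {L : List (Dir d)} (h : 2 ≤ L.length) :
    Bounded fun _ U T p => dt (fun t => pdList L (U t)) T p := by
  have h1 : Bounded fun _ U T p => transport (pdList L (U T)) p :=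
    Bounded.sum _ fun i _ => Bounded.velocity_mul
      (Relevant.bounded (L := Sum.inl i :: L) (Or.inl ⟨i, by simp⟩)) i
  have h2 : Bounded fun a U T p => diffusion (a T) (pdList L (U T)) p :=
    Bounded.sum _ fun i _ => Bounded.sum _ fun j _ => Bounded.coeff_mul
      (Relevant.bounded (L := Sum.inr i :: Sum.inr j :: L) (Or.inr (by simp; omega))) i j
  have h3 : Bounded fun _ U T p => commSource L (U T) p :=
    Bounded.listSum _ fun L' hL' => Relevant.bounded (Or.inl (commLists_spec hL').1)
  refine ((h1.add h2).add h3).congr fun δ a U χ c S hS T hT p hp => ?_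
  refine hS.solves_pdList (by rintro rfl; simp at h) T ⟨by linarith [hT.1], hT.2⟩ p ?_
  exact ((norm_snd_le p).trans (mem_closedBall_zero_iff.1 hp)).trans_lt (by norm_num)

/-- The standard basis vectors of Euclidean space. -/
noncomputable abbrev unitVec (i : Fin d) : Ed d := EuclideanSpace.single i 1

lemma fderiv_apply_clm {E F G : Type*} [NormedAddCommGroup E] [NormedSpace ℝ E]
    [NormedAddCommGroup F] [NormedSpace ℝ F] [NormedAddCommGroup G] [NormedSpace ℝ G]
    {H : E → F} {w : E} (hH : DifferentiableAt ℝ H w) (Φ : F →L[ℝ] G) (v : E) :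
    Φ (fderiv ℝ H w v) = fderiv ℝ (fun w => Φ (H w)) w v := by
  have h : HasFDerivAt (fun w => Φ (H w)) (Φ.comp (fderiv ℝ H w)) w :=
    Φ.hasFDerivAt.comp w hH.hasFDerivAt
  rw [h.fderiv]
  rfl

/-- Components of an iterated derivative along an affine slice of phase space. -/
lemma iteratedFDeriv_component {F : Type*} [NormedAddCommGroup F] [NormedSpace ℝ F]
    {H : Ed d → F} (hH : ContDiff ℝ (⊤ : ℕ∞) H) (Φ : F →L[ℝ] ℝ) {g : Phase d → ℝ}
    (hg : Smooth g) {σ : Ed d → Phase d} {ι : Ed d →L[ℝ] Phase d}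
    (hσ : ∀ w, HasFDerivAt σ ι w) {s : Fin d → Dir d} (hs : ∀ i, ι (unitVec i) = basisVec (s i))
    (hHg : ∀ w, Φ (H w) = g (σ w)) {m : ℕ} (I : Fin m → Fin d) (w : Ed d) :
    Φ (iteratedFDeriv ℝ m H w fun k => unitVec (I k)) =
      pdList (List.ofFn fun k => s (I k)) g (σ w) := by
  induction m generalizing w with
  | zero => simpa [pdList] using hHg w
  | succ m ih =>
    have hd : DifferentiableAt ℝ (iteratedFDeriv ℝ m H) w :=
      (hH.iteratedFDeriv_right (i := m) (m := 1) (by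
        exact_mod_cast le_top)).differentiable (by simp) w
    rw [iteratedFDeriv_succ_apply_left]
    have h1 := fderiv_apply_clm hd
      (Φ.comp (ContinuousMultilinearMap.apply ℝ (fun _ : Fin m => Ed d) F
        fun k => unitVec (I k.succ))) (unitVec (I 0))
    change _ = fderiv ℝ (fun w => Φ (iteratedFDeriv ℝ m H w fun k => unitVec (I k.succ))) w
      (unitVec (I 0)) at h1
    simp only [ih fun k => I k.succ] at h1
    refine h1.trans ?_
    have h2 : HasFDerivAt (fun w => pdList (List.ofFn fun k : Fin m => s (I k.succ)) g (σ w))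
        ((fderiv ℝ (pdList (List.ofFn fun k : Fin m => s (I k.succ)) g) (σ w)).comp ι) w :=
      ((hg.pdList _).differentiable _).hasFDerivAt.comp w (hσ w)
    rw [h2.fderiv, List.ofFn_succ]
    simp [pdList, pd, hs]

lemma hasFDerivAt_space_slice (v x : Ed d) :
    HasFDerivAt (fun y : Ed d => ((y, v) : Phase d)) (ContinuousLinearMap.inl ℝ (Ed d) (Ed d)) x :=
  (hasFDerivAt_id x).prodMk (hasFDerivAt_const v x)

lemma hasFDerivAt_velocity_slice (x v : Ed d) :
    HasFDerivAt (fun w : Ed d => ((x, w) : Phase d)) (ContinuousLinearMap.inr ℝ (Ed d) (Ed d)) v :=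
  (hasFDerivAt_const x v).prodMk (hasFDerivAt_id v)

lemma contDiff_iteratedFDeriv_slice {f : Phase d → ℝ} (hf : Smooth f) (l : ℕ) (x : Ed d) :
    ContDiff ℝ (⊤ : ℕ∞) fun w : Ed d => iteratedFDeriv ℝ l (fun y => f (y, w)) x := by
  have h : (fun w : Ed d => iteratedFDeriv ℝ l (fun y => f (y, w)) x) = fun w =>
      ContinuousMultilinearMap.compContinuousLinearMapL
        (fun _ : Fin l => ContinuousLinearMap.inl ℝ (Ed d) (Ed d))
        (iteratedFDeriv ℝ l f (x, w)) := by
    funext w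
    have h1 : (fun y => f (y, w)) =
        (fun q : Phase d => f (q + (0, w))) ∘ ContinuousLinearMap.inl ℝ (Ed d) (Ed d) := by
      funext y; simp
    have h2 : Smooth fun q : Phase d => f (q + (0, w)) :=
      hf.comp (contDiff_id.add contDiff_const)
    rw [h1, ContinuousLinearMap.iteratedFDeriv_comp_right _ h2 x (i := l)
      (by exact_mod_cast le_top), iteratedFDeriv_comp_add_right]
    simp
  rw [h]
  exact (ContinuousLinearMap.contDiff _).comp
    ((hf.iteratedFDeriv_right (i := l) (m := (⊤ : ℕ∞)) (by
      exact_mod_cast le_top)).comp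
      (contDiff_const.prodMk contDiff_id))

/-- The list of directions of a mixed derivative component. -/
def mixList {l m : ℕ} (I : Fin m → Fin d) (J : Fin l → Fin d) : List (Dir d) :=
  (List.ofFn fun k => Sum.inr (I k)) ++ List.ofFn fun k => Sum.inl (J k)

/-- Time slices of a function on space-time. -/
def slice (u : Pt d → ℝ) (t : ℝ) (p : Phase d) : ℝ := u (t, p.1, p.2)

/-- Evaluation of mixed derivatives on basis vectors. -/
noncomputable def component {l m : ℕ} (I : Fin m → Fin d) (J : Fin l → Fin d) :
    ContinuousMultilinearMap ℝ (fun _ : Fin m => Ed d)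
      (ContinuousMultilinearMap ℝ (fun _ : Fin l => Ed d) ℝ) →L[ℝ] ℝ :=
  (ContinuousMultilinearMap.apply ℝ (fun _ : Fin l => Ed d) ℝ fun k => unitVec (J k)).comp
    (ContinuousMultilinearMap.apply ℝ (fun _ : Fin m => Ed d) _ fun k => unitVec (I k))

lemma component_Dmix {u : Pt d → ℝ} {t : ℝ} (hu : Smooth (slice u t)) {l m : ℕ}
    (I : Fin m → Fin d) (J : Fin l → Fin d) (p : Phase d) :
    component I J (Dmix l m u (t, p)) = pdList (mixList I J) (slice u t) p := by
  rw [mixList, pdList_append]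
  refine iteratedFDeriv_component (contDiff_iteratedFDeriv_slice hu l p.1)
    (ContinuousMultilinearMap.apply ℝ (fun _ : Fin l => Ed d) ℝ fun k => unitVec (J k))
    (hu.pdList _) (hasFDerivAt_velocity_slice p.1) (fun i => by simp [basisVec])
    (fun w => ?_) I p.2
  have hH : ContDiff ℝ (⊤ : ℕ∞) fun y : Ed d => slice u t (y, w) :=
    hu.comp (contDiff_id.prodMk contDiff_const)
  exact iteratedFDeriv_component hH (ContinuousLinearMap.id ℝ ℝ) hu
    (hasFDerivAt_space_slice w) (fun i => by simp [basisVec]) (fun y => rfl) J p.1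

lemma norm_le_sum_basis {G : Type*} [NormedAddCommGroup G] [NormedSpace ℝ G] {m : ℕ}
    (T : ContinuousMultilinearMap ℝ (fun _ : Fin m => Ed d) G) :
    ‖T‖ ≤ ∑ I : Fin m → Fin d, ‖T fun k => unitVec (I k)‖ := by
  refine T.opNorm_le_bound (Finset.sum_nonneg fun _ _ => norm_nonneg _) fun w => ?_
  have hw : w = fun k => ∑ i, w k i • unitVec i := by
    funext k
    exact ((EuclideanSpace.basisFun (Fin d) ℝ).sum_repr (w k)).symm.trans (by simp)
  conv_lhs => rw [hw, T.map_sum]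
  rw [Finset.sum_mul]
  refine (norm_sum_le _ _).trans (Finset.sum_le_sum fun I _ => ?_)
  rw [T.map_smul_univ (fun k => w k (I k)) fun k => unitVec (I k), norm_smul, mul_comm, norm_prod]
  refine mul_le_mul_of_nonneg_left ?_ (norm_nonneg _)
  exact Finset.prod_le_prod (fun _ _ => norm_nonneg _) fun k _ => PiLp.norm_apply_le (w k) (I k)

lemma norm_le_sum_component {l m : ℕ} (T : ContinuousMultilinearMap ℝ (fun _ : Fin m => Ed d)
      (ContinuousMultilinearMap ℝ (fun _ : Fin l => Ed d) ℝ)) :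
    ‖T‖ ≤ ∑ I : Fin m → Fin d, ∑ J : Fin l → Fin d, |component I J T| :=
  (norm_le_sum_basis T).trans (Finset.sum_le_sum fun _ _ => norm_le_sum_basis _)

lemma exists_mixList_perm (L : List (Dir d)) :
    ∃ (l m : ℕ) (I : Fin m → Fin d) (J : Fin l → Fin d), L.Perm (mixList I J) := by
  suffices h : ∃ A B : List (Fin d), L.Perm (A.map Sum.inr ++ B.map Sum.inl) by
    obtain ⟨A, B, h⟩ := h
    refine ⟨B.length, A.length, A.get, B.get, ?_⟩
    have hA : (List.ofFn fun k => (Sum.inr (A.get k) : Dir d)) = A.map Sum.inr := by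
      rw [← Function.comp_def, ← List.map_ofFn, List.ofFn_get]
    have hB : (List.ofFn fun k => (Sum.inl (B.get k) : Dir d)) = B.map Sum.inl := by
      rw [← Function.comp_def, ← List.map_ofFn, List.ofFn_get]
    rwa [mixList, hA, hB]
  induction L with
  | nil => exact ⟨[], [], by simp⟩
  | cons e L ih =>
    obtain ⟨A, B, h⟩ := ih
    rcases e with i | i
    · exact ⟨A, i :: B, (h.cons _).trans List.perm_middle.symm⟩
    · exact ⟨i :: A, B, h.cons _⟩

/-- Functions on space-time with classical, continuous and once time differentiable mixed
derivatives of all orders. -/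
structure Classical (u : Pt d → ℝ) : Prop where
  smooth : ∀ t ∈ Ioo (-4 : ℝ) 0, ContDiff ℝ (⊤ : ℕ∞) (fun p : Ed d × Ed d => u (t, p.1, p.2))
  diff : ∀ l m : ℕ, ∀ z ∈ Ioo (-4 : ℝ) 0 ×ˢ (univ : Set (Ed d × Ed d)),
    DifferentiableAt ℝ (fun s => Dmix l m u (s, z.2.1, z.2.2)) z.1
  cont : ∀ l m : ℕ,
    ContinuousOn (fun z => Dmix l m u z) (Ioo (-4 : ℝ) 0 ×ˢ (univ : Set (Ed d × Ed d))) ∧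
    ContinuousOn (fun z => DtMix l m u z) (Ioo (-4 : ℝ) 0 ×ˢ (univ : Set (Ed d × Ed d)))

lemma time_subset : timeI ⊆ Ioo (-4 : ℝ) 0 := Ioo_subset_Ioo_left (by norm_num)

variable {u : Pt d → ℝ}

lemma Classical.component_eq (hu : Classical u) {t : ℝ} (ht : t ∈ Ioo (-4 : ℝ) 0) {l m : ℕ}
    (I : Fin m → Fin d) (J : Fin l → Fin d) (p : Phase d) :
    component I J (Dmix l m u (t, p)) = pdList (mixList I J) (slice u t) p :=
  component_Dmix (hu.smooth t ht) I J p

lemma hasDerivAt_clm_apply {F : Type*} [NormedAddCommGroup F] [NormedSpace ℝ F] (Φ : F →L[ℝ] ℝ)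
    {H : ℝ → F} {t : ℝ} (hH : DifferentiableAt ℝ H t) :
    HasDerivAt (fun s => Φ (H s)) (Φ (deriv H t)) t :=
  Φ.hasFDerivAt.comp_hasDerivAt t hH.hasDerivAt

lemma Classical.hasDerivAt_component (hu : Classical u) {t : ℝ} (ht : t ∈ Ioo (-4 : ℝ) 0)
    {l m : ℕ} (I : Fin m → Fin d) (J : Fin l → Fin d) (p : Phase d) :
    HasDerivAt (fun s => pdList (mixList I J) (slice u s) p)
      (component I J (DtMix l m u (t, p))) t := by
  have h2 := hasDerivAt_clm_apply (component I J) (H := fun s => Dmix l m u (s, p))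
    (hu.diff l m (t, p) ⟨ht, mem_univ _⟩)
  change HasDerivAt _ (component I J (DtMix l m u (t, p))) t at h2
  refine h2.congr_of_eventuallyEq ?_
  filter_upwards [isOpen_Ioo.mem_nhds ht] with s hs
  exact (hu.component_eq hs I J p).symm

lemma Classical.component_dt (hu : Classical u) {t : ℝ} (ht : t ∈ Ioo (-4 : ℝ) 0) {l m : ℕ}
    (I : Fin m → Fin d) (J : Fin l → Fin d) (p : Phase d) :
    component I J (DtMix l m u (t, p)) = dt (fun s => pdList (mixList I J) (slice u s)) t p :=
  (hu.hasDerivAt_component ht I J p).deriv.symm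

lemma Classical.regular (hu : Classical u) : Regular (slice u) := by
  have hsub : timeI ×ˢ (univ : Set (Phase d)) ⊆ Ioo (-4 : ℝ) 0 ×ˢ (univ : Set (Ed d × Ed d)) :=
    prod_mono_left time_subset
  have hperm (L : List (Dir d)) : ∃ (l m : ℕ) (I : Fin m → Fin d) (J : Fin l → Fin d),
      ∀ t ∈ Ioo (-4 : ℝ) 0, ∀ p,
        pdList L (slice u t) p = pdList (mixList I J) (slice u t) p := by
    obtain ⟨l, m, I, J, h⟩ := exists_mixList_perm L
    exact ⟨l, m, I, J, fun t ht p => congrFun (pdList_perm h (hu.smooth t ht)) p⟩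
  have hnhds (L : List (Dir d)) {l m : ℕ} {I : Fin m → Fin d} {J : Fin l → Fin d}
      (h : ∀ t ∈ Ioo (-4 : ℝ) 0, ∀ p,
        pdList L (slice u t) p = pdList (mixList I J) (slice u t) p)
      {t : ℝ} (ht : t ∈ timeI) (p : Phase d) :
      HasDerivAt (fun s => pdList L (slice u s) p) (component I J (DtMix l m u (t, p))) t := by
    refine (hu.hasDerivAt_component (time_subset ht) I J p).congr_of_eventuallyEq ?_
    filter_upwards [isOpen_Ioo.mem_nhds (time_subset ht)] with s hs
    exact h s hs p
  refine ⟨fun t ht => hu.smooth t (time_subset ht), fun L => ?_, fun L t ht p => ?_, fun L => ?_⟩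
  · obtain ⟨l, m, I, J, h⟩ := hperm L
    refine ((component I J).continuous.comp_continuousOn
      ((hu.cont l m).1.mono hsub)).congr fun z hz => ?_
    exact (h z.1 (time_subset hz.1) z.2).trans
      (hu.component_eq (time_subset hz.1) I J z.2).symm
  · obtain ⟨l, m, I, J, h⟩ := hperm L
    exact (hnhds L h ht p).differentiableAt
  · obtain ⟨l, m, I, J, h⟩ := hperm L
    refine ((component I J).continuous.comp_continuousOn
      ((hu.cont l m).2.mono hsub)).congr fun z hz => ?_
    exact (hnhds L h hz.1 z.2).deriv

lemma Dx_unitVec {t : ℝ} (hu : Smooth (slice u t)) (p : Phase d) (i : Fin d) :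
    Dx u (t, p) (unitVec i) = pd (Sum.inl i) (slice u t) p := by
  have h := (hu.differentiable p).hasFDerivAt.comp p.1
    (hasFDerivAt_space_slice p.2 p.1)
  have h' : Dx u (t, p) = _ := h.fderiv
  rw [h']
  simp [pd, basisVec]

lemma Dv_unitVec {t : ℝ} (hu : Smooth (slice u t)) (p : Phase d) (i : Fin d) :
    Dv u (t, p) (unitVec i) = pd (Sum.inr i) (slice u t) p := by
  have h := (hu.differentiable p).hasFDerivAt.comp p.2
    (hasFDerivAt_velocity_slice p.1 p.2)
  have h' : Dv u (t, p) = _ := h.fderiv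
  rw [h']
  simp [pd, basisVec]

lemma Dvv_unitVec {t : ℝ} (hu : Smooth (slice u t)) (p : Phase d) (i j : Fin d) :
    Dvv u (t, p) (unitVec i) (unitVec j) =
      pd (Sum.inr i) (pd (Sum.inr j) (slice u t)) p := by
  have hd : DifferentiableAt ℝ (fun w => Dv u (t, p.1, w)) p.2 := by
    have h1 : ContDiff ℝ (⊤ : ℕ∞) fun w : Ed d => slice u t (p.1, w) :=
      hu.comp (contDiff_const.prodMk contDiff_id)
    exact (h1.fderiv_right (m := (⊤ : ℕ∞)) (by simp)).differentiable (by simp) p.2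
  have h1 := fderiv_apply_clm hd (ContinuousLinearMap.apply ℝ ℝ (unitVec j)) (unitVec i)
  refine h1.trans ?_
  have h2 : (fun w => ContinuousLinearMap.apply ℝ ℝ (unitVec j) (Dv u (t, p.1, w))) =
      fun w => pd (Sum.inr j) (slice u t) (p.1, w) :=
    funext fun w => Dv_unitVec hu (p.1, w) j
  rw [h2]
  have h3 := ((hu.pd (Sum.inr j)).differentiable p).hasFDerivAt.comp p.2
    (hasFDerivAt_velocity_slice p.1 p.2)
  have h4 : fderiv ℝ (fun w => pd (Sum.inr j) (slice u t) (p.1, w)) p.2 = _ := h3.fderiv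
  rw [h4]
  simp [pd, basisVec]

lemma eq_sum_unitVec (v : Ed d) : v = ∑ i, v i • unitVec i :=
  ((EuclideanSpace.basisFun (Fin d) ℝ).sum_repr v).symm.trans (by simp)

lemma Classical.solves (hu : Classical u) {a : ℝ → Matrix (Fin d) (Fin d) ℝ} {χ : ℝ → ℝ}
    (h : ∀ z : Pt d, z.1 ∈ Ioo (-1 : ℝ) 0 → ‖z.2.2‖ < 1 → P0op a u z = χ z.1) :
    Solves a (slice u) fun t _ => χ t := by
  intro t ht p hp
  have hs : Smooth (slice u t) := hu.smooth t (time_subset ht)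
  have h1 := h (t, p) ht hp
  have h2 : Dx u (t, p) p.2 = transport (slice u t) p := by
    conv_lhs => rw [eq_sum_unitVec p.2]
    simp only [map_sum, map_smul, smul_eq_mul, Dx_unitVec hs]
    rfl
  have h3 : contr2 (a t) (Dvv u (t, p)) = diffusion (a t) (slice u t) p := by
    unfold contr2 diffusion
    simp only [Dvv_unitVec hs]
  have h4 : Dt u (t, p) - Dx u (t, p) p.2 - contr2 (a t) (Dvv u (t, p)) = χ t := h1
  have h5 : Dt u (t, p) = dt (slice u) t p := rfl
  rw [h2, h3, h5] at h4
  linarith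

lemma kQ_one_eq : kQ 1 (ptO d) =
    Ioo (-1 : ℝ) 0 ×ˢ (Metric.ball (0 : Ed d) 1 ×ˢ Metric.ball (0 : Ed d) 1) := by
  ext z
  simp [kQ, kCyl, ptO]
  tauto

lemma measurableSet_kQ_one : MeasurableSet (kQ 1 (ptO d)) := by
  rw [kQ_one_eq]
  exact measurableSet_Ioo.prod (measurableSet_ball.prod measurableSet_ball)

lemma volume_kQ_one_lt_top : volume (kQ 1 (ptO d)) < ∞ := by
  rw [kQ_one_eq]
  exact ((Metric.isBounded_Ioo _ _).prod (Metric.isBounded_ball.prod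
    Metric.isBounded_ball)).measure_lt_top

lemma cylInt_le_setIntegral {F : ℝ → Phase d → ℝ} (hF : JointCont F) {g : Pt d → ℝ}
    (hg : IntegrableOn g (kQ 1 (ptO d))) (hg0 : ∀ z, 0 ≤ g z)
    (h : ∀ z ∈ kQ 1 (ptO d), F z.1 z.2 ≤ g z) {ρ : ℝ} (hρ : ρ ∈ Ico (1 / 2 : ℝ) 1) {T : ℝ}
    (hT : T ∈ Ico (-1 / 4 : ℝ) 0) : cylInt ρ T F ≤ ∫ z in kQ 1 (ptO d), g z := by
  have hρT : -ρ ≤ T := by linarith [hρ.1, hT.1]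
  have hsub : Ioc (-ρ) T ×ˢ Metric.closedBall (0 : Phase d) ρ ⊆ kQ 1 (ptO d) := by
    rintro z ⟨hz1, hz2⟩
    have hz3 := mem_closedBall_zero_iff.1 hz2
    rw [kQ_one_eq]
    refine ⟨⟨by linarith [hz1.1, hρ.2], hz1.2.trans_lt hT.2⟩, ?_, ?_⟩
    · exact mem_ball_zero_iff.2 (((norm_fst_le z.2).trans hz3).trans_lt hρ.2)
    · exact mem_ball_zero_iff.2 (((norm_snd_le z.2).trans hz3).trans_lt hρ.2)
  have hInt : IntegrableOn (fun z : ℝ × Phase d => F z.1 z.2)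
      (Ioc (-ρ) T ×ˢ Metric.closedBall (0 : Phase d) ρ) := by
    have h1 : ContinuousOn (fun z : ℝ × Phase d => F z.1 z.2)
        (Icc (-ρ) T ×ˢ Metric.closedBall (0 : Phase d) ρ) :=
      ContinuousOn.mono hF (prod_mono (Icc_subset_Ioo (by linarith [hρ.2]) hT.2) (subset_univ _))
    exact (h1.integrableOn_compact (isCompact_Icc.prod (isCompact_closedBall _ _))).mono_set
      (prod_mono_left Ioc_subset_Icc_self)
  have hcyl : cylInt ρ T F =
      ∫ z in Ioc (-ρ) T ×ˢ Metric.closedBall (0 : Phase d) ρ, F z.1 z.2 := by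
    rw [cylInt, intervalIntegral.integral_of_le hρT]
    exact (setIntegral_prod _ hInt).symm
  rw [hcyl]
  refine (setIntegral_mono_on hInt (hg.mono_set hsub)
    (measurableSet_Ioc.prod measurableSet_closedBall) fun z hz => h z (hsub hz)).trans ?_
  exact setIntegral_mono_set hg (Filter.Eventually.of_forall hg0) hsub.eventuallyLE

lemma kQ_one_subset : kQ 1 (ptO d) ⊆
    Ioo (-4 : ℝ) 0 ×ˢ (Metric.ball (0 : Ed d) 1 ×ˢ Metric.ball (0 : Ed d) 1) := by
  rw [kQ_one_eq]
  exact prod_mono_left time_subset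

lemma abs_component_le {l m : ℕ} (I : Fin m → Fin d) (J : Fin l → Fin d)
    (T : ContinuousMultilinearMap ℝ (fun _ : Fin m => Ed d)
      (ContinuousMultilinearMap ℝ (fun _ : Fin l => Ed d) ℝ)) : |component I J T| ≤ ‖T‖ := by
  refine ((T fun k => unitVec (I k)).le_opNorm fun k => unitVec (J k)).trans ?_
  refine (le_of_eq (by simp)).trans ((T.le_opNorm fun k => unitVec (I k)).trans (le_of_eq ?_))
  simp

lemma Classical.memLp_pdList (hu : Classical u)
    (hInt : ∀ l m : ℕ, IntegrableOn (fun z => ‖Dmix l m u z‖ ^ 2) (Ioo (-4 : ℝ) 0 ×ˢ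
      (Metric.ball (0 : Ed d) 1 ×ˢ Metric.ball (0 : Ed d) 1))) (L : List (Dir d)) :
    MemLp (fun z : Pt d => pdList L (slice u z.1) z.2) 2 (volume.restrict (kQ 1 (ptO d))) := by
  obtain ⟨l, m, I, J, h⟩ := exists_mixList_perm L
  have hreg : ∀ z ∈ kQ 1 (ptO d), z.1 ∈ Ioo (-4 : ℝ) 0 := fun z hz => (kQ_one_subset hz).1
  have hcomp : ∀ z ∈ kQ 1 (ptO d),
      pdList L (slice u z.1) z.2 = component I J (Dmix l m u z) := fun z hz =>
    (congrFun (pdList_perm h (hu.smooth z.1 (hreg z hz))) z.2).trans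
      (hu.component_eq (hreg z hz) I J z.2).symm
  have hcont : ContinuousOn (fun z : Pt d => pdList L (slice u z.1) z.2) (kQ 1 (ptO d)) :=
    (hu.regular.cont L).mono fun z hz => by
      rw [kQ_one_eq] at hz; exact ⟨hz.1, mem_univ _⟩
  have hmeas := hcont.aestronglyMeasurable (μ := volume) measurableSet_kQ_one
  rw [memLp_two_iff_integrable_sq hmeas]
  refine Integrable.mono' (((hInt l m).mono_set kQ_one_subset).const_mul 1) (hmeas.pow 2) ?_
  refine (ae_restrict_iff' measurableSet_kQ_one).2 (Filter.Eventually.of_forall fun z hz => ?_)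
  rw [hcomp z hz, norm_pow, one_mul]
  gcongr
  exact abs_component_le I J _

lemma memLp_sum_smul {ι G : Type*} [Fintype ι] [NormedAddCommGroup G] [NormedSpace ℝ G]
    {μ : Measure (Pt d)} {f : ι → Pt d → ℝ} (hf : ∀ i, MemLp (f i) 2 μ) (B : ι → G) :
    MemLp (fun z => ∑ i, f i z • B i) 2 μ :=
  memLp_finsetSum _ fun i _ => (ContinuousLinearMap.toSpanSingleton ℝ (B i)).comp_memLp' (hf i)

/-- The coordinate functionals on Euclidean space. -/
noncomputable abbrev coord (i : Fin d) : Ed d →L[ℝ] ℝ := EuclideanSpace.proj i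

lemma functional_eq_sum {G : Type*} [NormedAddCommGroup G] [NormedSpace ℝ G] (B : Ed d →L[ℝ] G) :
    B = ∑ i, (coord i).smulRight (B (unitVec i)) := by
  ext v
  conv_lhs => rw [eq_sum_unitVec v]
  simp

lemma Classical.memLp_Dx (hu : Classical u)
    (hInt : ∀ l m : ℕ, IntegrableOn (fun z => ‖Dmix l m u z‖ ^ 2) (Ioo (-4 : ℝ) 0 ×ˢ
      (Metric.ball (0 : Ed d) 1 ×ˢ Metric.ball (0 : Ed d) 1))) :
    MemLp (fun z => Dx u z) 2 (volume.restrict (kQ 1 (ptO d))) := by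
  have h := memLp_sum_smul (fun i : Fin d => hu.memLp_pdList hInt [Sum.inl i]) coord
  refine h.ae_eq ((ae_restrict_iff' measurableSet_kQ_one).2
    (Filter.Eventually.of_forall fun z hz => ?_))
  have hs := hu.smooth z.1 (kQ_one_subset hz).1
  refine Eq.trans ?_ (functional_eq_sum (Dx u z)).symm
  refine Finset.sum_congr rfl fun i _ => ?_
  ext v
  have := Dx_unitVec hs z.2 i
  change Dx u z (unitVec i) = _ at this
  rw [ContinuousLinearMap.smulRight_apply, this]
  simp [pdList, mul_comm]

lemma Classical.memLp_Dvv (hu : Classical u)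
    (hInt : ∀ l m : ℕ, IntegrableOn (fun z => ‖Dmix l m u z‖ ^ 2) (Ioo (-4 : ℝ) 0 ×ˢ
      (Metric.ball (0 : Ed d) 1 ×ˢ Metric.ball (0 : Ed d) 1))) :
    MemLp (fun z => Dvv u z) 2 (volume.restrict (kQ 1 (ptO d))) := by
  have h := memLp_sum_smul
    (fun i : Fin d × Fin d => hu.memLp_pdList hInt [Sum.inr i.1, Sum.inr i.2])
    fun i => (coord i.1).smulRight (coord i.2)
  simp only [Fintype.sum_prod_type] at h
  refine h.ae_eq ((ae_restrict_iff' measurableSet_kQ_one).2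
    (Filter.Eventually.of_forall fun z hz => ?_))
  have hs := hu.smooth z.1 (kQ_one_subset hz).1
  refine Eq.trans ?_ (functional_eq_sum (Dvv u z)).symm
  refine Finset.sum_congr rfl fun i _ => ?_
  rw [functional_eq_sum (Dvv u z (unitVec i))]
  ext v w
  simp only [sum_apply, ContinuousLinearMap.smulRight_apply,
    smul_apply, Finset.smul_sum, smul_eq_mul]
  refine Finset.sum_congr rfl fun j _ => ?_
  have := Dvv_unitVec hs z.2 i j
  change Dvv u z (unitVec i) (unitVec j) = _ at this
  rw [this]
  simp only [pdList]
  ring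

lemma norm_unitVec (i : Fin d) : ‖unitVec i‖ = 1 := by simp

lemma Classical.setup (hu : Classical u)
    (hInt : ∀ l m : ℕ, IntegrableOn (fun z => ‖Dmix l m u z‖ ^ 2) (Ioo (-4 : ℝ) 0 ×ˢ
      (Metric.ball (0 : Ed d) 1 ×ˢ Metric.ball (0 : Ed d) 1)))
    {δ : ℝ} (hδ : δ ∈ Ioo (0 : ℝ) 1) {a : ℝ → Matrix (Fin d) (Fin d) ℝ}
    (ha : ∀ t, elliptic δ (a t)) {χ : ℝ → ℝ}
    (h : ∀ z : Pt d, z.1 ∈ Ioo (-1 : ℝ) 0 → ‖z.2.2‖ < 1 → P0op a u z = χ z.1) :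
    Setup δ a (slice u) χ
      (fun i j => avg (kQ 1 (ptO d)) (fun z => Dvv u z) (unitVec i) (unitVec j))
      ((1 + volume.real (kQ 1 (ptO d))) * (oscL2 (kQ 1 (ptO d)) (fun z => Dvv u z) +
        l2 (kQ 1 (ptO d)) (fun z => Dx u z)) ^ 2) := by
  set A := kQ 1 (ptO d)
  set B := avg A (fun z => Dvv u z)
  set V := volume.real A
  set o := oscL2 A (fun z => Dvv u z)
  set s := l2 A (fun z => Dx u z)
  have hV0 : 0 ≤ V := measureReal_nonneg
  have ho0 : 0 ≤ o := Real.sqrt_nonneg _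
  have hs0 : 0 ≤ s := Real.sqrt_nonneg _
  have hfin : volume A < ∞ := volume_kQ_one_lt_top
  have : IsFiniteMeasure (volume.restrict A) := ⟨by simpa using hfin⟩
  have hreg : ∀ z ∈ A, z.1 ∈ Ioo (-4 : ℝ) 0 := fun z hz => (kQ_one_subset hz).1
  have hDx : IntegrableOn (fun z => ‖Dx u z‖ ^ 2) A := (hu.memLp_Dx hInt).norm.integrable_sq
  have hDvv : IntegrableOn (fun z => ‖Dvv u z - B‖ ^ 2) A :=
    ((hu.memLp_Dvv hInt).sub (memLp_const B)).norm.integrable_sq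
  have hDx_le : ∫ z in A, ‖Dx u z‖ ^ 2 ≤ (1 + V) * (o + s) ^ 2 := by
    have h1 : s ^ 2 = ∫ z in A, ‖Dx u z‖ ^ 2 :=
      Real.sq_sqrt (integral_nonneg fun z => by positivity)
    rw [← h1]
    nlinarith [mul_nonneg hV0 (sq_nonneg (o + s)), mul_nonneg ho0 hs0, sq_nonneg o]
  have hDvv_le : ∫ z in A, ‖Dvv u z - B‖ ^ 2 ≤ (1 + V) * (o + s) ^ 2 := by
    have h1 : o ^ 2 = ⨍ z in A, ‖Dvv u z - B‖ ^ 2 :=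
      Real.sq_sqrt (integral_nonneg fun z => by positivity)
    rw [← measure_smul_setAverage _ hfin.ne, ← h1, smul_eq_mul]
    have h2 : o ^ 2 ≤ (o + s) ^ 2 := by nlinarith [mul_nonneg ho0 hs0, sq_nonneg s]
    nlinarith [mul_le_mul_of_nonneg_left h2 hV0, sq_nonneg (o + s)]
  refine ⟨hδ, ha, hu.regular, hu.solves h, by positivity, fun ρ hρ T hT i => ?_,
    fun ρ hρ T hT i j => ?_⟩
  · refine (cylInt_le_setIntegral (hu.regular.cont [Sum.inl i]).sq hDx
      (fun z => by positivity) (fun z hz => ?_) hρ hT).trans hDx_le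
    have h1 : Dx u z (unitVec i) = pd (Sum.inl i) (slice u z.1) z.2 :=
      Dx_unitVec (hu.smooth z.1 (hreg z hz)) z.2 i
    have h2 := (Dx u z).le_opNorm (unitVec i)
    rw [norm_unitVec, mul_one, h1] at h2
    exact sq_le_sq' (abs_le.1 h2).1 (abs_le.1 h2).2
  · have hc : JointCont fun t p => pdList [Sum.inr i, Sum.inr j] (slice u t) p -
        B (unitVec i) (unitVec j) := (hu.regular.cont _).sub continuousOn_const
    refine (cylInt_le_setIntegral hc.sq hDvv
      (fun z => by positivity) (fun z hz => ?_) hρ hT).trans hDvv_le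
    have h1 : Dvv u z (unitVec i) (unitVec j) =
        pd (Sum.inr i) (pd (Sum.inr j) (slice u z.1)) z.2 :=
      Dvv_unitVec (hu.smooth z.1 (hreg z hz)) z.2 i j
    have h2 := (Dvv u z - B).le_opNorm₂ (unitVec i) (unitVec j)
    have h3 : (Dvv u z - B) (unitVec i) (unitVec j) =
        pd (Sum.inr i) (pd (Sum.inr j) (slice u z.1)) z.2 - B (unitVec i) (unitVec j) := by
      rw [← h1]; rfl
    rw [norm_unitVec, norm_unitVec, mul_one, mul_one, h3] at h2
    exact sq_le_sq' (abs_le.1 h2).1 (abs_le.1 h2).2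

lemma Bounded.abs
    {Q : (ℝ → Matrix (Fin d) (Fin d) ℝ) → (ℝ → Phase d → ℝ) → ℝ → Phase d → ℝ}
    (hQ : Bounded Q) : Bounded fun a U T p => |Q a U T p| := by
  simpa only [Bounded, abs_abs] using hQ

lemma mixList_relevant {l m : ℕ} (h : 1 ≤ l ∨ 3 ≤ m) (I : Fin m → Fin d) (J : Fin l → Fin d) :
    Relevant (mixList I J) := by
  rcases h with h | h
  · refine Or.inl ⟨J ⟨0, h⟩, ?_⟩
    exact List.mem_append_right _ (List.mem_ofFn.2 ⟨⟨0, h⟩, rfl⟩)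
  · refine Or.inr ?_
    simp [mixList]
    omega

/-- A derivative whose components are bounded quantities obeys the interior bound. -/
lemma exists_supNorm_bound {l m : ℕ}
    {W : (Pt d → ℝ) → Pt d → ContinuousMultilinearMap ℝ (fun _ : Fin m => Ed d)
      (ContinuousMultilinearMap ℝ (fun _ : Fin l => Ed d) ℝ)}
    {Q : (Fin m → Fin d) → (Fin l → Fin d) → (ℝ → Matrix (Fin d) (Fin d) ℝ) →
      (ℝ → Phase d → ℝ) → ℝ → Phase d → ℝ} (hQ : ∀ I J, Bounded (Q I J))
    (hW : ∀ u : Pt d → ℝ, Classical u → ∀ t ∈ Ioo (-4 : ℝ) 0, ∀ p a I J,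
      component I J (W u (t, p)) = Q I J a (slice u) t p) :
    ∃ θ : ℝ, 0 < θ ∧ ∃ N : ℝ, 0 < N ∧ ∀ δ a u χ c R, 0 ≤ R → Classical u →
      Setup δ a (slice u) χ c ((1 + volume.real (kQ 1 (ptO d))) * R ^ 2) →
      supNorm (kQ (1 / 2) (ptO d)) (W u) ≤ ENNReal.ofReal (N * δ ^ (-θ) * R) := by
  obtain ⟨C, hC, k, hsum⟩ := Bounded.sum Finset.univ fun I _ =>
    Bounded.sum Finset.univ fun J _ => (hQ I J).abs
  have hV : 0 ≤ volume.real (kQ 1 (ptO d)) := measureReal_nonneg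
  refine ⟨k + 1, by positivity, C * √(1 + volume.real (kQ 1 (ptO d))) + 1, by positivity,
    fun δ a u χ c R hR hu hS => iSup₂_le fun z hz => ?_⟩
  have hz' : -(1 / 4 : ℝ) < z.1 ∧ z.1 < 0 ∧ ‖z.2.2‖ < 1 / 2 ∧ ‖z.2.1‖ < 1 / 8 := by
    have := hz
    simp only [kQ, kCyl, ptO, mem_ofPred_eq, zero_sub, sub_zero, smul_zero, add_zero] at this
    norm_num at this ⊢
    exact this
  obtain ⟨h1, h2, h3, h4⟩ := hz'
  have hp : z.2 ∈ Metric.closedBall (0 : Phase d) (1 / 2) :=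
    mem_closedBall_zero_iff.2 (max_le (by linarith) h3.le)
  have hb := hsum δ a (slice u) χ c _ hS z.1 ⟨by linarith, h2⟩ z.2 hp
  have hδ := hS.one_le_inv
  have hδ0 := hS.mem.1
  have hnorm : ‖W u z‖ ≤ C * δ⁻¹ ^ k * √((1 + volume.real (kQ 1 (ptO d))) * R ^ 2) := by
    refine ((norm_le_sum_component (W u z)).trans (le_of_eq ?_)).trans ((le_abs_self _).trans hb)
    refine Finset.sum_congr rfl fun I _ => Finset.sum_congr rfl fun J _ => congrArg _ ?_
    exact hW u hu z.1 ⟨by linarith, h2⟩ z.2 a I J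
  rw [← enorm_eq_nnnorm, ← ofReal_norm]
  refine ENNReal.ofReal_le_ofReal (hnorm.trans ?_)
  rw [Real.sqrt_mul (by positivity), Real.sqrt_sq hR]
  have hpow : δ⁻¹ ^ k ≤ δ ^ (-((k : ℝ) + 1)) := by
    rw [Real.rpow_neg hδ0.le, ← Real.inv_rpow hδ0.le, ← Nat.cast_succ, Real.rpow_natCast]
    exact pow_le_pow_right₀ hδ (Nat.le_succ k)
  have h5 : 0 ≤ δ⁻¹ ^ k := by positivity
  calc C * δ⁻¹ ^ k * (√(1 + volume.real (kQ 1 (ptO d))) * R)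
      = C * √(1 + volume.real (kQ 1 (ptO d))) * δ⁻¹ ^ k * R := by ring
    _ ≤ _ := by
      gcongr
      linarith

end Kinetic

open MeasureTheory ENNReal Set in
/-- **Lemma 3.6**: interior bounds on higher derivatives for solutions of the model
equation with a time-dependent source. -/
theorem interior_derivative_bounds (d : ℕ) (hd : 1 ≤ d) (j l m : ℕ) (hj : j ≤ 1)
    (hjlm : 1 ≤ j + l + m) :
    ∃ θ : ℝ, 0 < θ ∧ ∃ N : ℝ, 0 < N ∧
      ∀ δ : ℝ, δ ∈ Set.Ioo (0:ℝ) 1 →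
      ∀ a : ℝ → Matrix (Fin d) (Fin d) ℝ,
        (∀ i i', Measurable fun t => a t i i') → (∀ t : ℝ, elliptic δ (a t)) →
      ∀ χ : ℝ → ℝ, Measurable χ →
      ∀ u : Pt d → ℝ,
        (∀ t ∈ Set.Ioo (-4:ℝ) 0, ContDiff ℝ (⊤ : ℕ∞) (fun p : Ed d × Ed d => u (t, p.1, p.2))) →
        (∀ l' m' : ℕ, ∀ z ∈ Set.Ioo (-4:ℝ) 0 ×ˢ (Set.univ : Set (Ed d × Ed d)),
          DifferentiableAt ℝ (fun s => Dmix l' m' u (s, z.2.1, z.2.2)) z.1) →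
        (∀ l' m' : ℕ,
          ContinuousOn (fun z => Dmix l' m' u z)
            (Set.Ioo (-4:ℝ) 0 ×ˢ (Set.univ : Set (Ed d × Ed d))) ∧
          ContinuousOn (fun z => DtMix l' m' u z)
            (Set.Ioo (-4:ℝ) 0 ×ˢ (Set.univ : Set (Ed d × Ed d)))) →
        (∀ l' m' : ℕ, ∀ s : ℝ, 0 < s →
          IntegrableOn (fun z => ‖Dmix l' m' u z‖ ^ 2)
            (Set.Ioo (-4:ℝ) 0 ×ˢ (Metric.ball (0 : Ed d) s ×ˢ Metric.ball (0 : Ed d) s)) ∧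
          IntegrableOn (fun z => ‖DtMix l' m' u z‖ ^ 2)
            (Set.Ioo (-4:ℝ) 0 ×ˢ (Metric.ball (0 : Ed d) s ×ˢ Metric.ball (0 : Ed d) s))) →
        (∀ z : Pt d, z.1 ∈ Set.Ioo (-1:ℝ) 0 → ‖z.2.2‖ < 1 → P0op a u z = χ z.1) →
        supNorm (kQ (1/2) (ptO d))
            (fun z => if j = 0 then Dmix l (m + 2) u z else DtMix l (m + 2) u z) ≤
          ENNReal.ofReal (N * δ ^ (-θ) *
            (oscL2 (kQ 1 (ptO d)) (fun z => Dvv u z) +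
              l2 (kQ 1 (ptO d)) (fun z => Dx u z))) := by
  have key : ∃ θ : ℝ, 0 < θ ∧ ∃ N : ℝ, 0 < N ∧ ∀ δ a u χ c R, 0 ≤ R → Kinetic.Classical u →
      Kinetic.Setup δ a (Kinetic.slice u) χ c ((1 + volume.real (kQ 1 (ptO d))) * R ^ 2) →
      supNorm (kQ (1 / 2) (ptO d))
        (fun z => if j = 0 then Dmix l (m + 2) u z else DtMix l (m + 2) u z) ≤
        ENNReal.ofReal (N * δ ^ (-θ) * R) := by
    rcases Nat.le_one_iff_eq_zero_or_eq_one.1 hj with rfl | rfl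
    · simp only [if_true]
      exact Kinetic.exists_supNorm_bound (W := fun u z => Dmix l (m + 2) u z)
        (Q := fun I J _ U T p => Kinetic.pdList (Kinetic.mixList I J) (U T) p)
        (fun I J => (Kinetic.mixList_relevant (by omega) I J).bounded)
        fun u hu t ht p _ I J => hu.component_eq ht I J p
    · simp only [one_ne_zero, if_false]
      exact Kinetic.exists_supNorm_bound (W := fun u z => DtMix l (m + 2) u z)
        (Q := fun I J _ U T p =>
          Kinetic.dt (fun t => Kinetic.pdList (Kinetic.mixList I J) (U t)) T p)
        (fun I J => Kinetic.bounded_dt_pdList (by simp [Kinetic.mixList]))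
        fun u hu t ht p _ I J => hu.component_dt ht I J p
  obtain ⟨θ, hθ, N, hN, h⟩ := key
  refine ⟨θ, hθ, N, hN, fun δ hδ a _ ha χ _ u hsmooth hdiff hcont hInt hsol => ?_⟩
  have hu : Kinetic.Classical u := ⟨hsmooth, hdiff, hcont⟩
  exact h δ a u χ _ _ (add_nonneg (Real.sqrt_nonneg _) (Real.sqrt_nonneg _)) hu
    (hu.setup (fun l m => (hInt l m 1 one_pos).1) hδ ha hsol)
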